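/- There exists N such that for every n ∈ 3ℤ with n ≥ N the following holds: if H is a (1,3)-partite 4-graph with partition classes Q, P such that 3|Q| = |P| = n, and d_H({u, v}) ≥ C(n−1, 2) − C(2n/3, 2) + 1 for all u ∈ P and v ∈ Q, then H has a perfect matching. -/

import Mathlib

namespace PM13
open Finset
set_option linter.unusedSectionVars false
set_option linter.unusedVariables false

/-- A (1,3)-partite system given by a symmetric relation. -/
structure Sys {V : Type} (Q P : Finset V) (R : V → V → V → V → Prop) : Prop where
  disj : Disjoint Q P
  mem : ∀ q x y z, R q x y z → q ∈ Q ∧ x ∈ P ∧ y ∈ P ∧ z ∈ P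
  ne : ∀ q x y z, R q x y z → x ≠ y ∧ x ≠ z ∧ y ≠ z
  sw1 : ∀ q x y z, R q x y z → R q y x z
  sw2 : ∀ q x y z, R q x y z → R q x z y

def IsEdge {V : Type} [DecidableEq V] (R : V → V → V → V → Prop) (e : Finset V) : Prop :=
  ∃ q x y z, R q x y z ∧ e = {q, x, y, z}

/-- `S` is the union of `k` pairwise disjoint edges. -/
def Til {V : Type} [DecidableEq V] (R : V → V → V → V → Prop) (k : ℕ) (S : Finset V) : Prop :=
  ∃ M : Finset (Finset V), (∀ e ∈ M, IsEdge R e) ∧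
    (∀ e ∈ M, ∀ f ∈ M, e ≠ f → Disjoint e f) ∧ M.card = k ∧ M.biUnion id = S

section basic
variable {V : Type} [DecidableEq V] {R : V → V → V → V → Prop}

lemma Til.nil : Til R 0 ∅ := ⟨∅, by simp, by simp, by simp, by simp⟩

lemma IsEdge.nonempty {e : Finset V} (h : IsEdge R e) : e.Nonempty := by
  obtain ⟨q, x, y, z, _, rfl⟩ := h
  exact ⟨q, by simp⟩

lemma Til.union {k l : ℕ} {S T : Finset V} (hS : Til R k S) (hT : Til R l T) (hd : Disjoint S T) :
    Til R (k + l) (S ∪ T) := by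
  obtain ⟨M, h1, h2, h3, h4⟩ := hS
  obtain ⟨M', h1', h2', h3', h4'⟩ := hT
  have hsub : ∀ e ∈ M, e ⊆ S := fun e he => h4 ▸ subset_biUnion_of_mem id he
  have hsub' : ∀ e ∈ M', e ⊆ T := fun e he => h4' ▸ subset_biUnion_of_mem id he
  have hdd : ∀ e ∈ M, ∀ f ∈ M', Disjoint e f := fun e he f hf =>
    disjoint_of_subset_left (hsub e he) (disjoint_of_subset_right (hsub' f hf) hd)
  refine ⟨M ∪ M', ?_, ?_, ?_, ?_⟩
  · intro e he
    rcases mem_union.1 he with h | h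
    exacts [h1 e h, h1' e h]
  · intro e he f hf hne
    rcases mem_union.1 he with h | h <;> rcases mem_union.1 hf with h' | h'
    · exact h2 e h f h' hne
    · exact hdd e h f h'
    · exact (hdd f h' e h).symm
    · exact h2' e h f h' hne
  · rw [card_union_of_disjoint, h3, h3']
    rw [Finset.disjoint_left]
    intro e he he'
    have := hdd e he e he'
    rw [disjoint_self_iff_empty] at this
    exact (h1 e he).nonempty.ne_empty this
  · rw [union_biUnion, h4, h4']

lemma Til.single {q x y z : V} (h : R q x y z) : Til R 1 {q, x, y, z} :=
  ⟨{{q, x, y, z}}, by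
    intro e he
    rw [mem_singleton] at he
    exact ⟨q, x, y, z, h, he⟩, by
    intro e he f hf hne
    rw [mem_singleton] at he hf
    exact absurd (he.trans hf.symm) hne, by simp, by simp⟩

lemma Til.mono {R' : V → V → V → V → Prop} (hR : ∀ q x y z, R q x y z → R' q x y z) {k : ℕ}
    {S : Finset V} (h : Til R k S) : Til R' k S := by
  obtain ⟨M, h1, h2, h3, h4⟩ := h
  refine ⟨M, fun e he => ?_, h2, h3, h4⟩
  obtain ⟨q, x, y, z, hr, rfl⟩ := h1 e he
  exact ⟨q, x, y, z, hR _ _ _ _ hr, rfl⟩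

variable {Q P : Finset V}

lemma IsEdge.cards (hs : Sys Q P R) {e : Finset V} (h : IsEdge R e) :
    (e ∩ Q).card = 1 ∧ (e ∩ P).card = 3 ∧ e ⊆ Q ∪ P := by
  obtain ⟨q, x, y, z, hr, rfl⟩ := h
  obtain ⟨hq, hx, hy, hz⟩ := hs.mem _ _ _ _ hr
  obtain ⟨h1, h2, h3⟩ := hs.ne _ _ _ _ hr
  have hqP : q ∉ P := fun h => Finset.disjoint_left.1 hs.disj hq h
  have hx' : x ∉ Q := fun h => Finset.disjoint_left.1 hs.disj h hx
  have hy' : y ∉ Q := fun h => Finset.disjoint_left.1 hs.disj h hy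
  have hz' : z ∉ Q := fun h => Finset.disjoint_left.1 hs.disj h hz
  refine ⟨?_, ?_, ?_⟩
  · have : ({q, x, y, z} : Finset V) ∩ Q = {q} := by
      ext v; simp only [mem_inter, mem_insert, mem_singleton]; grind
    rw [this, card_singleton]
  · have : ({q, x, y, z} : Finset V) ∩ P = {x, y, z} := by
      ext v; simp only [mem_inter, mem_insert, mem_singleton]; grind
    rw [this, card_eq_three]
    exact ⟨x, y, z, h1, h2, h3, rfl⟩
  · intro v; simp only [mem_union, mem_insert, mem_singleton]; grind

lemma Til.cards (hs : Sys Q P R) {k : ℕ} {S : Finset V} (h : Til R k S) :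
    (S ∩ Q).card = k ∧ (S ∩ P).card = 3 * k ∧ S ⊆ Q ∪ P := by
  obtain ⟨M, h1, h2, h3, h4⟩ := h
  subst h4
  refine ⟨?_, ?_, ?_⟩
  · rw [biUnion_inter, card_biUnion]
    · simp only [id]
      rw [sum_congr rfl (fun e he => ((h1 e he).cards hs).1)]; simp [h3]
    · intro e he f hf hne
      exact disjoint_of_subset_left inter_subset_left
        (disjoint_of_subset_right inter_subset_left (h2 e he f hf hne))
  · rw [biUnion_inter, card_biUnion]
    · simp only [id]
      rw [sum_congr rfl (fun e he => ((h1 e he).cards hs).2.1)]; simp [h3, mul_comm]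
    · intro e he f hf hne
      exact disjoint_of_subset_left inter_subset_left
        (disjoint_of_subset_right inter_subset_left (h2 e he f hf hne))
  · exact biUnion_subset.2 (fun e he => ((h1 e he).cards hs).2.2)

lemma Sys.rot (hs : Sys Q P R) {q x y z : V} (h : R q x y z) : R q y z x :=
  hs.sw2 _ _ _ _ (hs.sw1 _ _ _ _ h)

lemma Sys.rot' (hs : Sys Q P R) {q x y z : V} (h : R q x y z) : R q z x y :=
  hs.sw1 _ _ _ _ (hs.sw2 _ _ _ _ h)

end basic


/-! ### Counting with predicates -/

open Classical in
/-- the finset of elements satisfying a predicate -/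
noncomputable def FS {α : Type*} [Fintype α] (p : α → Prop) : Finset α := univ.filter p

/-- the number of elements satisfying a predicate -/
noncomputable def cn {α : Type*} [Fintype α] (p : α → Prop) : ℕ := (FS p).card

section counting
variable {α β : Type*} [Fintype α] [Fintype β]

@[simp] lemma mem_FS {p : α → Prop} {a : α} : a ∈ FS p ↔ p a := by simp [FS]

lemma cn_mono {p q : α → Prop} (h : ∀ a, p a → q a) : cn p ≤ cn q :=
  card_le_card (fun a ha => by simp at ha ⊢; exact h a ha)

lemma cn_congr {p q : α → Prop} (h : ∀ a, p a ↔ q a) : cn p = cn q :=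
  le_antisymm (cn_mono fun a => (h a).1) (cn_mono fun a => (h a).2)

lemma cn_inj {p : α → Prop} {q : β → Prop} (f : α → β) (hf : ∀ a, p a → q (f a))
    (hi : ∀ a b, p a → p b → f a = f b → a = b) : cn p ≤ cn q := by
  refine card_le_card_of_injOn f ?_ ?_
  · intro a ha
    have : p a := by simpa using ha
    simpa using hf a this
  · intro a ha b hb h
    exact hi a b (by simpa using ha) (by simpa using hb) h

lemma cn_or (p q : α → Prop) : cn (fun a => p a ∨ q a) ≤ cn p + cn q := by
  classical
  have : FS (fun a => p a ∨ q a) ⊆ FS p ∪ FS q := by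
    intro a; simp
  exact (card_le_card this).trans (card_union_le _ _)

lemma cn_cover {p q r : α → Prop} (h : ∀ a, p a → q a ∨ r a) : cn p ≤ cn q + cn r :=
  (cn_mono h).trans (cn_or q r)

lemma cn_not (p : α → Prop) : cn p + cn (fun a => ¬ p a) = Fintype.card α := by
  classical
  have := card_filter_add_card_filter_not (s := (univ : Finset α)) p
  rw [card_univ] at this
  rw [← this]
  unfold cn FS
  congr!

lemma cn_le_card (p : α → Prop) : cn p ≤ Fintype.card α := card_le_univ _

lemma cn_pos {p : α → Prop} (h : 0 < cn p) : ∃ a, p a := by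
  obtain ⟨a, ha⟩ := card_pos.1 h
  exact ⟨a, by simpa using ha⟩

lemma cn_exists {p q : α → Prop} (h : cn q < cn p) : ∃ a, p a ∧ ¬ q a := by
  by_contra hc
  push Not at hc
  exact absurd (cn_mono hc) (not_le.2 h)

lemma cn_mem (s : Finset α) : cn (fun a => a ∈ s) = s.card := by
  unfold cn; congr 1; ext; simp

lemma cn_eq_sum (p : α → Prop) [DecidablePred p] : cn p = ∑ a, if p a then 1 else 0 := by
  rw [sum_boole]; unfold cn FS; simp; congr!

lemma cn_prod (p : α × β → Prop) : cn p = ∑ a, cn (fun b => p (a, b)) := by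
  classical
  rw [cn_eq_sum, Fintype.sum_prod_type]
  exact sum_congr rfl (fun a _ => (cn_eq_sum _).symm)

lemma cn_prod' (p : α × β → Prop) : cn p = ∑ b, cn (fun a => p (a, b)) := by
  classical
  rw [cn_eq_sum, Fintype.sum_prod_type_right]
  exact sum_congr rfl (fun a _ => (cn_eq_sum _).symm)

lemma cn_and_prod (p : α → Prop) (q : β → Prop) :
    cn (fun x : α × β => p x.1 ∧ q x.2) = cn p * cn q := by
  unfold cn
  rw [← card_product]
  congr 1; ext; simp

lemma cn_equiv (e : α ≃ β) (p : β → Prop) : cn (fun a => p (e a)) = cn p :=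
  le_antisymm (cn_inj e (fun _ h => h) (fun _ _ _ _ h => e.injective h))
    (cn_inj e.symm (fun b h => by simpa using h) (fun _ _ _ _ h => e.symm.injective h))

/-- fibred lower bound -/
lemma cn_prod_ge {p : α × β → Prop} (s : Finset α) (m : ℕ)
    (h : ∀ a ∈ s, m ≤ cn (fun b => p (a, b))) : s.card * m ≤ cn p := by
  rw [cn_prod, ← smul_eq_mul]
  refine (card_nsmul_le_sum s _ m h).trans ?_
  exact sum_le_sum_of_subset (subset_univ _)

/-- fibred upper bound -/
lemma cn_prod_le {p : α × β → Prop} (s : Finset α) (m : ℕ) (hs : ∀ a b, p (a, b) → a ∈ s)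
    (h : ∀ a ∈ s, cn (fun b => p (a, b)) ≤ m) : cn p ≤ s.card * m := by
  rw [cn_prod, ← smul_eq_mul]
  rw [← sum_subset (subset_univ s)]
  · exact sum_le_card_nsmul s _ m h
  · intro a _ ha
    by_contra hne
    obtain ⟨b, hb⟩ := cn_pos (Nat.pos_of_ne_zero hne)
    exact ha (hs a b hb)

end counting

/-- almost complete 4-partite case -/
lemma latin (t : ℕ) (R : Fin t → Fin t → Fin t → Fin t → Prop) (m : ℕ)
    (h1 : ∀ a, (cn fun p : Fin t × Fin t × Fin t => ¬ R a p.1 p.2.1 p.2.2) ≤ m)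
    (h2 : ∀ a, (cn fun p : Fin t × Fin t × Fin t => ¬ R p.2.2 a p.1 p.2.1) ≤ m)
    (h3 : ∀ a, (cn fun p : Fin t × Fin t × Fin t => ¬ R p.2.1 p.2.2 a p.1) ≤ m)
    (h4 : ∀ a, (cn fun p : Fin t × Fin t × Fin t => ¬ R p.1 p.2.1 p.2.2 a) ≤ m)
    (hm : 4 * m + 6 * t ^ 2 < t ^ 3) :
    ∃ s2 s3 s4 : Equiv.Perm (Fin t), ∀ i, R i (s2 i) (s3 i) (s4 i) := by
  obtain ⟨⟨s2, s3, s4⟩, hmax⟩ := Finite.exists_max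
    (fun s : Equiv.Perm (Fin t) × Equiv.Perm (Fin t) × Equiv.Perm (Fin t) =>
      cn fun i => R i (s.1 i) (s.2.1 i) (s.2.2 i))
  refine ⟨s2, s3, s4, ?_⟩
  by_contra hcon
  push Not at hcon
  obtain ⟨o, ho⟩ := hcon
  let T := Fin t × Fin t × Fin t
  have c1 : cn (fun p : T => ¬ R o (s2 p.1) (s3 p.2.1) (s4 p.2.2)) ≤ m :=
    (cn_equiv (Equiv.prodCongr s2 (Equiv.prodCongr s3 s4)) _).trans_le (h1 o)
  have c2 : cn (fun p : T => ¬ R p.1 (s2 p.2.1) (s3 p.2.2) (s4 o)) ≤ m :=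
    (cn_equiv (Equiv.prodCongr (Equiv.refl _) (Equiv.prodCongr s2 s3)) _).trans_le (h4 (s4 o))
  have c3 : cn (fun p : T => ¬ R p.2.1 (s2 p.2.2) (s3 o) (s4 p.1)) ≤ m :=
    (cn_equiv (Equiv.prodCongr s4 (Equiv.prodCongr (Equiv.refl _) s2)) _).trans_le (h3 (s3 o))
  have c4 : cn (fun p : T => ¬ R p.2.2 (s2 o) (s3 p.1) (s4 p.2.1)) ≤ m :=
    (cn_equiv (Equiv.prodCongr s3 (Equiv.prodCongr s4 (Equiv.refl _))) _).trans_le (h2 (s2 o))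
  have cd : ∀ (F : T → Prop) (g : T → Fin t × Fin t), (∀ p p', F p → F p' → g p = g p' → p = p') →
      cn F ≤ t ^ 2 := by
    intro F g hg
    have : cn F ≤ cn (fun _ : Fin t × Fin t => True) := cn_inj g (fun _ _ => trivial) hg
    refine this.trans ((cn_le_card _).trans ?_)
    simp [sq]
  have d1 := cd (fun p => p.1 = o) (fun p => p.2) (by
    rintro ⟨a, b, c⟩ ⟨a', b', c'⟩ h h' hh; simp_all)
  have d2 := cd (fun p => p.2.1 = o) (fun p => (p.1, p.2.2)) (by
    rintro ⟨a, b, c⟩ ⟨a', b', c'⟩ h h' hh; simp_all)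
  have d3 := cd (fun p => p.2.2 = o) (fun p => (p.1, p.2.1)) (by
    rintro ⟨a, b, c⟩ ⟨a', b', c'⟩ h h' hh; simp_all)
  have d4 := cd (fun p => p.1 = p.2.1) (fun p => (p.1, p.2.2)) (by
    rintro ⟨a, b, c⟩ ⟨a', b', c'⟩ h h' hh; simp_all)
  have d5 := cd (fun p => p.1 = p.2.2) (fun p => (p.1, p.2.1)) (by
    rintro ⟨a, b, c⟩ ⟨a', b', c'⟩ h h' hh; simp_all)
  have d6 := cd (fun p => p.2.1 = p.2.2) (fun p => (p.1, p.2.1)) (by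
    rintro ⟨a, b, c⟩ ⟨a', b', c'⟩ h h' hh; simp_all)
  have hex : ∃ p : T, R o (s2 p.1) (s3 p.2.1) (s4 p.2.2) ∧ R p.1 (s2 p.2.1) (s3 p.2.2) (s4 o) ∧
      R p.2.1 (s2 p.2.2) (s3 o) (s4 p.1) ∧ R p.2.2 (s2 o) (s3 p.1) (s4 p.2.1) ∧
      p.1 ≠ o ∧ p.2.1 ≠ o ∧ p.2.2 ≠ o ∧ p.1 ≠ p.2.1 ∧ p.1 ≠ p.2.2 ∧ p.2.1 ≠ p.2.2 := by
    by_contra hno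
    push Not at hno
    have hT : cn (fun _ : T => True) = t ^ 3 := by
      simp [cn, FS, T]; ring
    have a1 := cn_cover (p := fun _ : T => True)
      (q := fun p : T => ¬ R o (s2 p.1) (s3 p.2.1) (s4 p.2.2)) (fun p _ => Or.symm (em _))
    have a2 := cn_cover (p := fun p : T => R o (s2 p.1) (s3 p.2.1) (s4 p.2.2))
      (q := fun p : T => ¬ R p.1 (s2 p.2.1) (s3 p.2.2) (s4 o))
      (r := fun p : T => R o (s2 p.1) (s3 p.2.1) (s4 p.2.2) ∧ R p.1 (s2 p.2.1) (s3 p.2.2) (s4 o))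
      (fun p _ => by tauto)
    have a3 := cn_cover
      (p := fun p : T => R o (s2 p.1) (s3 p.2.1) (s4 p.2.2) ∧ R p.1 (s2 p.2.1) (s3 p.2.2) (s4 o))
      (q := fun p : T => ¬ R p.2.1 (s2 p.2.2) (s3 o) (s4 p.1))
      (r := fun p : T => R o (s2 p.1) (s3 p.2.1) (s4 p.2.2) ∧ R p.1 (s2 p.2.1) (s3 p.2.2) (s4 o) ∧
        R p.2.1 (s2 p.2.2) (s3 o) (s4 p.1))
      (fun p _ => by tauto)
    have a4 := cn_cover
      (p := fun p : T => R o (s2 p.1) (s3 p.2.1) (s4 p.2.2) ∧ R p.1 (s2 p.2.1) (s3 p.2.2) (s4 o) ∧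
        R p.2.1 (s2 p.2.2) (s3 o) (s4 p.1))
      (q := fun p : T => ¬ R p.2.2 (s2 o) (s3 p.1) (s4 p.2.1))
      (r := fun p : T => p.1 = o ∨ p.2.1 = o ∨ p.2.2 = o ∨ p.1 = p.2.1 ∨ p.1 = p.2.2 ∨ p.2.1 = p.2.2)
      (fun p _ => by have := hno p; tauto)
    have e1 := cn_or (fun p : T => p.1 = o)
      (fun p : T => p.2.1 = o ∨ p.2.2 = o ∨ p.1 = p.2.1 ∨ p.1 = p.2.2 ∨ p.2.1 = p.2.2)
    have e2 := cn_or (fun p : T => p.2.1 = o)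
      (fun p : T => p.2.2 = o ∨ p.1 = p.2.1 ∨ p.1 = p.2.2 ∨ p.2.1 = p.2.2)
    have e3 := cn_or (fun p : T => p.2.2 = o)
      (fun p : T => p.1 = p.2.1 ∨ p.1 = p.2.2 ∨ p.2.1 = p.2.2)
    have e4 := cn_or (fun p : T => p.1 = p.2.1) (fun p : T => p.1 = p.2.2 ∨ p.2.1 = p.2.2)
    have e5 := cn_or (fun p : T => p.1 = p.2.2) (fun p : T => p.2.1 = p.2.2)
    omega
  obtain ⟨⟨i, j, k⟩, r1, r2, r3, r4, hi, hj, hk, hij, hik, hjk⟩ := hex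
  simp only at r1 r2 r3 r4 hi hj hk hij hik hjk
  let c : Equiv.Perm (Fin t) := Equiv.swap o i * Equiv.swap i j * Equiv.swap j k
  have co : c o = i := by
    simp only [c, Equiv.Perm.mul_apply]
    rw [Equiv.swap_apply_of_ne_of_ne hj.symm hk.symm, Equiv.swap_apply_of_ne_of_ne hi.symm hj.symm,
      Equiv.swap_apply_left]
  have ci : c i = j := by
    simp only [c, Equiv.Perm.mul_apply]
    rw [Equiv.swap_apply_of_ne_of_ne hij hik, Equiv.swap_apply_left,
      Equiv.swap_apply_of_ne_of_ne hj hij.symm]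
  have cj : c j = k := by
    simp only [c, Equiv.Perm.mul_apply]
    rw [Equiv.swap_apply_left, Equiv.swap_apply_of_ne_of_ne hik.symm hjk.symm,
      Equiv.swap_apply_of_ne_of_ne hk hik.symm]
  have ck : c k = o := by
    simp only [c, Equiv.Perm.mul_apply]
    rw [Equiv.swap_apply_right, Equiv.swap_apply_right, Equiv.swap_apply_right]
  have cx : ∀ x, x ≠ o → x ≠ i → x ≠ j → x ≠ k → c x = x := by
    intro x a1 a2 a3 a4
    simp only [c, Equiv.Perm.mul_apply]
    rw [Equiv.swap_apply_of_ne_of_ne a3 a4, Equiv.swap_apply_of_ne_of_ne a2 a3,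
      Equiv.swap_apply_of_ne_of_ne a1 a2]
  have hlt := hmax (s2 * c, s3 * c * c, s4 * c * c * c)
  refine absurd hlt (not_le.2 (card_lt_card ?_))
  rw [Finset.ssubset_iff_of_subset]
  · refine ⟨o, ?_, ?_⟩
    · simp only [mem_FS, Equiv.Perm.mul_apply, co, ci, cj]
      exact r1
    · simpa using ho
  · intro x hx
    simp only [mem_FS, Equiv.Perm.mul_apply] at hx ⊢
    by_cases xo : x = o
    · subst xo; rw [co, ci, cj]; exact r1
    by_cases xi : x = i
    · subst xi; rw [ci, cj, ck]; exact r2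
    by_cases xj : x = j
    · subst xj; rw [cj, ck, co]; exact r3
    by_cases xk : x = k
    · subst xk; rw [ck, co, ci]; exact r4
    rw [cx x xo xi xj xk, cx x xo xi xj xk, cx x xo xi xj xk]
    exact hx

end PM13


namespace PM13
open Finset
set_option linter.unusedSectionVars false
set_option linter.unusedVariables false

/-! ### Absorption -/

section counting2
variable {α β : Type*} [Fintype α] [Fintype β]

lemma cn_ex_le {ι : Type*} [Fintype ι] (p : ι → α → Prop) :
    cn (fun a => ∃ i, p i a) ≤ ∑ i, cn (p i) := by
  classical
  have : FS (fun a => ∃ i, p i a) ⊆ (univ : Finset ι).biUnion (fun i => FS (p i)) := by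
    intro a; simp
  exact (card_le_card this).trans card_biUnion_le

lemma cn_and_or {p q r : α → Prop} (h : ∀ a, p a ∨ q a → r a) :
    cn p + cn q ≤ cn (fun a => p a ∧ q a) + cn r := by
  classical
  have h1 := card_union_add_card_inter (FS p) (FS q)
  have h2 : (FS p ∪ FS q).card ≤ cn r := card_le_card (fun a ha => by
    simp only [mem_union, mem_FS] at ha ⊢; exact h a ha)
  have h3 : (FS p ∩ FS q).card ≤ cn (fun a => p a ∧ q a) := card_le_card (fun a ha => by
    simpa using ha)
  unfold cn at *
  omega

lemma bad_tuples {V : Type*} [Fintype V] (k : ℕ) (X : Finset V) :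
    cn (fun f : Fin (k + 1) → V => (∃ i, f i ∈ X) ∨ ¬ Function.Injective f) ≤
      ((k + 1) * X.card + (k + 1) * (k + 1)) * Fintype.card V ^ k := by
  have hV : cn (fun f : Fin k → V => True) ≤ Fintype.card V ^ k := by
    refine (cn_le_card _).trans ?_
    simp
  have h1 : ∀ i, cn (fun f : Fin (k + 1) → V => f i ∈ X) ≤ X.card * Fintype.card V ^ k := by
    intro i
    have : cn (fun f : Fin (k + 1) → V => f i ∈ X) ≤
        cn (fun x : V × (Fin k → V) => x.1 ∈ X ∧ True) := by
      refine cn_inj (fun f => (f i, fun j => f (i.succAbove j))) (fun f h => ⟨h, trivial⟩) ?_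
      intro f g _ _ h
      simp only [Prod.mk.injEq] at h
      funext j
      rcases Fin.eq_self_or_eq_succAbove i j with rfl | ⟨j', rfl⟩
      · exact h.1
      · exact congrFun h.2 j'
    rw [cn_and_prod (fun v => v ∈ X) (fun _ => True), cn_mem] at this
    exact this.trans (Nat.mul_le_mul_left _ hV)
  have h2 : ∀ p : Fin (k + 1) × Fin (k + 1), cn (fun f : Fin (k + 1) → V => p.1 ≠ p.2 ∧ f p.1 = f p.2) ≤
      Fintype.card V ^ k := by
    rintro ⟨i, j⟩
    refine le_trans ?_ hV
    refine cn_inj (fun f => fun j => f (i.succAbove j)) (fun f h => trivial) ?_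
    rintro f g ⟨hij, hf⟩ ⟨_, hg⟩ h
    simp only at hij hf hg
    have hs : ∀ l, l ≠ i → f l = g l := by
      intro l hl
      obtain ⟨j', rfl⟩ := Fin.exists_succAbove_eq hl
      exact congrFun h j'
    funext l
    by_cases hl : l = i
    · subst hl; rw [hf, hg]; exact hs j hij.symm
    · exact hs l hl
  have h3 := cn_cover (p := fun f : Fin (k + 1) → V => (∃ i, f i ∈ X) ∨ ¬ Function.Injective f)
    (q := fun f => ∃ i, f i ∈ X)
    (r := fun f => ∃ p : Fin (k + 1) × Fin (k + 1), p.1 ≠ p.2 ∧ f p.1 = f p.2) (by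
      rintro f (h | h)
      · exact Or.inl h
      · right
        simp only [Function.Injective] at h
        push Not at h
        obtain ⟨i, j, h1, h2⟩ := h
        exact ⟨(i, j), h2, h1⟩)
  have h4 := (cn_ex_le (fun (i : Fin (k + 1)) (f : Fin (k + 1) → V) => f i ∈ X)).trans
    (sum_le_card_nsmul _ _ _ (fun i _ => h1 i))
  have h5 := (cn_ex_le (fun (p : Fin (k + 1) × Fin (k + 1)) (f : Fin (k + 1) → V) =>
    p.1 ≠ p.2 ∧ f p.1 = f p.2)).trans (sum_le_card_nsmul _ _ _ (fun i _ => h2 i))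
  simp only [card_univ, Fintype.card_prod, Fintype.card_fin, smul_eq_mul] at h4 h5
  calc _ ≤ _ := h3
    _ ≤ _ := Nat.add_le_add h4 h5
    _ = _ := by ring

end counting2

/-- absorber tuples: a pair followed by two triples -/
abbrev A8 (V : Type) := (V × V) × ((V × V × V) × (V × V × V))

section absorb
variable {V : Type} [Fintype V] [DecidableEq V] {R : V → V → V → V → Prop} {Q P : Finset V}

def vts (A : A8 V) : Finset V :=
  {A.2.1.1, A.1.1, A.2.1.2.1, A.2.1.2.2} ∪ {A.2.2.1, A.1.2, A.2.2.2.1, A.2.2.2.2}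

def Ok (R : V → V → V → V → Prop) (A : A8 V) : Prop :=
  R A.2.1.1 A.1.1 A.2.1.2.1 A.2.1.2.2 ∧ R A.2.2.1 A.1.2 A.2.2.2.1 A.2.2.2.2 ∧
  Disjoint ({A.2.1.1, A.1.1, A.2.1.2.1, A.2.1.2.2} : Finset V)
    {A.2.2.1, A.1.2, A.2.2.2.1, A.2.2.2.2}

def Abs (R : V → V → V → V → Prop) (T : V × V × V × V) (A : A8 V) : Prop :=
  R T.1 T.2.1 A.1.1 A.1.2 ∧ R A.2.1.1 T.2.2.1 A.2.1.2.1 A.2.1.2.2 ∧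
  R A.2.2.1 T.2.2.2 A.2.2.2.1 A.2.2.2.2

lemma vts_card (A : A8 V) : (vts A).card ≤ 8 := by
  unfold vts
  exact (card_union_le _ _).trans (Nat.add_le_add card_le_four card_le_four)

lemma Ok.til {A : A8 V} (h : Ok R A) : Til R 2 (vts A) :=
  (Til.single h.1).union (Til.single h.2.1) h.2.2

lemma abs_til (hs : Sys Q P R) {A : A8 V} {t p1 p2 p3 : V} (h : Ok R A) (ha : Abs R (t, p1, p2, p3) A)
    (hd : Disjoint ({t, p1, p2, p3} : Finset V) (vts A)) (h12 : p1 ≠ p2) (h13 : p1 ≠ p3)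
    (h23 : p2 ≠ p3) : Til R 3 (vts A ∪ {t, p1, p2, p3}) := by
  obtain ⟨⟨u, u'⟩, ⟨q, a, b⟩, ⟨q', a', b'⟩⟩ := A
  obtain ⟨h1, h2, h3⟩ := h
  obtain ⟨g1, g2, g3⟩ := ha
  simp only at h1 h2 h3 g1 g2 g3
  have e1 := hs.mem _ _ _ _ h1
  have e2 := hs.mem _ _ _ _ h2
  have e3 := hs.mem _ _ _ _ g1
  have e4 := hs.mem _ _ _ _ g2
  have e5 := hs.mem _ _ _ _ g3
  have n1 := hs.ne _ _ _ _ h1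
  have n2 := hs.ne _ _ _ _ h2
  have dj : ∀ x y, x ∈ Q → y ∈ P → x ≠ y := by
    rintro x y hx hy rfl
    exact Finset.disjoint_left.1 hs.disj hx hy
  have key : Til R (1 + (1 + 1)) ({t, p1, u, u'} ∪ ({q, p2, a, b} ∪ {q', p3, a', b'})) := by
    simp only [vts, Finset.disjoint_left, mem_union, mem_insert, mem_singleton] at hd h3
    refine (Til.single g1).union ((Til.single g2).union (Til.single g3) ?_) ?_
    · rw [Finset.disjoint_left]
      simp only [mem_union, mem_insert, mem_singleton]
      grind
    · rw [Finset.disjoint_left]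
      simp only [mem_union, mem_insert, mem_singleton]
      grind
  have : vts ((u, u'), (q, a, b), (q', a', b')) ∪ {t, p1, p2, p3} =
      {t, p1, u, u'} ∪ ({q, p2, a, b} ∪ {q', p3, a', b'}) := by
    ext v
    simp only [vts, mem_union, mem_insert, mem_singleton]
    tauto
  rw [this]
  exact key

/-- many absorbers avoiding a small set -/
lemma many_abs {N : ℕ} (hs : Sys Q P R) (hQ : Q.card = N) (hP : P.card = 3 * N)
    (hV : Fintype.card V = 4 * N)
    (hdeg : ∀ q ∈ Q, ∀ u ∈ P, 5 * N ^ 2 ≤ 7 * N + cn (fun x : V × V => R q u x.1 x.2))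
    (hN : 28 ≤ N) (X : Finset V) (hX : 32768 * (8 * X.card + 64) ≤ N) {t p1 p2 p3 : V}
    (ht : t ∈ Q) (h1 : p1 ∈ P) (h2 : p2 ∈ P) (h3 : p3 ∈ P) :
    N ^ 8 ≤ 2 * cn (fun A : A8 V => Ok R A ∧ Disjoint (vts A) X ∧ Abs R (t, p1, p2, p3) A) := by
  have dj : ∀ x y, x ∈ Q → y ∈ P → x ≠ y := by
    rintro x y hx hy rfl
    exact Finset.disjoint_left.1 hs.disj hx hy
  have hf : ∀ u ∈ P, ∀ p ∈ P, N ^ 3 ≤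
      2 * cn (fun x : V × V × V => R x.1 u x.2.1 x.2.2 ∧ R x.1 p x.2.1 x.2.2) := by
    intro u hu p hp
    have : Q.card * ((N ^ 2 + 1) / 2) ≤
        cn (fun x : V × V × V => R x.1 u x.2.1 x.2.2 ∧ R x.1 p x.2.1 x.2.2) := by
      refine cn_prod_ge Q _ ?_
      intro q hq
      have a1 := hdeg q hq u hu
      have a2 := hdeg q hq p hp
      have a3 := cn_and_or (p := fun x : V × V => R q u x.1 x.2) (q := fun x : V × V => R q p x.1 x.2)
        (r := fun x : V × V => x.1 ∈ P ∧ x.2 ∈ P) (by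
          rintro x (h | h)
          · exact ⟨(hs.mem _ _ _ _ h).2.2.1, (hs.mem _ _ _ _ h).2.2.2⟩
          · exact ⟨(hs.mem _ _ _ _ h).2.2.1, (hs.mem _ _ _ _ h).2.2.2⟩)
      rw [cn_and_prod (fun v => v ∈ P) (fun v => v ∈ P), cn_mem, hP] at a3
      have : 28 * N ≤ N ^ 2 := by nlinarith
      have e : 3 * N * (3 * N) = 9 * N ^ 2 := by ring
      rw [e] at a3
      simp only
      omega
    rw [hQ] at this
    have e : N ^ 3 = N * N ^ 2 := by ring
    have e2 : N ^ 2 ≤ 2 * ((N ^ 2 + 1) / 2) := by omega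
    calc N ^ 3 = N * N ^ 2 := e
      _ ≤ N * (2 * ((N ^ 2 + 1) / 2)) := Nat.mul_le_mul_left _ e2
      _ = 2 * (N * ((N ^ 2 + 1) / 2)) := by ring
      _ ≤ _ := Nat.mul_le_mul_left _ this
  -- count all
  have hall : N ^ 8 ≤ cn (fun A : A8 V => (R A.2.1.1 A.1.1 A.2.1.2.1 A.2.1.2.2 ∧
      R A.2.2.1 A.1.2 A.2.2.2.1 A.2.2.2.2) ∧ Abs R (t, p1, p2, p3) A) := by
    have hu : 4 * N ^ 2 ≤ (FS (fun x : V × V => R t p1 x.1 x.2)).card := by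
      have a1 := hdeg t ht p1 h1
      have : 28 * N ≤ N ^ 2 := by nlinarith
      change 4 * N ^ 2 ≤ cn (fun x : V × V => R t p1 x.1 x.2)
      omega
    have := cn_prod_ge (p := fun A : A8 V => (R A.2.1.1 A.1.1 A.2.1.2.1 A.2.1.2.2 ∧
      R A.2.2.1 A.1.2 A.2.2.2.1 A.2.2.2.2) ∧ Abs R (t, p1, p2, p3) A)
      (FS (fun x : V × V => R t p1 x.1 x.2)) ((N ^ 6 + 3) / 4) (by
        rintro ⟨u, u'⟩ hu
        simp only [mem_FS] at hu
        have m := hs.mem _ _ _ _ hu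
        have b1 := hf u m.2.2.1 p2 h2
        have b2 := hf u' m.2.2.2 p3 h3
        have b3 := Nat.mul_le_mul b1 b2
        have b4 := cn_and_prod (fun x : V × V × V => R x.1 u x.2.1 x.2.2 ∧ R x.1 p2 x.2.1 x.2.2)
          (fun x : V × V × V => R x.1 u' x.2.1 x.2.2 ∧ R x.1 p3 x.2.1 x.2.2)
        have b5 : cn (fun x : (V × V × V) × (V × V × V) =>
          (R x.1.1 u x.1.2.1 x.1.2.2 ∧ R x.1.1 p2 x.1.2.1 x.1.2.2) ∧
          (R x.2.1 u' x.2.2.1 x.2.2.2 ∧ R x.2.1 p3 x.2.2.1 x.2.2.2)) ≤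
          cn (fun x : (V × V × V) × (V × V × V) => (R x.1.1 u x.1.2.1 x.1.2.2 ∧
            R x.2.1 u' x.2.2.1 x.2.2.2) ∧ Abs R (t, p1, p2, p3) ((u, u'), x)) := by
          refine cn_mono ?_
          rintro x ⟨⟨c1, c2⟩, c3, c4⟩
          exact ⟨⟨c1, c3⟩, hu, c2, c4⟩
        have e : N ^ 3 * N ^ 3 = N ^ 6 := by ring
        have e2 : ∀ a b : ℕ, 2 * a * (2 * b) = 4 * (a * b) := by intros; ring
        rw [e, e2, ← b4] at b3
        simp only
        omega)
    have e2 : N ^ 6 ≤ 4 * ((N ^ 6 + 3) / 4) := by omega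
    calc N ^ 8 = N ^ 2 * N ^ 6 := by ring
      _ ≤ N ^ 2 * (4 * ((N ^ 6 + 3) / 4)) := Nat.mul_le_mul_left _ e2
      _ = 4 * N ^ 2 * ((N ^ 6 + 3) / 4) := by ring
      _ ≤ _ := Nat.mul_le_mul_right _ hu
      _ ≤ _ := this
  have hcov := cn_cover (p := fun A : A8 V => (R A.2.1.1 A.1.1 A.2.1.2.1 A.2.1.2.2 ∧
      R A.2.2.1 A.1.2 A.2.2.2.1 A.2.2.2.2) ∧ Abs R (t, p1, p2, p3) A)
    (q := fun A : A8 V => Ok R A ∧ Disjoint (vts A) X ∧ Abs R (t, p1, p2, p3) A)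
    (r := fun A : A8 V => (∃ i, (![A.2.1.1, A.1.1, A.2.1.2.1, A.2.1.2.2, A.2.2.1, A.1.2, A.2.2.2.1,
      A.2.2.2.2] : Fin 8 → V) i ∈ X) ∨ ¬ Function.Injective (![A.2.1.1, A.1.1, A.2.1.2.1,
        A.2.1.2.2, A.2.2.1, A.1.2, A.2.2.2.1, A.2.2.2.2] : Fin 8 → V)) (by
      rintro A ⟨⟨c1, c2⟩, c3⟩
      by_cases hX' : ∃ i, (![A.2.1.1, A.1.1, A.2.1.2.1, A.2.1.2.2, A.2.2.1, A.1.2, A.2.2.2.1,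
        A.2.2.2.2] : Fin 8 → V) i ∈ X
      · exact Or.inr (Or.inl hX')
      by_cases hI : Function.Injective (![A.2.1.1, A.1.1, A.2.1.2.1,
        A.2.1.2.2, A.2.2.1, A.1.2, A.2.2.2.1, A.2.2.2.2] : Fin 8 → V)
      · left
        refine ⟨⟨c1, c2, ?_⟩, ?_, c3⟩
        · rw [Finset.disjoint_left]
          intro v hv hv'
          simp only [mem_insert, mem_singleton] at hv hv'
          have g : ∀ i j : Fin 8, i ≠ j → _ := fun i j hij => hI.ne hij
          rcases hv with rfl | rfl | rfl | rfl
          · rcases hv' with h | h | h | h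
            · exact g 0 4 (by decide) h
            · exact g 0 5 (by decide) h
            · exact g 0 6 (by decide) h
            · exact g 0 7 (by decide) h
          · rcases hv' with h | h | h | h
            · exact g 1 4 (by decide) h
            · exact g 1 5 (by decide) h
            · exact g 1 6 (by decide) h
            · exact g 1 7 (by decide) h
          · rcases hv' with h | h | h | h
            · exact g 2 4 (by decide) h
            · exact g 2 5 (by decide) h
            · exact g 2 6 (by decide) h
            · exact g 2 7 (by decide) h
          · rcases hv' with h | h | h | h
            · exact g 3 4 (by decide) h
            · exact g 3 5 (by decide) h
            · exact g 3 6 (by decide) h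
            · exact g 3 7 (by decide) h
        · push Not at hX'
          rw [Finset.disjoint_left]
          intro v hv
          simp only [vts, mem_union, mem_insert, mem_singleton] at hv
          rcases hv with (rfl | rfl | rfl | rfl) | (rfl | rfl | rfl | rfl)
          · exact hX' 0
          · exact hX' 1
          · exact hX' 2
          · exact hX' 3
          · exact hX' 4
          · exact hX' 5
          · exact hX' 6
          · exact hX' 7
      · exact Or.inr (Or.inr hI))
  have hinj : cn (fun A : A8 V => (∃ i, (![A.2.1.1, A.1.1, A.2.1.2.1, A.2.1.2.2, A.2.2.1, A.1.2, A.2.2.2.1,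
      A.2.2.2.2] : Fin 8 → V) i ∈ X) ∨ ¬ Function.Injective (![A.2.1.1, A.1.1, A.2.1.2.1,
        A.2.1.2.2, A.2.2.1, A.1.2, A.2.2.2.1, A.2.2.2.2] : Fin 8 → V)) ≤
      cn (fun f : Fin (7 + 1) → V => (∃ i, f i ∈ X) ∨ ¬ Function.Injective f) := by
    refine cn_inj (fun A : A8 V => (![A.2.1.1, A.1.1, A.2.1.2.1, A.2.1.2.2, A.2.2.1, A.1.2, A.2.2.2.1,
      A.2.2.2.2] : Fin 8 → V)) (fun A h => h) ?_
    rintro ⟨⟨u, u'⟩, ⟨q, a, b⟩, ⟨q', a', b'⟩⟩ ⟨⟨v, v'⟩, ⟨r, c, d⟩, ⟨r', c', d'⟩⟩ _ _ h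
    have g : ∀ i : Fin 8, _ := fun i => congrFun h i
    have g0 : q = r := g 0
    have g1 : u = v := g 1
    have g2 : a = c := g 2
    have g3 : b = d := g 3
    have g4 : q' = r' := g 4
    have g5 : u' = v' := g 5
    have g6 : a' = c' := g 6
    have g7 : b' = d' := g 7
    subst g0 g1 g2 g3 g4 g5 g6 g7
    rfl
  have hbad := bad_tuples 7 X
  rw [hV] at hbad
  have e : (4 * N) ^ 7 = 16384 * N ^ 7 := by ring
  rw [e] at hbad
  have hfin : 2 * (((7 + 1) * X.card + (7 + 1) * (7 + 1)) * (16384 * N ^ 7)) ≤ N ^ 8 := by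
    calc 2 * (((7 + 1) * X.card + (7 + 1) * (7 + 1)) * (16384 * N ^ 7))
        = 32768 * (8 * X.card + 64) * N ^ 7 := by ring
      _ ≤ N * N ^ 7 := Nat.mul_le_mul_right _ hX
      _ = N ^ 8 := by ring
  omega

end absorb
end PM13


namespace PM13
open Finset
set_option linter.unusedSectionVars false
set_option linter.unusedVariables false

open Classical in
lemma greedy_family {V α τ : Type} [DecidableEq V] [Fintype α] (TT : Finset τ) (hTT : TT.Nonempty)
    (rel : τ → α → Prop) (ok : α → Prop) (vt : α → Finset V) (hvne : ∀ A, (vt A).Nonempty)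
    (hv8 : ∀ A, (vt A).card ≤ 8) (c : ℝ) (hc : 0 < c) (s : ℕ) (hα : 0 < Fintype.card α)
    (H : ∀ X : Finset V, X.card ≤ 8 * s → ∀ T ∈ TT,
      2 * c * Fintype.card α ≤ cn (fun A => ok A ∧ Disjoint (vt A) X ∧ rel T A)) :
    ∀ j ≤ s, ∃ 𝒮 : Finset α, 𝒮.card = j ∧ (∀ A ∈ 𝒮, ok A) ∧
      (∀ A ∈ 𝒮, ∀ B ∈ 𝒮, A ≠ B → Disjoint (vt A) (vt B)) ∧
      ∑ T ∈ TT, (1 / 2 : ℝ) ^ (𝒮.filter (rel T)).card ≤ (1 - c) ^ j * TT.card := by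
  intro j
  induction j with
  | zero =>
    intro _
    exact ⟨∅, by simp, by simp, by simp, by simp⟩
  | succ j ih =>
    intro hj
    obtain ⟨𝒮, h1, h2, h3, h4⟩ := ih (by omega)
    set X := 𝒮.biUnion vt with hX
    have hXc : X.card ≤ 8 * s := by
      refine (card_biUnion_le_card_mul 𝒮 vt 8 (fun A _ => hv8 A)).trans ?_
      rw [h1]; nlinarith
    set w : τ → ℝ := fun T => (1 / 2 : ℝ) ^ (𝒮.filter (rel T)).card with hw
    have hwpos : ∀ T, 0 < w T := fun T => by positivity
    set W := ∑ T ∈ TT, w T with hW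
    have hWpos : 0 < W := sum_pos (fun T _ => hwpos T) hTT
    set 𝒜 : Finset α := FS (fun A => ok A ∧ Disjoint (vt A) X) with h𝒜
    have hcnt : ∀ T ∈ TT, 2 * c * Fintype.card α ≤ ((𝒜.filter (rel T)).card : ℝ) := by
      intro T hT
      refine (H X hXc T hT).trans ?_
      norm_cast
      apply card_le_card
      intro A
      simp only [mem_FS, mem_filter, h𝒜]
      tauto
    have hα' : (0 : ℝ) < Fintype.card α := by exact_mod_cast hα
    have hne : 𝒜.Nonempty := by
      obtain ⟨T, hT⟩ := hTT
      have := hcnt T hT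
      have h0 : (0 : ℝ) < ((𝒜.filter (rel T)).card : ℝ) := lt_of_lt_of_le (by positivity) this
      obtain ⟨A, hA⟩ := card_pos.1 (by exact_mod_cast h0)
      exact ⟨A, (mem_filter.1 hA).1⟩
    have hsum : ∑ A ∈ 𝒜, 2 * c * W ≤ ∑ A ∈ 𝒜, ∑ T ∈ TT, if rel T A then w T else 0 := by
      rw [sum_comm]
      calc ∑ A ∈ 𝒜, 2 * c * W = 𝒜.card * (2 * c * W) := by simp
        _ ≤ Fintype.card α * (2 * c * W) := by
            apply mul_le_mul_of_nonneg_right _ (by positivity)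
            exact_mod_cast card_le_univ 𝒜
        _ = ∑ T ∈ TT, (2 * c * Fintype.card α) * w T := by rw [← mul_sum]; ring
        _ ≤ _ := by
            apply sum_le_sum
            intro T hT
            rw [← sum_filter, sum_const, nsmul_eq_mul]
            exact mul_le_mul_of_nonneg_right (hcnt T hT) (hwpos T).le
    obtain ⟨A, hA, hAs⟩ := exists_le_of_sum_le hne hsum
    have hA' : ok A ∧ Disjoint (vt A) X := by simpa [h𝒜] using hA
    have hAn : A ∉ 𝒮 := by
      intro hmem
      have hsub : vt A ⊆ X := subset_biUnion_of_mem vt hmem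
      have := disjoint_of_subset_right hsub hA'.2
      rw [disjoint_self_iff_empty] at this
      exact (hvne A).ne_empty this
    have hdj : ∀ B ∈ 𝒮, Disjoint (vt A) (vt B) := fun B hB =>
      disjoint_of_subset_right (subset_biUnion_of_mem vt hB) hA'.2
    refine ⟨insert A 𝒮, by rw [card_insert_of_notMem hAn, h1], ?_, ?_, ?_⟩
    · intro B hB
      rcases mem_insert.1 hB with rfl | hB
      exacts [hA'.1, h2 B hB]
    · intro B hB C hC hne
      rcases mem_insert.1 hB with rfl | hB' <;> rcases mem_insert.1 hC with rfl | hC'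
      · exact absurd rfl hne
      · exact hdj C hC'
      · exact (hdj B hB').symm
      · exact h3 B hB' C hC' hne
    · have key : ∀ T ∈ TT, (1 / 2 : ℝ) ^ ((insert A 𝒮).filter (rel T)).card =
          w T - 1 / 2 * (if rel T A then w T else 0) := by
        intro T _
        rw [filter_insert]
        split_ifs with hr
        · rw [card_insert_of_notMem (by simp [hAn]), pow_succ]; simp only [hw]; ring
        · simp only [hw]; ring
      rw [sum_congr rfl key, sum_sub_distrib, ← mul_sum]
      have : W ≤ (1 - c) ^ j * TT.card := h4
      have hc1 : 0 ≤ 1 - c := by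
        have hle : ∑ T ∈ TT, (if rel T A then w T else 0) ≤ W :=
          sum_le_sum (fun T _ => by split_ifs; exacts [le_rfl, (hwpos T).le])
        have : 2 * c * W ≤ 1 * W := by linarith
        have := le_of_mul_le_mul_right this hWpos
        linarith
      rw [pow_succ]
      nlinarith [mul_le_mul_of_nonneg_left this hc1]

section
variable {V : Type} [Fintype V] [DecidableEq V] {Q P : Finset V} {R : V → V → V → V → Prop}

lemma til_family (𝒮 : Finset (A8 V)) (hok : ∀ A ∈ 𝒮, Ok R A)
    (hd : ∀ A ∈ 𝒮, ∀ B ∈ 𝒮, A ≠ B → Disjoint (vts A) (vts B)) :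
    Til R (2 * 𝒮.card) (𝒮.biUnion vts) := by
  classical
  induction 𝒮 using Finset.induction_on with
  | empty => simpa using Til.nil
  | insert A 𝒮 hA ih =>
    rw [card_insert_of_notMem hA, biUnion_insert]
    have h1 := ih (fun B hB => hok B (mem_insert_of_mem hB))
      (fun B hB C hC => hd B (mem_insert_of_mem hB) C (mem_insert_of_mem hC))
    have h2 := (hok A (mem_insert_self _ _)).til
    have := h2.union h1 (by
      rw [disjoint_biUnion_right]
      intro B hB
      exact hd A (mem_insert_self _ _) B (mem_insert_of_mem hB) (by rintro rfl; exact hA hB))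
    rwa [show 2 * (𝒮.card + 1) = 2 + 2 * 𝒮.card by ring]

lemma quad_cards (hs : Disjoint Q P) {t p1 p2 p3 : V} (ht : t ∈ Q) (m1 : p1 ∈ P) (m2 : p2 ∈ P)
    (m3 : p3 ∈ P) (h12 : p1 ≠ p2) (h13 : p1 ≠ p3) (h23 : p2 ≠ p3) :
    (({t, p1, p2, p3} : Finset V) ∩ Q).card = 1 ∧ (({t, p1, p2, p3} : Finset V) ∩ P).card = 3 := by
  have tP : t ∉ P := fun h => Finset.disjoint_left.1 hs ht h
  have pQ : ∀ x ∈ P, x ∉ Q := fun x hx h => Finset.disjoint_left.1 hs h hx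
  have := pQ p1 m1
  have := pQ p2 m2
  have := pQ p3 m3
  constructor
  · have : ({t, p1, p2, p3} : Finset V) ∩ Q = {t} := by
      ext v; simp only [mem_inter, mem_insert, mem_singleton]
      grind
    rw [this, card_singleton]
  · have : ({t, p1, p2, p3} : Finset V) ∩ P = {p1, p2, p3} := by
      ext v; simp only [mem_inter, mem_insert, mem_singleton]
      grind
    rw [this, card_eq_three]
    exact ⟨p1, p2, p3, h12, h13, h23, rfl⟩

lemma card_sdiff_inter {Z T : Finset V} (Q : Finset V) (h : T ⊆ Z) :
    ((Z \ T) ∩ Q).card + (T ∩ Q).card = (Z ∩ Q).card := by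
  rw [← card_union_of_disjoint, ← union_inter_distrib_right, sdiff_union_of_subset h]
  exact disjoint_of_subset_left inter_subset_left
    (disjoint_of_subset_right inter_subset_left sdiff_disjoint)

open Classical in
lemma absorb (hs : Sys Q P R) (ℓ : ℕ) : ∀ (𝒮 : Finset (A8 V)) (hok : ∀ A ∈ 𝒮, Ok R A)
    (hd : ∀ A ∈ 𝒮, ∀ B ∈ 𝒮, A ≠ B → Disjoint (vts A) (vts B))
    (hab : ∀ t ∈ Q, ∀ p1 ∈ P, ∀ p2 ∈ P, ∀ p3 ∈ P,
      ℓ ≤ (𝒮.filter (Abs R (t, p1, p2, p3))).card)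
    (Z : Finset V) (hZ : Disjoint Z (𝒮.biUnion vts)) (hZQ : Z ⊆ Q ∪ P)
    (hZ1 : (Z ∩ Q).card = ℓ) (hZ2 : (Z ∩ P).card = 3 * ℓ),
    ∃ k, Til R k (𝒮.biUnion vts ∪ Z) := by
  induction ℓ with
  | zero =>
    intro 𝒮 hok hd hab Z hZ hZQ hZ1 hZ2
    have : Z = ∅ := by
      rw [card_eq_zero] at hZ1
      simp only [Nat.mul_zero, card_eq_zero] at hZ2
      have : Z = Z ∩ Q ∪ Z ∩ P := by
        rw [← inter_union_distrib_left, inter_eq_left.2 hZQ]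
      rw [this, hZ1, hZ2]; simp
    subst this
    exact ⟨_, by rw [union_empty]; exact til_family 𝒮 hok hd⟩
  | succ ℓ ih =>
    intro 𝒮 hok hd hab Z hZ hZQ hZ1 hZ2
    obtain ⟨t, ht⟩ := card_pos.1 (by omega : 0 < (Z ∩ Q).card)
    obtain ⟨Y, hY, hYc⟩ := exists_subset_card_eq (by omega : 3 ≤ (Z ∩ P).card)
    obtain ⟨p1, p2, p3, h12, h13, h23, rfl⟩ := card_eq_three.1 hYc
    have hp : ∀ x ∈ ({p1, p2, p3} : Finset V), x ∈ Z ∧ x ∈ P := fun x hx => mem_inter.1 (hY hx)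
    have m1 := hp p1 (by simp)
    have m2 := hp p2 (by simp)
    have m3 := hp p3 (by simp)
    have mt := mem_inter.1 ht
    have hpos : 0 < (𝒮.filter (Abs R (t, p1, p2, p3))).card :=
      lt_of_lt_of_le (Nat.succ_pos _) (hab t mt.2 p1 m1.2 p2 m2.2 p3 m3.2)
    obtain ⟨A, hA⟩ := card_pos.1 hpos
    obtain ⟨hA1, hA2⟩ := mem_filter.1 hA
    have hvA : vts A ⊆ 𝒮.biUnion vts := subset_biUnion_of_mem vts hA1
    set T : Finset V := {t, p1, p2, p3} with hT
    have hTZ : T ⊆ Z := by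
      intro x hx
      simp only [hT, mem_insert, mem_singleton] at hx
      rcases hx with rfl | rfl | rfl | rfl
      exacts [mt.1, m1.1, m2.1, m3.1]
    have htil := abs_til hs (hok A hA1) hA2
      (disjoint_of_subset_left hTZ (disjoint_of_subset_right hvA hZ)) h12 h13 h23
    have hdis : Disjoint (vts A) ((𝒮.erase A).biUnion vts) := by
      rw [disjoint_biUnion_right]
      intro B hB
      exact hd A hA1 B (mem_of_mem_erase hB) (ne_of_mem_erase hB).symm
    have hsubE : (𝒮.erase A).biUnion vts ⊆ 𝒮.biUnion vts :=
      biUnion_subset_biUnion_of_subset_left _ (erase_subset _ _)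
    have tP : t ∉ P := fun h => Finset.disjoint_left.1 hs.disj mt.2 h
    have pQ : ∀ x ∈ P, x ∉ Q := fun x hx h => Finset.disjoint_left.1 hs.disj h hx
    obtain ⟨n1, n2⟩ := quad_cards hs.disj mt.2 m1.2 m2.2 m3.2 h12 h13 h23
    rw [← hT] at n1 n2
    obtain ⟨k, hk⟩ := ih (𝒮.erase A) (fun B hB => hok B (mem_of_mem_erase hB))
      (fun B hB C hC => hd B (mem_of_mem_erase hB) C (mem_of_mem_erase hC))
      (by
        intro t ht p1 h1 p2 h2 p3 h3
        have := hab t ht p1 h1 p2 h2 p3 h3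
        rw [filter_erase]
        have := pred_card_le_card_erase (s := 𝒮.filter (Abs R (t, p1, p2, p3))) (a := A)
        omega)
      (Z \ T) (disjoint_of_subset_left sdiff_subset (disjoint_of_subset_right hsubE hZ))
      (sdiff_subset.trans hZQ)
      (by have := card_sdiff_inter Q hTZ; omega)
      (by have := card_sdiff_inter P hTZ; omega)
    refine ⟨3 + k, ?_⟩
    have := htil.union hk (by
      rw [Finset.disjoint_union_left, Finset.disjoint_union_right, Finset.disjoint_union_right]
      refine ⟨⟨hdis, ?_⟩, ?_, disjoint_sdiff⟩
      · exact (disjoint_of_subset_left sdiff_subset (disjoint_of_subset_right hvA hZ)).symm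
      · exact disjoint_of_subset_left hTZ (disjoint_of_subset_right hsubE hZ))
    convert this using 1
    have e1 : 𝒮.biUnion vts = vts A ∪ (𝒮.erase A).biUnion vts := by
      rw [← biUnion_insert, insert_erase hA1]
    rw [e1]
    ext v
    have := @hTZ v
    simp only [mem_union, mem_sdiff]
    tauto

lemma pow_large (D : ℕ) : ∃ L, ∀ l ≥ L, 256 * D ^ 4 * (l + 1) ^ 4 < 2 ^ l := by
  have h := tendsto_pow_const_div_const_pow_of_one_lt 4 (r := (2 : ℝ)) (by norm_num)
  have hpos : (0 : ℝ) < 1 / (4096 * D ^ 4 + 1) := by positivity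
  have h2 := (h.eventually (gt_mem_nhds hpos))
  rw [Filter.eventually_atTop] at h2
  obtain ⟨L, hL⟩ := h2
  refine ⟨L + 1, fun l hl => ?_⟩
  have h3 := hL l (by omega)
  rw [div_lt_div_iff₀ (by positivity) (by positivity), one_mul] at h3
  have h4 : l ^ 4 * (4096 * D ^ 4 + 1) < 2 ^ l := by exact_mod_cast h3
  have h5 : (l + 1) ^ 4 ≤ (2 * l) ^ 4 := Nat.pow_le_pow_left (by omega) 4
  have h6 : (l + 1) ^ 4 ≤ 16 * l ^ 4 := h5.trans_eq (by ring)
  calc 256 * D ^ 4 * (l + 1) ^ 4 ≤ 256 * D ^ 4 * (16 * l ^ 4) := Nat.mul_le_mul_left _ h6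
    _ ≤ l ^ 4 * (4096 * D ^ 4 + 1) := by nlinarith [Nat.zero_le (l ^ 4)]
    _ < _ := h4

lemma one_sub_pow : (1 - 1 / 2 ^ 18 : ℝ) ^ (2 ^ 18) ≤ 1 / 2 := by
  have h1 : (1 - 1 / 2 ^ 18 : ℝ) ≤ Real.exp (-(1 / 2 ^ 18)) := by
    have := Real.add_one_le_exp (-(1 / 2 ^ 18) : ℝ)
    linarith
  have h2 : (1 - 1 / 2 ^ 18 : ℝ) ^ (2 ^ 18) ≤ Real.exp (-(1 / 2 ^ 18)) ^ (2 ^ 18) :=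
    pow_le_pow_left₀ (by norm_num) h1 _
  rw [← Real.exp_nat_mul] at h2
  refine h2.trans ?_
  have : ((2 ^ 18 : ℕ) : ℝ) * (-(1 / 2 ^ 18)) = -1 := by push_cast; norm_num
  rw [this, Real.exp_neg, one_div]
  have := Real.add_one_le_exp (1 : ℝ)
  exact inv_anti₀ (by norm_num) (by linarith)

end

open Classical in
theorem absorber (D : ℕ) (hD : 2 ^ 42 ≤ D) : ∃ N0 : ℕ, ∀ N ≥ N0, ∀ (V : Type) [Fintype V]
    [DecidableEq V] (Q P : Finset V) (R : V → V → V → V → Prop), Sys Q P R → Q.card = N →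
    P.card = 3 * N → Fintype.card V = 4 * N →
    (∀ q ∈ Q, ∀ u ∈ P, 5 * N ^ 2 ≤ 7 * N + cn (fun x : V × V => R q u x.1 x.2)) →
    ∃ S k, Til R k S ∧ k = 2 ^ 20 * (N / D) ∧ S.card ≤ 2 ^ 22 * (N / D) ∧
      ∀ Z, Disjoint Z S → Z ⊆ Q ∪ P → ∀ l ≤ N / D, (Z ∩ Q).card = l → (Z ∩ P).card = 3 * l →
        ∃ k', Til R k' (S ∪ Z) := by
  obtain ⟨L, hL⟩ := pow_large D
  refine ⟨D * (L + 1) + 2 ^ 42, ?_⟩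
  intro N hN V _ _ Q P R hs hQ hP hV hdeg
  set l := N / D with hl
  have hDpos : 0 < D := lt_of_lt_of_le (by norm_num) hD
  have hlL : L ≤ l := by
    rw [hl, Nat.le_div_iff_mul_le hDpos]; nlinarith
  have hlN : l * D ≤ N := Nat.div_mul_le_self N D
  have hNl : N ≤ D * (l + 1) := (Nat.lt_mul_div_succ N hDpos).le
  set s := 2 ^ 19 * l with hsdef
  have hNpos : 0 < N := by omega
  obtain ⟨q0, hq0⟩ := card_pos.1 (by omega : 0 < Q.card)
  obtain ⟨p0, hp0⟩ := card_pos.1 (by omega : 0 < P.card)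
  set TT : Finset (V × V × V × V) := Q ×ˢ P ×ˢ P ×ˢ P with hTT
  have hTTc : TT.card ≤ 256 * D ^ 4 * (l + 1) ^ 4 := by
    rw [hTT, card_product, card_product, card_product, hQ, hP]
    have : N ^ 4 ≤ (D * (l + 1)) ^ 4 := Nat.pow_le_pow_left hNl 4
    rw [mul_pow] at this
    nlinarith
  have hα : Fintype.card (A8 V) = (4 * N) ^ 8 := by
    simp only [A8, Fintype.card_prod, hV]; ring
  obtain ⟨𝒮, h1, h2, h3, h4⟩ := greedy_family TT ⟨(q0, p0, p0, p0), by simp [hTT, hq0, hp0]⟩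
    (Abs R) (Ok R) vts (fun A => ⟨A.2.1.1, by simp [vts]⟩) vts_card (1 / 2 ^ 18) (by norm_num) s
    (by rw [hα]; positivity)
    (by
      intro X hX T hT
      obtain ⟨t, p1, p2, p3⟩ := T
      simp only [hTT, mem_product] at hT
      have := many_abs hs hQ hP hV hdeg (by omega) X
        (by
          have : 2 ^ 42 * l ≤ N := le_trans (by nlinarith) hlN
          omega) hT.1 hT.2.1 hT.2.2.1 hT.2.2.2
      rw [hα]
      have h' : (N : ℝ) ^ 8 ≤ 2 * (cn (fun A : A8 V => Ok R A ∧ Disjoint (vts A) X ∧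
        Abs R (t, p1, p2, p3) A) : ℝ) := by exact_mod_cast this
      push_cast
      rw [mul_pow]
      linarith) s le_rfl
  refine ⟨𝒮.biUnion vts, _, til_family 𝒮 h2 h3, by rw [h1]; omega, ?_, ?_⟩
  · refine (card_biUnion_le_card_mul 𝒮 vts 8 (fun A _ => vts_card A)).trans ?_
    rw [h1]; omega
  · intro Z hZ hZQ l' hl' hZ1 hZ2
    refine absorb hs l' 𝒮 h2 h3 ?_ Z hZ hZQ hZ1 hZ2
    intro t ht p1 hp1 p2 hp2 p3 hp3
    refine hl'.trans ?_
    by_contra hlt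
    push Not at hlt
    set m := (𝒮.filter (Abs R (t, p1, p2, p3))).card with hm
    have e1 : (1 / 2 : ℝ) ^ m ≤ (1 - 1 / 2 ^ 18) ^ s * TT.card := by
      refine le_trans ?_ h4
      exact single_le_sum (f := fun T => (1 / 2 : ℝ) ^ (𝒮.filter (Abs R T)).card)
        (fun T _ => by positivity) (by simp [hTT, ht, hp1, hp2, hp3] :
          (t, p1, p2, p3) ∈ TT)
    have e2 : (1 - 1 / 2 ^ 18 : ℝ) ^ s ≤ (1 / 2) ^ (2 * l) := by
      rw [hsdef, show 2 ^ 19 * l = 2 ^ 18 * (2 * l) by ring, pow_mul]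
      exact pow_le_pow_left₀ (by positivity) one_sub_pow _
    have e3 : (1 / 2 : ℝ) ^ l ≤ (1 / 2) ^ m :=
      pow_le_pow_of_le_one (by norm_num) (by norm_num) hlt.le
    have e4 : (TT.card : ℝ) < 2 ^ l := by exact_mod_cast lt_of_le_of_lt hTTc (hL l hlL)
    have e5 : (1 / 2 : ℝ) ^ l ≤ (1 / 2) ^ (2 * l) * TT.card :=
      e3.trans (e1.trans (mul_le_mul_of_nonneg_right e2 (by positivity)))
    have e6 : (1 / 2 : ℝ) ^ (2 * l) * TT.card < (1 / 2) ^ (2 * l) * 2 ^ l :=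
      mul_lt_mul_of_pos_left e4 (by positivity)
    have e7 : (1 / 2 : ℝ) ^ (2 * l) * 2 ^ l = (1 / 2) ^ l := by
      rw [two_mul, pow_add, mul_assoc, ← mul_pow]; norm_num
    linarith

end PM13


namespace PM13
open Finset
set_option linter.unusedSectionVars false
set_option linter.unusedVariables false

/-- ordered blocks: one `Q`-vertex and three `P`-vertices -/
abbrev Bk (V : Type) := V × (Fin 3 → V)

section
variable {V : Type} [Fintype V] [DecidableEq V] {Q P : Finset V} {R : V → V → V → V → Prop}

def vs (E : Bk V) : Finset V := {E.1, E.2 0, E.2 1, E.2 2}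

lemma mem_vs {E : Bk V} {x : V} : x ∈ vs E ↔ x = E.1 ∨ ∃ i, x = E.2 i := by
  simp only [vs, mem_insert, mem_singleton, Fin.exists_fin_succ, Fin.exists_fin_zero]
  simp

def Fam (Q P : Finset V) (B : Finset (Bk V)) : Prop :=
  (∀ E ∈ B, E.1 ∈ Q ∧ (∀ i, E.2 i ∈ P) ∧ Function.Injective E.2) ∧
  (∀ E ∈ B, ∀ F ∈ B, E ≠ F → Disjoint (vs E) (vs F))

lemma Fam.cards (hd : Disjoint Q P) {B : Finset (Bk V)} (h : Fam Q P B) :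
    (B.biUnion vs ∩ Q).card = B.card ∧ (B.biUnion vs ∩ P).card = 3 * B.card := by
  have key : ∀ E ∈ B, (vs E ∩ Q).card = 1 ∧ (vs E ∩ P).card = 3 := by
    intro E hE
    obtain ⟨h1, h2, h3⟩ := h.1 E hE
    exact quad_cards hd h1 (h2 0) (h2 1) (h2 2) (h3.ne (by decide)) (h3.ne (by decide))
      (h3.ne (by decide))
  constructor
  · rw [biUnion_inter, card_biUnion]
    · rw [sum_congr rfl (fun e he => (key e he).1)]; simp
    · intro e he f hf hne
      exact disjoint_of_subset_left inter_subset_left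
        (disjoint_of_subset_right inter_subset_left (h.2 e he f hf hne))
  · rw [biUnion_inter, card_biUnion]
    · rw [sum_congr rfl (fun e he => (key e he).2)]; simp [mul_comm]
    · intro e he f hf hne
      exact disjoint_of_subset_left inter_subset_left
        (disjoint_of_subset_right inter_subset_left (h.2 e he f hf hne))

lemma Fam.extend (hd : Disjoint Q P) {N : ℕ} (hQ : Q.card = N) (hP : P.card = 3 * N)
    {B : Finset (Bk V)} (h : Fam Q P B) (j : ℕ) (hj : B.card + j ≤ N) :
    ∃ B', B ⊆ B' ∧ Fam Q P B' ∧ B'.card = B.card + j := by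
  induction j with
  | zero => exact ⟨B, Subset.refl _, h, rfl⟩
  | succ j ih =>
    obtain ⟨B', hB, hF, hc⟩ := ih (by omega)
    obtain ⟨c1, c2⟩ := hF.cards hd
    set X := B'.biUnion vs with hX
    have d1 := card_sdiff_add_card_inter Q X
    have d2 := card_sdiff_add_card_inter P X
    rw [inter_comm] at d1 d2
    obtain ⟨q, hq⟩ := card_pos.1 (by omega : 0 < (Q \ X).card)
    obtain ⟨Y, hY, hYc⟩ := exists_subset_card_eq (by omega : 3 ≤ (P \ X).card)
    obtain ⟨p1, p2, p3, h12, h13, h23, rfl⟩ := card_eq_three.1 hYc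
    have hp : ∀ x ∈ ({p1, p2, p3} : Finset V), x ∈ P ∧ x ∉ X := fun x hx => mem_sdiff.1 (hY hx)
    have m1 := hp p1 (by simp)
    have m2 := hp p2 (by simp)
    have m3 := hp p3 (by simp)
    have mq := mem_sdiff.1 hq
    set E : Bk V := (q, ![p1, p2, p3]) with hE
    have hEd : Disjoint (vs E) X := by
      rw [Finset.disjoint_left]
      intro x hx
      simp only [vs, hE, mem_insert, mem_singleton] at hx
      rcases hx with rfl | rfl | rfl | rfl
      exacts [mq.2, m1.2, m2.2, m3.2]
    have hEd' : ∀ F ∈ B', Disjoint (vs E) (vs F) := fun F hF =>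
      disjoint_of_subset_right (subset_biUnion_of_mem vs hF) hEd
    have hEn : E ∉ B' := by
      intro hmem
      exact Finset.disjoint_left.1 hEd (show q ∈ vs E by simp [vs, hE])
        (mem_biUnion.2 ⟨E, hmem, by simp [vs, hE]⟩)
    refine ⟨insert E B', hB.trans (subset_insert _ _), ⟨?_, ?_⟩, ?_⟩
    · intro F hFm
      rcases mem_insert.1 hFm with rfl | hFm
      · refine ⟨mq.1, ?_, ?_⟩
        · intro i; fin_cases i
          exacts [m1.1, m2.1, m3.1]
        · intro i j hij
          fin_cases i <;> fin_cases j <;> simp_all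
      · exact hF.1 F hFm
    · intro F hFm F' hFm' hne
      rcases mem_insert.1 hFm with h1 | h1 <;> rcases mem_insert.1 hFm' with h2 | h2
      · exact absurd (h1.trans h2.symm) hne
      · rw [h1]; exact hEd' _ h2
      · rw [h2]; exact (hEd' _ h1).symm
      · exact hF.2 _ h1 _ h2 hne
    · rw [card_insert_of_notMem hEn, hc]; rfl

lemma til_tuples (B : Finset (Bk V)) (hR : ∀ E ∈ B, R E.1 (E.2 0) (E.2 1) (E.2 2))
    (hd : ∀ E ∈ B, ∀ F ∈ B, E ≠ F → Disjoint (vs E) (vs F)) :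
    Til R B.card (B.biUnion vs) := by
  induction B using Finset.induction_on with
  | empty => simpa using Til.nil
  | insert A S hA ih =>
    rw [card_insert_of_notMem hA, biUnion_insert]
    have h1 := ih (fun B hB => hR B (mem_insert_of_mem hB))
      (fun B hB C hC => hd B (mem_insert_of_mem hB) C (mem_insert_of_mem hC))
    have h2 : Til R 1 (vs A) := Til.single (hR A (mem_insert_self _ _))
    have := h2.union h1 (by
      rw [disjoint_biUnion_right]
      intro B hB
      exact hd A (mem_insert_self _ _) B (mem_insert_of_mem hB) (by rintro rfl; exact hA hB))
    rwa [add_comm]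

lemma til_to_fam (hs : Sys Q P R) {k : ℕ} {S : Finset V} (h : Til R k S) :
    ∃ B : Finset (Bk V), Fam Q P B ∧ B.card = k ∧ ∀ E ∈ B, R E.1 (E.2 0) (E.2 1) (E.2 2) := by
  obtain ⟨M, h1, h2, h3, h4⟩ := h
  have : ∀ e : M, ∃ E : Bk V, R E.1 (E.2 0) (E.2 1) (E.2 2) ∧ vs E = e.1 := by
    rintro ⟨e, he⟩
    obtain ⟨q, x, y, z, hr, rfl⟩ := h1 e he
    exact ⟨(q, ![x, y, z]), hr, rfl⟩
  choose f hf1 hf2 using this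
  refine ⟨M.attach.image f, ⟨?_, ?_⟩, ?_, ?_⟩
  · intro E hE
    obtain ⟨e, _, rfl⟩ := mem_image.1 hE
    have a := hs.mem _ _ _ _ (hf1 e)
    have b := hs.ne _ _ _ _ (hf1 e)
    refine ⟨a.1, ?_, ?_⟩
    · intro i; fin_cases i
      exacts [a.2.1, a.2.2.1, a.2.2.2]
    · obtain ⟨b1, b2, b3⟩ := b
      intro i j hij
      fin_cases i <;> fin_cases j <;> first | rfl | (exfalso; simp at hij; first | exact b1 hij | exact b2 hij | exact b3 hij | exact b1 hij.symm | exact b2 hij.symm | exact b3 hij.symm)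
  · intro E hE F hF hne
    obtain ⟨e, _, rfl⟩ := mem_image.1 hE
    obtain ⟨e', _, rfl⟩ := mem_image.1 hF
    rw [hf2, hf2]
    exact h2 _ e.2 _ e'.2 (fun h => hne (by rw [Subtype.ext h]))
  · rw [card_image_of_injective, card_attach, h3]
    intro e e' h
    apply Subtype.ext
    rw [← hf2, ← hf2, h]
  · intro E hE
    obtain ⟨e, _, rfl⟩ := mem_image.1 hE
    exact hf1 e

structure Ctx (Q P : Finset V) (R : V → V → V → V → Prop) (m : ℕ) (B : Finset (Bk V))
    (LQ LP : Finset V) : Prop where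
  hs : Sys Q P R
  fam : Fam Q P B
  lq : ∀ q, q ∈ LQ ↔ q ∈ Q ∧ q ∉ B.biUnion vs
  lp : ∀ q, q ∈ LP ↔ q ∈ P ∧ q ∉ B.biUnion vs
  clq : LQ.card = m
  clp : LP.card = 3 * m
  aug : ∀ K ⊆ B, ∀ k S, Til R k S → S ⊆ K.biUnion vs ∪ (LQ ∪ LP) → k ≤ K.card

lemma exists_ctx (hs : Sys Q P R) {N m : ℕ} (hQ : Q.card = N) (hP : P.card = 3 * N)
    (hmN : m ≤ N) (hmax : ∀ k S, Til R k S → k + m ≤ N) :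
    ∃ B LQ LP, Ctx Q P R m B LQ LP ∧ B.card + m = N := by
  classical
  have hex : ∃ k, (∃ S, Til R k S) ∧ ∀ l, (∃ S, Til R l S) → l ≤ k := by
    refine ⟨Nat.findGreatest (fun k => ∃ S, Til R k S) N, ?_, ?_⟩
    · exact Nat.findGreatest_spec (P := fun k => ∃ S, Til R k S) (Nat.zero_le N) ⟨∅, Til.nil⟩
    · intro l hl
      refine Nat.le_findGreatest ?_ hl
      obtain ⟨S, hS⟩ := hl
      have := hmax l S hS
      omega
  obtain ⟨k, ⟨S, hS⟩, hk⟩ := hex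
  obtain ⟨M, hM1, hM2, hM3⟩ := til_to_fam hs hS
  have hkm := hmax k S hS
  obtain ⟨B, hB1, hB2, hB3⟩ := hM1.extend hs.disj hQ hP (N - m - k) (by omega)
  obtain ⟨c1, c2⟩ := hB2.cards hs.disj
  have d1 := card_sdiff_add_card_inter Q (B.biUnion vs)
  have d2 := card_sdiff_add_card_inter P (B.biUnion vs)
  rw [inter_comm] at d1 d2
  refine ⟨B, Q \ B.biUnion vs, P \ B.biUnion vs, ⟨hs, hB2, fun q => mem_sdiff, fun q => mem_sdiff,
    by omega, by omega, ?_⟩, by omega⟩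
  intro K hK l S' hS' hsub
  have h1 := til_tuples (R := R) (M \ K) (fun E hE => hM3 E (mem_sdiff.1 hE).1)
    (fun E hE F hF => hM1.2 E (mem_sdiff.1 hE).1 F (mem_sdiff.1 hF).1)
  have h2 := h1.union hS' (by
    rw [Finset.disjoint_left]
    intro x hx hx'
    obtain ⟨E, hE, hxE⟩ := mem_biUnion.1 hx
    obtain ⟨hE1, hE2⟩ := mem_sdiff.1 hE
    rcases mem_union.1 (hsub hx') with h | h
    · obtain ⟨F, hF, hxF⟩ := mem_biUnion.1 h
      exact Finset.disjoint_left.1 (hB2.2 E (hB1 hE1) F (hK hF) (by rintro rfl; exact hE2 hF))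
        hxE hxF
    · have : x ∈ B.biUnion vs := mem_biUnion.2 ⟨E, hB1 hE1, hxE⟩
      rcases mem_union.1 h with h | h
      · exact (mem_sdiff.1 h).2 this
      · exact (mem_sdiff.1 h).2 this)
  have h3 := hk _ ⟨_, h2⟩
  have h4 := card_sdiff_add_card_inter M K
  have h5 : (M ∩ K).card ≤ K.card := card_le_card inter_subset_right
  omega

end
end PM13


namespace PM13
open Finset
set_option linter.unusedSectionVars false
set_option linter.unusedVariables false

section
variable {V : Type} [Fintype V] [DecidableEq V] {Q P : Finset V} {R : V → V → V → V → Prop}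
  {m : ℕ} {B : Finset (Bk V)} {LQ LP : Finset V}

/-- pairs with many extensions into the leftover -/
def GG (R : V → V → V → V → Prop) (m : ℕ) (LQ LP : Finset V) (x y : V) : Prop :=
  60 * m < cn (fun a : V × V => a.1 ∈ LQ ∧ a.2 ∈ LP ∧ R a.1 a.2 x y)

lemma GG.symm (h : Ctx Q P R m B LQ LP) {x y : V} (hG : GG R m LQ LP x y) : GG R m LQ LP y x := by
  refine lt_of_lt_of_le hG (cn_mono ?_)
  rintro a ⟨h1, h2, h3⟩
  exact ⟨h1, h2, h.hs.sw2 _ _ _ _ h3⟩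

lemma ext_pairs (h : Ctx Q P R m B LQ LP) (S0 : Finset V) (k0 : ℕ) (hS0 : Til R k0 S0)
    (hk0 : k0 ≤ 1) (hS0L : Disjoint S0 (LQ ∪ LP)) :
    ∀ (l : List (V × V)), l.length ≤ 8 → (∀ a ∈ l, GG R m LQ LP a.1 a.2) →
    (l.flatMap (fun a => [a.1, a.2])).Nodup →
    (∀ a ∈ l.flatMap (fun a => [a.1, a.2]), a ∉ S0 ∧ a ∉ LQ ∧ a ∉ LP) →
    ∃ S, Til R (k0 + l.length) S ∧
      S ⊆ S0 ∪ (l.flatMap (fun a => [a.1, a.2])).toFinset ∪ (LQ ∪ LP) := by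
  intro l
  induction l with
  | nil =>
    intro _ _ _ _
    exact ⟨S0, by simpa using hS0, by intro x hx; simp [hx]⟩
  | cons a l ih =>
    intro hl hG hnd hv
    obtain ⟨x, y⟩ := a
    simp only [List.flatMap_cons, List.cons_append, List.nil_append, List.nodup_cons,
      List.mem_cons, not_or] at hnd hv
    obtain ⟨S, hS, hsub⟩ := ih (by simp at hl; omega) (fun a ha => hG a (List.mem_cons_of_mem _ ha))
      hnd.2.2 (fun a ha => hv a (Or.inr (Or.inr ha)))
    obtain ⟨c1, c2, c3⟩ := hS.cards h.hs
    have hlen : k0 + l.length ≤ 8 := by simp at hl; omega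
    have hx := hv x (Or.inl rfl)
    have hy := hv y (Or.inr (Or.inl rfl))
    have hxS : x ∉ S := by
      intro hxS
      have := hsub hxS
      simp only [mem_union, List.mem_toFinset] at this
      have := hnd.1.2
      tauto
    have hyS : y ∉ S := by
      intro hxS
      have := hsub hxS
      simp only [mem_union, List.mem_toFinset] at this
      have := hnd.2.1
      tauto
    have hcnt : cn (fun a : V × V => (a.1 ∈ S ∩ Q ∧ a.2 ∈ LP) ∨ (a.1 ∈ LQ ∧ a.2 ∈ S ∩ P)) ≤
        60 * m := by
      refine (cn_or _ _).trans ?_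
      rw [cn_and_prod (fun a => a ∈ S ∩ Q) (fun a => a ∈ LP),
        cn_and_prod (fun a => a ∈ LQ) (fun a => a ∈ S ∩ P), cn_mem, cn_mem, cn_mem, cn_mem,
        c1, c2, h.clq, h.clp]
      nlinarith
    obtain ⟨⟨q, p⟩, ⟨hq, hp, hr⟩, hnot⟩ := cn_exists (lt_of_le_of_lt hcnt
      (hG (x, y) List.mem_cons_self))
    simp only [] at hq hp hr hnot
    have hqQ : q ∈ Q := ((h.lq q).1 hq).1
    have hpP : p ∈ P := ((h.lp p).1 hp).1
    have hqS : q ∉ S := fun hh => hnot (Or.inl ⟨mem_inter.2 ⟨hh, hqQ⟩, hp⟩)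
    have hpS : p ∉ S := fun hh => hnot (Or.inr ⟨hq, mem_inter.2 ⟨hh, hpP⟩⟩)
    refine ⟨S ∪ {q, p, x, y}, ?_, ?_⟩
    · have := hS.union (Til.single hr) (by
        rw [Finset.disjoint_right]
        intro v hv
        simp only [mem_insert, mem_singleton] at hv
        rcases hv with rfl | rfl | rfl | rfl <;> assumption)
      simpa [add_assoc] using this
    · intro v hv
      rcases mem_union.1 hv with hv | hv
      · have := hsub hv
        simp only [List.flatMap_cons, List.cons_append, List.nil_append, mem_union, List.mem_toFinset,
          List.mem_cons] at this ⊢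
        tauto
      · simp only [List.flatMap_cons, List.cons_append, List.nil_append, mem_union, List.mem_toFinset,
          List.mem_cons, mem_insert, mem_singleton] at hv ⊢
        rcases hv with rfl | rfl | rfl | rfl
        · exact Or.inr (Or.inl hq)
        · exact Or.inr (Or.inr hp)
        · exact Or.inl (Or.inr (Or.inl rfl))
        · exact Or.inl (Or.inr (Or.inr (Or.inl rfl)))

/-- index-level adjacency -/
def Gx (R : V → V → V → V → Prop) (m : ℕ) (LQ LP : Finset V) (a b : Bk V × Fin 3) : Prop :=
  GG R m LQ LP (a.1.2 a.2) (b.1.2 b.2)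

lemma Ctx.inj (h : Ctx Q P R m B LQ LP) {E F : Bk V} (hE : E ∈ B) (hF : F ∈ B) {i j : Fin 3}
    (he : E.2 i = F.2 j) : E = F ∧ i = j := by
  by_cases hEF : E = F
  · subst hEF
    exact ⟨rfl, (h.fam.1 E hE).2.2 he⟩
  · exfalso
    exact Finset.disjoint_left.1 (h.fam.2 E hE F hF hEF) (mem_vs.2 (Or.inr ⟨i, rfl⟩))
      (mem_vs.2 (Or.inr ⟨j, he⟩))

lemma noG (h : Ctx Q P R m B LQ LP) (K : Finset (Bk V)) (hK : K ⊆ B)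
    (S0 : Finset V) (k0 : ℕ) (hS0 : Til R k0 S0)
    (hk0 : k0 ≤ 1) (hS0K : S0 ⊆ K.biUnion vs)
    (l : List ((Bk V × Fin 3) × (Bk V × Fin 3))) (hl : l.length ≤ 8)
    (hG : ∀ a ∈ l, Gx R m LQ LP a.1 a.2)
    (hnd : (l.flatMap (fun a => [a.1, a.2])).Nodup)
    (hv : ∀ a ∈ l.flatMap (fun a => [a.1, a.2]), a.1 ∈ K ∧ a.1.2 a.2 ∉ S0) :
    k0 + l.length ≤ K.card := by
  set ev : Bk V × Fin 3 → V := fun a => a.1.2 a.2 with hev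
  have hinL : ∀ x, x ∈ B.biUnion vs → x ∉ LQ ∧ x ∉ LP := fun x hx =>
    ⟨fun hh => ((h.lq x).1 hh).2 hx, fun hh => ((h.lp x).1 hh).2 hx⟩
  have hKB : K.biUnion vs ⊆ B.biUnion vs := biUnion_subset_biUnion_of_subset_left _ hK
  have hflat : (l.map (Prod.map ev ev)).flatMap (fun a => [a.1, a.2]) =
      (l.flatMap (fun a => [a.1, a.2])).map ev := by
    rw [List.flatMap_map, List.map_flatMap]; rfl
  have hevmem : ∀ a : Bk V × Fin 3, a.1 ∈ K → ev a ∈ K.biUnion vs := fun a ha =>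
    mem_biUnion.2 ⟨a.1, ha, mem_vs.2 (Or.inr ⟨a.2, rfl⟩)⟩
  obtain ⟨S, hS, hsub⟩ := ext_pairs h S0 k0 hS0 hk0 (by
      rw [Finset.disjoint_left]
      intro x hx hx'
      have := hinL x (hKB (hS0K hx))
      simp only [mem_union] at hx'
      tauto) (l.map (Prod.map ev ev)) (by simpa using hl) (by
      intro a ha
      obtain ⟨b, hb, rfl⟩ := List.mem_map.1 ha
      exact hG b hb) (by
      rw [hflat]
      refine List.Nodup.map_on ?_ hnd
      rintro ⟨E, i⟩ hx ⟨F, j⟩ hy hxy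
      obtain ⟨h1, h2⟩ := h.inj (hK (hv _ hx).1) (hK (hv _ hy).1) hxy
      exact Prod.ext h1 h2) (by
      rw [hflat]
      intro a ha
      obtain ⟨b, hb, rfl⟩ := List.mem_map.1 ha
      exact ⟨(hv b hb).2, hinL _ (hKB (hevmem b (hv b hb).1))⟩)
  rw [List.length_map] at hS
  refine h.aug K hK _ S hS (hsub.trans ?_)
  intro x hx
  rw [hflat] at hx
  simp only [mem_union, List.mem_toFinset, List.mem_map] at hx ⊢
  rcases hx with (hx | ⟨b, hb, rfl⟩) | hx
  · exact Or.inl (hS0K hx)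
  · exact Or.inl (hevmem b (hv b hb).1)
  · exact Or.inr hx

lemma noG' (h : Ctx Q P R m B LQ LP) (K : Finset (Bk V)) (hK : K ⊆ B)
    (l : List ((Bk V × Fin 3) × (Bk V × Fin 3))) (hl : l.length ≤ 8)
    (hG : ∀ a ∈ l, Gx R m LQ LP a.1 a.2)
    (hnd : (l.flatMap (fun a => [a.1, a.2])).Nodup)
    (hv : ∀ a ∈ l.flatMap (fun a => [a.1, a.2]), a.1 ∈ K) : l.length ≤ K.card := by
  have := noG h K hK ∅ 0 Til.nil (by norm_num) (by simp) l hl hG hnd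
    (fun a ha => ⟨hv a ha, by simp⟩)
  simpa using this

/-- case analysis -/
lemma case33 (g : Fin 3 → Fin 3 → Bool) :
    (∃ a b c : Fin 3, a ≠ b ∧ a ≠ c ∧ b ≠ c ∧ g 0 a ∧ g 1 b ∧ g 2 c) ∨
    (∃ a b c : Fin 3, a ≠ b ∧ (∀ j, g a j) ∧ (∀ j, j ≠ c → g b j)) ∨
    (∃ a b c : Fin 3, a ≠ b ∧ (∀ j, g j a) ∧ (∀ j, j ≠ c → g j b)) ∨
    ((∃ a a' : Fin 3, ∀ i j, (i = a ∨ j = a') → g i j) ∧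
      ∑ i, ∑ j, (g i j).toNat ≤ 5) ∨
    ∑ i, ∑ j, (g i j).toNat ≤ 4 := by
  have key : ∀ a0 a1 a2 b0 b1 b2 c0 c1 c2 : Bool, ∀ g : Fin 3 → Fin 3 → Bool,
    g = ![![a0, a1, a2], ![b0, b1, b2], ![c0, c1, c2]] →
    ((∃ a b c : Fin 3, a ≠ b ∧ a ≠ c ∧ b ≠ c ∧ g 0 a ∧ g 1 b ∧ g 2 c) ∨
    (∃ a b c : Fin 3, a ≠ b ∧ (∀ j, g a j) ∧ (∀ j, j ≠ c → g b j)) ∨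
    (∃ a b c : Fin 3, a ≠ b ∧ (∀ j, g j a) ∧ (∀ j, j ≠ c → g j b)) ∨
    ((∃ a a' : Fin 3, ∀ i j, (i = a ∨ j = a') → g i j) ∧
      ∑ i, ∑ j, (g i j).toNat ≤ 5) ∨
    ∑ i, ∑ j, (g i j).toNat ≤ 4) := by
    intro a0 a1 a2 b0 b1 b2 c0 c1 c2 g hg
    subst hg
    revert a0 a1 a2 b0 b1 b2 c0 c1 c2
    simp only [Fin.sum_univ_three, Fin.exists_fin_succ, Fin.forall_fin_succ, Fin.exists_fin_zero]
    simp
  refine key (g 0 0) (g 0 1) (g 0 2) (g 1 0) (g 1 1) (g 1 2) (g 2 0) (g 2 1) (g 2 2) g ?_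
  funext i j
  fin_cases i <;> fin_cases j <;> rfl

end
end PM13


namespace PM13
open Finset
set_option linter.unusedSectionVars false
set_option linter.unusedVariables false
set_option linter.unusedSimpArgs false

lemma kst {α : Type*} [Fintype α] [DecidableEq α] (B : Finset α) (r : α → α → Prop)
    (hr : ∀ E F, r E F → E ∈ B ∧ F ∈ B)
    (h2 : ∀ F1 F2, F1 ≠ F2 → cn (fun E => r E F1 ∧ r E F2) ≤ 2) :
    (cn (fun x : α × α => r x.1 x.2)) ^ 2 ≤ 3 * B.card ^ 3 := by
  have e1 : cn (fun x : α × α => r x.1 x.2) = ∑ E ∈ B, cn (fun F => r E F) := by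
    rw [cn_prod]
    symm
    apply sum_subset (subset_univ _)
    intro E _ hE
    by_contra hne
    obtain ⟨F, hF⟩ := cn_pos (Nat.pos_of_ne_zero hne)
    exact hE (hr _ _ hF).1
  have e2 : ∑ E ∈ B, (cn (fun F => r E F)) ^ 2 ≤ 3 * B.card ^ 2 := by
    have a1 : ∑ E ∈ B, (cn (fun F => r E F)) ^ 2 ≤
        cn (fun x : (α × α) × α => r x.2 x.1.1 ∧ r x.2 x.1.2) := by
      rw [cn_prod']
      refine (sum_le_sum_of_subset (subset_univ B)).trans (sum_le_sum ?_)
      intro E _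
      rw [sq, ← cn_and_prod]
    have a2 : cn (fun x : (α × α) × α => r x.2 x.1.1 ∧ r x.2 x.1.2) ≤
        cn (fun x : (α × α) × α => x.1.1 ≠ x.1.2 ∧ r x.2 x.1.1 ∧ r x.2 x.1.2) +
        cn (fun x : (α × α) × α => x.1.1 = x.1.2 ∧ r x.2 x.1.1 ∧ r x.2 x.1.2) :=
      cn_cover (fun x hx => by tauto)
    have a3 : cn (fun x : (α × α) × α => x.1.1 ≠ x.1.2 ∧ r x.2 x.1.1 ∧ r x.2 x.1.2) ≤
        (B ×ˢ B).card * 2 := by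
      refine cn_prod_le _ 2 ?_ ?_
      · rintro ⟨a, b⟩ c ⟨_, h1, h2⟩
        exact mem_product.2 ⟨(hr _ _ h1).2, (hr _ _ h2).2⟩
      · rintro ⟨a, b⟩ _
        by_cases hab : a = b
        · by_contra hne
          obtain ⟨F, hF⟩ := cn_pos (lt_of_le_of_lt (Nat.zero_le 2) (not_le.1 hne))
          exact hF.1 hab
        · exact (cn_mono (fun E h => h.2)).trans (h2 a b hab)
    have a4 : cn (fun x : (α × α) × α => x.1.1 = x.1.2 ∧ r x.2 x.1.1 ∧ r x.2 x.1.2) ≤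
        cn (fun x : α × α => x ∈ B ×ˢ B) := by
      refine cn_inj (fun x => (x.1.1, x.2)) ?_ ?_
      · rintro ⟨⟨a, b⟩, c⟩ ⟨_, h1, h2⟩
        exact mem_product.2 ⟨(hr _ _ h1).2, (hr _ _ h1).1⟩
      · rintro ⟨⟨a, b⟩, c⟩ ⟨⟨a', b'⟩, c'⟩ h h' he
        simp only [Prod.mk.injEq] at *
        grind
    rw [cn_mem] at a4
    rw [card_product] at a3 a4
    nlinarith
  rw [e1]
  calc (∑ E ∈ B, cn (fun F => r E F)) ^ 2 ≤ B.card * ∑ E ∈ B, (cn (fun F => r E F)) ^ 2 :=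
        sq_sum_le_card_mul_sum_sq
    _ ≤ B.card * (3 * B.card ^ 2) := Nat.mul_le_mul_left _ e2
    _ = _ := by ring

section
variable {V : Type} [Fintype V] [DecidableEq V] {Q P : Finset V} {R : V → V → V → V → Prop}
  {m : ℕ} {B : Finset (Bk V)} {LQ LP : Finset V}

def Arr (R : V → V → V → V → Prop) (m : ℕ) (B : Finset (Bk V)) (LQ LP : Finset V)
    (t : Fin 3 × Fin 3 × Fin 3) (E F : Bk V) : Prop :=
  E ∈ B ∧ F ∈ B ∧ E ≠ F ∧ t.1 ≠ t.2.1 ∧ (∀ j, Gx R m LQ LP (E, t.1) (F, j)) ∧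
    ∀ j, j ≠ t.2.2 → Gx R m LQ LP (E, t.2.1) (F, j)

def Good (R : V → V → V → V → Prop) (m : ℕ) (B : Finset (Bk V)) (LQ LP : Finset V)
    (E F : Bk V) : Prop :=
  E ∈ B ∧ F ∈ B ∧ E ≠ F ∧ ∃ a a' : Fin 3, ∀ i j, (i = a ∨ j = a') → Gx R m LQ LP (E, i) (F, j)

noncomputable def ee (R : V → V → V → V → Prop) (m : ℕ) (LQ LP : Finset V) (E F : Bk V) : ℕ :=
  cn (fun ij : Fin 3 × Fin 3 => Gx R m LQ LP (E, ij.1) (F, ij.2))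

lemma Gx.symm (h : Ctx Q P R m B LQ LP) {a b : Bk V × Fin 3} (hG : Gx R m LQ LP a b) :
    Gx R m LQ LP b a := GG.symm h hG

lemma Good.symm (h : Ctx Q P R m B LQ LP) {E F : Bk V} (hG : Good R m B LQ LP E F) :
    Good R m B LQ LP F E := by
  obtain ⟨h1, h2, h3, a, a', h4⟩ := hG
  exact ⟨h2, h1, h3.symm, a', a, fun i j hij => (h4 j i hij.symm).symm h⟩

lemma dich (h : Ctx Q P R m B LQ LP) {E F : Bk V} (hE : E ∈ B) (hF : F ∈ B) (hne : E ≠ F) :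
    (∃ t, Arr R m B LQ LP t E F) ∨ (∃ t, Arr R m B LQ LP t F E) ∨
    (Good R m B LQ LP E F ∧ ee R m LQ LP E F ≤ 5) ∨ ee R m LQ LP E F ≤ 4 := by
  classical
  set g : Fin 3 → Fin 3 → Bool := fun i j => decide (Gx R m LQ LP (E, i) (F, j)) with hg
  have hee : ee R m LQ LP E F = ∑ i, ∑ j, (g i j).toNat := by
    unfold ee
    rw [cn_eq_sum, Fintype.sum_prod_type]
    refine sum_congr rfl (fun i _ => sum_congr rfl (fun j _ => ?_))
    simp only [hg]
    split_ifs with hh <;> simp [hh]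
  have hgi : ∀ i j, g i j = true ↔ Gx R m LQ LP (E, i) (F, j) := fun i j => by simp [hg]
  have := case33 g
  simp only [hgi, ← hee] at this
  rcases this with ⟨a, b, c, hab, hac, hbc, h0, h1, h2⟩ | ⟨a, b, c, hab, h1, h2⟩ |
    ⟨a, b, c, hab, h1, h2⟩ | ⟨⟨a, a', h1⟩, h2⟩ | h1
  · exfalso
    have := noG' h {E, F} (by intro x; simp; rintro (rfl | rfl) <;> assumption)
      [((E, 0), (F, a)), ((E, 1), (F, b)), ((E, 2), (F, c))] (by simp)
      (by simp [h0, h1, h2]) (by simp [hne, hne.symm, hab, hac, hbc]) (by simp)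
    rw [card_pair hne] at this
    simp at this
  · exact Or.inl ⟨(a, b, c), hE, hF, hne, hab, h1, h2⟩
  · exact Or.inr (Or.inl ⟨(a, b, c), hF, hE, hne.symm, hab, fun j => (h1 j).symm h,
      fun j hj => (h2 j hj).symm h⟩)
  · exact Or.inr (Or.inr (Or.inl ⟨⟨hE, hF, hne, a, a', h1⟩, h2⟩))
  · exact Or.inr (Or.inr (Or.inr h1))

lemma fin3_other (c : Fin 3) : ∃ c1 c2 : Fin 3, c1 ≠ c ∧ c2 ≠ c ∧ c1 ≠ c2 := by
  revert c; decide

lemma fin3_third (a b : Fin 3) : ∃ c : Fin 3, c ≠ a ∧ c ≠ b := by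
  revert a b; decide

lemma arr_K32 (h : Ctx Q P R m B LQ LP) (t : Fin 3 × Fin 3 × Fin 3) {E1 E2 E3 F1 F2 : Bk V}
    (h12 : E1 ≠ E2) (h13 : E1 ≠ E3) (h23 : E2 ≠ E3) (hF : F1 ≠ F2)
    (g11 : Arr R m B LQ LP t E1 F1) (g12 : Arr R m B LQ LP t E1 F2)
    (g21 : Arr R m B LQ LP t E2 F1) (g22 : Arr R m B LQ LP t E2 F2)
    (g31 : Arr R m B LQ LP t E3 F1) (g32 : Arr R m B LQ LP t E3 F2) : False := by
  obtain ⟨a, b, c⟩ := t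
  obtain ⟨c1, c2, hc1, hc2, hc12⟩ := fin3_other c
  obtain ⟨mE1, mF1, n11, hab, x1, y1⟩ := g11
  obtain ⟨_, mF2, n12, _, _, _⟩ := g12
  obtain ⟨mE2, _, n21, _, _, y2⟩ := g21
  obtain ⟨_, _, n22, _, x2, _⟩ := g22
  obtain ⟨mE3, _, n31, _, _, _⟩ := g31
  obtain ⟨_, _, n32, _, x3, y3⟩ := g32
  simp only [] at hab x1 y1 y2 x2 x3 y3
  have := noG' h {E1, E2, E3, F1, F2}
    (by intro x; simp; rintro (rfl | rfl | rfl | rfl | rfl) <;> assumption)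
    [((E1, b), (F1, c1)), ((E2, b), (F1, c2)), ((E3, b), (F2, c1)), ((E1, a), (F1, c)),
      ((E2, a), (F2, c)), ((E3, a), (F2, c2))] (by simp)
    (by simp [y1 c1 hc1, y2 c2 hc2, y3 c1 hc1, x1 c, x2 c, x3 c2])
    (by simp [*, Ne.symm n11, Ne.symm n12, Ne.symm n21, Ne.symm n22, Ne.symm n31, Ne.symm n32,
        Ne.symm h12, Ne.symm h13, Ne.symm h23, Ne.symm hc1, Ne.symm hc2, Ne.symm hab, Ne.symm hF,
        Ne.symm hc12])
    (by simp)
  have h5 : ({E1, E2, E3, F1, F2} : Finset (Bk V)).card ≤ 5 := card_le_five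
  simp at this
  omega

lemma arr_count (h : Ctx Q P R m B LQ LP) (t : Fin 3 × Fin 3 × Fin 3) :
    (cn (fun x : Bk V × Bk V => Arr R m B LQ LP t x.1 x.2)) ^ 2 ≤ 3 * B.card ^ 3 := by
  refine kst B (Arr R m B LQ LP t) (fun E F h => ⟨h.1, h.2.1⟩) ?_
  intro F1 F2 hF
  by_contra hlt
  push Not at hlt
  obtain ⟨E1, E2, E3, h1, h2, h3, h12, h13, h23⟩ := two_lt_card_iff.1 hlt
  simp only [mem_FS] at h1 h2 h3
  exact arr_K32 h t h12 h13 h23 hF h1.1 h1.2 h2.1 h2.2 h3.1 h3.2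

lemma consist (h : Ctx Q P R m B LQ LP) {E F0 E' : Bk V} (w : Fin 3)
    (hE : E ∈ B) (hF : F0 ∈ B) (hEF : E ≠ F0) 
    (hw : ∃ b, ∀ i j, (i = w ∨ j = b) → Gx R m LQ LP (E, i) (F0, j))
    (h2 : Good R m B LQ LP E E') (h3 : Good R m B LQ LP F0 E') :
    ∀ j, Gx R m LQ LP (E, w) (E', j) := by
  obtain ⟨b, hb⟩ := hw
  obtain ⟨_, hE', n2, a, a', h2⟩ := h2
  obtain ⟨_, _, n3, c, c', h3⟩ := h3
  by_cases haw : a = w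
  · intro j
    exact h2 _ _ (Or.inl haw.symm)
  · exfalso
    obtain ⟨e3, he1, he2⟩ := fin3_third w a
    obtain ⟨y, hy, _⟩ := fin3_third c' c'
    obtain ⟨x, z, hx, hz, hxz⟩ := fin3_other b
    have := noG' h {E, F0, E'}
      (by intro x; simp; rintro (rfl | rfl | rfl) <;> assumption)
      [((E, w), (F0, x)), ((E, a), (E', y)), ((E, e3), (F0, b)), ((F0, z), (E', c'))] (by simp)
      (by simp [hb w x (Or.inl rfl), h2 a y (Or.inl rfl), hb e3 b (Or.inr rfl),
          h3 z c' (Or.inr rfl)])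
      (by simp [*, Ne.symm hEF, Ne.symm n2, Ne.symm n3, Ne.symm haw, Ne.symm he1, Ne.symm he2,
        Ne.symm hx, Ne.symm hxz, Ne.symm hz])
      (by simp)
    have h5 : ({E, F0, E'} : Finset (Bk V)).card ≤ 3 := card_le_three
    simp at this
    omega

/-- The final configuration is impossible. -/
lemma final_gadget (h : Ctx Q P R m B LQ LP) {F0 F E1 E2 E3 : Bk V} (w : Bk V → Fin 3)
    (hw : ∀ E, Good R m B LQ LP E F0 →
      ∃ b, ∀ i j, (i = w E ∨ j = b) → Gx R m LQ LP (E, i) (F0, j))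
    {k1 k2 k3 : Fin 3} (hk1 : k1 ≠ w E1) (hk2 : k2 ≠ w E2) (hk3 : k3 ≠ w E3)
    (hR : R F.1 (E1.2 k1) (E2.2 k2) (E3.2 k3))
    (gF : Good R m B LQ LP F F0) (g1 : Good R m B LQ LP E1 F0) (g2 : Good R m B LQ LP E2 F0)
    (g3 : Good R m B LQ LP E3 F0) (gF1 : Good R m B LQ LP F E1) (n2 : F ≠ E2) (g3F : Good R m B LQ LP E3 F)
    (g12 : Good R m B LQ LP E1 E2) (n13 : E1 ≠ E3) (g23 : Good R m B LQ LP E2 E3) : False := by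
  have cs : ∀ E E', Good R m B LQ LP E F0 → Good R m B LQ LP E' F0 → Good R m B LQ LP E E' →
      ∀ j, Gx R m LQ LP (E, w E) (E', j) := fun E E' a b c =>
    consist h (w E) a.1 a.2.1 a.2.2.1 (hw E a) c (b.symm h)
  obtain ⟨u1, a1, b1⟩ := fin3_third k1 (w E1)
  obtain ⟨u2, a2, b2⟩ := fin3_third k2 (w E2)
  obtain ⟨u3, a3, b3⟩ := fin3_third k3 (w E3)
  obtain ⟨f, hf, _⟩ := fin3_third (w F) (w F)
  have nF1 := gF1.2.2.1
  have n3F := g3F.2.2.1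
  have n12 := g12.2.2.1
  have n23 := g23.2.2.1
  have mF := gF.1
  have m1 := g1.1
  have m2 := g2.1
  have m3 := g3.1
  have c1 := cs F E1 gF g1 gF1 u1
  have c2 := cs E1 E2 g1 g2 g12 u2
  have c3 := cs E2 E3 g2 g3 g23 u3
  have c4 := cs E3 F g3 gF g3F f
  have hKB : ({F, E1, E2, E3} : Finset (Bk V)) ⊆ B := by
    intro x; simp only [mem_insert, mem_singleton]; rintro (rfl | rfl | rfl | rfl) <;> assumption
  have hne : ∀ E ∈ B, ∀ j, E.2 j ≠ F.1 := by
    intro E hE j he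
    have hq := (h.fam.1 F mF).1
    have hp := (h.fam.1 E hE).2.1 j
    rw [he] at hp
    exact Finset.disjoint_left.1 h.hs.disj hq hp
  have hin : ∀ E ∈ B, ∀ E' ∈ B, ∀ i j, E.2 i = E'.2 j ↔ (E = E' ∧ i = j) := fun E hE E' hE' i j =>
    ⟨fun hh => h.inj hE hE' hh, fun hh => by rw [hh.1, hh.2]⟩
  have := noG h {F, E1, E2, E3} hKB {F.1, E1.2 k1, E2.2 k2, E3.2 k3} 1 (Til.single hR) le_rfl
    (by
      intro x hx
      simp only [mem_insert, mem_singleton] at hx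
      simp only [mem_biUnion, mem_vs]
      rcases hx with rfl | rfl | rfl | rfl
      exacts [⟨F, by simp, Or.inl rfl⟩, ⟨E1, by simp, Or.inr ⟨_, rfl⟩⟩,
        ⟨E2, by simp, Or.inr ⟨_, rfl⟩⟩, ⟨E3, by simp, Or.inr ⟨_, rfl⟩⟩])
    [((F, w F), (E1, u1)), ((E1, w E1), (E2, u2)), ((E2, w E2), (E3, u3)), ((E3, w E3), (F, f))]
    (by simp) (by simp [c1, c2, c3, c4])
    (by simp [nF1, nF1.symm, n2, n2.symm, n3F, n3F.symm, n12, n12.symm, n13, n13.symm, n23, n23.symm,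
      b1, b1.symm, b2, b2.symm, b3, b3.symm, hf, hf.symm])
    (by
      simp [hne F mF, hne E1 m1, hne E2 m2, hne E3 m3, hin F mF E1 m1, hin F mF E2 m2,
        hin F mF E3 m3, hin E1 m1 E1 m1, hin E1 m1 E2 m2, hin E1 m1 E3 m3, hin E2 m2 E1 m1,
        hin E2 m2 E2 m2, hin E2 m2 E3 m3, hin E3 m3 E1 m1, hin E3 m3 E2 m2, hin E3 m3 E3 m3,
        nF1, nF1.symm, n2, n2.symm, n3F, n3F.symm, n12, n12.symm, n13, n13.symm, n23, n23.symm,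
        a1, a2, a3, hk1.symm, hk2.symm, hk3.symm])
  have h5 : ({F, E1, E2, E3} : Finset (Bk V)).card ≤ 4 := card_le_four
  simp at this
  omega

end
end PM13


namespace PM13
open Finset
set_option linter.unusedSectionVars false
set_option linter.unusedVariables false

section
variable {V : Type} [Fintype V] [DecidableEq V] {Q P : Finset V} {R : V → V → V → V → Prop}
  {m N g : ℕ} {B : Finset (Bk V)} {LQ LP : Finset V}

/-- number of cross `G`-pairs -/
noncomputable def crossN (R : V → V → V → V → Prop) (m : ℕ) (B : Finset (Bk V))
    (LQ LP : Finset V) : ℕ :=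
  cn (fun x : (Bk V × Bk V) × (Fin 3 × Fin 3) => x.1.1 ∈ B ∧ x.1.2 ∈ B ∧ x.1.1 ≠ x.1.2 ∧
    Gx R m LQ LP (x.1.1, x.2.1) (x.1.2, x.2.2))

lemma Ctx.block (h : Ctx Q P R m B LQ LP) {x : V} (hx : x ∈ P) (hx' : x ∉ LP) :
    ∃ E ∈ B, ∃ i, x = E.2 i := by
  have : x ∈ B.biUnion vs := by
    by_contra hc
    exact hx' ((h.lp x).2 ⟨hx, hc⟩)
  obtain ⟨E, hE, hxE⟩ := mem_biUnion.1 this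
  rcases mem_vs.1 hxE with rfl | ⟨i, rfl⟩
  · exact absurd hx (fun hh => Finset.disjoint_left.1 h.hs.disj (h.fam.1 E hE).1 hh)
  · exact ⟨E, hE, i, rfl⟩

lemma cross_lower (h : Ctx Q P R m B LQ LP) (hQ : Q.card = N) (hP : P.card = 3 * N)
    (hB : B.card ≤ N)
    (hdeg : ∀ q ∈ Q, ∀ u ∈ P, 5 * N ^ 2 ≤ g + cn (fun x : V × V => R q u x.1 x.2)) :
    3 * m ^ 2 * (5 * N ^ 2) ≤ 3 * m ^ 2 * (g + crossN R m B LQ LP) + 54 * m ^ 3 * N +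
      540 * m * N ^ 2 + 27 * m ^ 2 * N := by
  set tot := cn (fun x : (V × V) × (V × V) => x.1.1 ∈ LQ ∧ x.1.2 ∈ LP ∧ R x.1.1 x.1.2 x.2.1 x.2.2)
    with htot
  have low : (LQ ×ˢ LP).card * (5 * N ^ 2 - g) ≤ tot := by
    refine cn_prod_ge _ _ ?_
    rintro ⟨q, p⟩ hqp
    obtain ⟨hq, hp⟩ := mem_product.1 hqp
    have := hdeg q ((h.lq q).1 hq).1 p ((h.lp p).1 hp).1
    have e : cn (fun b : V × V => q ∈ LQ ∧ p ∈ LP ∧ R q p b.1 b.2) =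
      cn (fun x : V × V => R q p x.1 x.2) := cn_congr (fun b => by simp only [] at hq hp; tauto)
    show _ ≤ cn (fun b : V × V => q ∈ LQ ∧ p ∈ LP ∧ R q p b.1 b.2)
    rw [e]; omega
  have hsw : tot = cn (fun x : (V × V) × (V × V) => x.2.1 ∈ LQ ∧ x.2.2 ∈ LP ∧
      R x.2.1 x.2.2 x.1.1 x.1.2) :=
    (cn_equiv (Equiv.prodComm (V × V) (V × V)) (fun x => x.1.1 ∈ LQ ∧ x.1.2 ∈ LP ∧
      R x.1.1 x.1.2 x.2.1 x.2.2)).symm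
  have hfib : ∀ x : V × V, cn (fun a : V × V => a.1 ∈ LQ ∧ a.2 ∈ LP ∧ R a.1 a.2 x.1 x.2) ≤
      3 * m ^ 2 := by
    intro x
    refine (cn_mono (q := fun a => a ∈ LQ ×ˢ LP) (fun a ha => mem_product.2 ⟨ha.1, ha.2.1⟩)).trans ?_
    rw [cn_mem, card_product, h.clq, h.clp]; nlinarith
  -- the four classes
  let S1 : Finset (V × V) := LP ×ˢ P
  let S2 : Finset (V × V) := P ×ˢ LP
  let S3 : Finset (V × V) := P ×ˢ P
  let S4 : Finset (V × V) := B.biUnion (fun E => (univ ×ˢ univ : Finset (Fin 3 × Fin 3)).image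
    (fun ij => (E.2 ij.1, E.2 ij.2)))
  let S5 : Finset (V × V) := (FS (fun x : (Bk V × Bk V) × (Fin 3 × Fin 3) => x.1.1 ∈ B ∧ x.1.2 ∈ B ∧
    x.1.1 ≠ x.1.2 ∧ Gx R m LQ LP (x.1.1, x.2.1) (x.1.2, x.2.2))).image
    (fun x => (x.1.1.2 x.2.1, x.1.2.2 x.2.2))
  let T (x : (V × V) × (V × V)) : Prop := x.2.1 ∈ LQ ∧ x.2.2 ∈ LP ∧ R x.2.1 x.2.2 x.1.1 x.1.2
  have cls : ∀ S : Finset (V × V), cn (fun x : (V × V) × (V × V) => x.1 ∈ S ∧ T x) ≤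
      S.card * (3 * m ^ 2) := by
    intro S
    refine cn_prod_le S _ (fun a b h => h.1) (fun a ha => ?_)
    exact (cn_mono (fun b hb => hb.2)).trans (hfib a)
  have cls3 : cn (fun x : (V × V) × (V × V) => (x.1 ∈ S3 ∧ ¬ GG R m LQ LP x.1.1 x.1.2) ∧ T x) ≤
      S3.card * (60 * m) := by
    refine cn_prod_le S3 _ (fun a b h => h.1.1) (fun a ha => ?_)
    by_cases hG : GG R m LQ LP a.1 a.2
    · by_contra hne
      obtain ⟨F, hF⟩ := cn_pos (lt_of_le_of_lt (Nat.zero_le _) (not_le.1 hne))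
      exact hF.1.2 hG
    · exact (cn_mono (fun b hb => hb.2)).trans (not_lt.1 hG)
  have cover : ∀ x, T x → x.1 ∈ S1 ∧ T x ∨ x.1 ∈ S2 ∧ T x ∨
      (x.1 ∈ S3 ∧ ¬ GG R m LQ LP x.1.1 x.1.2) ∧ T x ∨ x.1 ∈ S4 ∧ T x ∨ x.1 ∈ S5 ∧ T x := by
    rintro ⟨⟨x, y⟩, ⟨q, p⟩⟩ hT
    obtain ⟨_, _, hx, hy⟩ := h.hs.mem _ _ _ _ hT.2.2
    simp only [] at hx hy
    by_cases h1 : x ∈ LP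
    · exact Or.inl ⟨mem_product.2 ⟨h1, hy⟩, hT⟩
    by_cases h2 : y ∈ LP
    · exact Or.inr (Or.inl ⟨mem_product.2 ⟨hx, h2⟩, hT⟩)
    by_cases h3 : GG R m LQ LP x y
    · obtain ⟨E, hE, i, rfl⟩ := h.block hx h1
      obtain ⟨F, hF, j, rfl⟩ := h.block hy h2
      by_cases hEF : E = F
      · subst hEF
        refine Or.inr (Or.inr (Or.inr (Or.inl ⟨?_, hT⟩)))
        exact mem_biUnion.2 ⟨E, hE, mem_image.2 ⟨(i, j), by simp, rfl⟩⟩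
      · refine Or.inr (Or.inr (Or.inr (Or.inr ⟨?_, hT⟩)))
        exact mem_image.2 ⟨((E, F), (i, j)), by simp only [mem_FS]; exact ⟨hE, hF, hEF, h3⟩, rfl⟩
    · exact Or.inr (Or.inr (Or.inl ⟨⟨mem_product.2 ⟨hx, hy⟩, h3⟩, hT⟩))
  have up : tot ≤ cn (fun x : (V × V) × (V × V) => x.1 ∈ S1 ∧ T x) +
      (cn (fun x : (V × V) × (V × V) => x.1 ∈ S2 ∧ T x) +
      (cn (fun x : (V × V) × (V × V) => (x.1 ∈ S3 ∧ ¬ GG R m LQ LP x.1.1 x.1.2) ∧ T x) +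
      (cn (fun x : (V × V) × (V × V) => x.1 ∈ S4 ∧ T x) +
      cn (fun x : (V × V) × (V × V) => x.1 ∈ S5 ∧ T x)))) := by
    rw [hsw]
    refine (cn_cover cover).trans (Nat.add_le_add_left ?_ _)
    refine (cn_or _ _).trans (Nat.add_le_add_left ?_ _)
    refine (cn_or _ _).trans (Nat.add_le_add_left ?_ _)
    exact cn_or _ _
  have k1 : S1.card = 9 * m * N := by simp only [S1, card_product, h.clp, hP]; ring
  have k2 : S2.card = 9 * m * N := by simp only [S2, card_product, h.clp, hP]; ring
  have k3 : S3.card = 9 * N ^ 2 := by simp only [S3, card_product, hP]; ring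
  have k4 : S4.card ≤ 9 * N := by
    refine (card_biUnion_le_card_mul B _ 9 (fun E _ => card_image_le)).trans ?_
    omega
  have k5 : S5.card ≤ crossN R m B LQ LP := card_image_le
  have l1 := cls S1
  have l2 := cls S2
  have l4 := cls S4
  have l5 := cls S5
  rw [k1] at l1
  rw [k2] at l2
  rw [k3] at cls3
  rw [card_product, h.clq, h.clp] at low
  have l4' := l4.trans (Nat.mul_le_mul_right _ k4)
  have l5' := l5.trans (Nat.mul_le_mul_right _ k5)
  have hfin : m * (3 * m) * (5 * N ^ 2) ≤ m * (3 * m) * (5 * N ^ 2 - g) + m * (3 * m) * g := by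
    rw [← Nat.mul_add]
    exact Nat.mul_le_mul_left _ (by omega)
  nlinarith

noncomputable def arrN (R : V → V → V → V → Prop) (m : ℕ) (B : Finset (Bk V))
    (LQ LP : Finset V) : ℕ := cn (fun x : (Bk V × Bk V) × (Fin 3 × Fin 3 × Fin 3) =>
      Arr R m B LQ LP x.2 x.1.1 x.1.2)

noncomputable def ngN (R : V → V → V → V → Prop) (m : ℕ) (B : Finset (Bk V))
    (LQ LP : Finset V) : ℕ := cn (fun x : Bk V × Bk V => x.1 ∈ B ∧ x.2 ∈ B ∧ x.1 ≠ x.2 ∧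
      ¬ Good R m B LQ LP x.1 x.2)

lemma cross_upper (h : Ctx Q P R m B LQ LP) :
    crossN R m B LQ LP + ngN R m B LQ LP ≤ 5 * B.card ^ 2 + 10 * arrN R m B LQ LP := by
  classical
  have a1 : arrN R m B LQ LP = ∑ x : Bk V × Bk V, cn (fun t => Arr R m B LQ LP t x.1 x.2) := by
    unfold arrN; rw [cn_prod]
  have a2 : arrN R m B LQ LP = ∑ x : Bk V × Bk V, cn (fun t => Arr R m B LQ LP t x.2 x.1) := by
    rw [a1]
    exact (Equiv.sum_comp (Equiv.prodComm (Bk V) (Bk V))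
      (fun x => cn (fun t => Arr R m B LQ LP t x.1 x.2))).symm
  have b1 : 5 * B.card ^ 2 = ∑ x : Bk V × Bk V, if x ∈ B ×ˢ B then 5 else 0 := by
    rw [← sum_filter, sum_const, smul_eq_mul, mul_comm, sq, ← card_product]
    congr 2
    ext x; simp
  have e10 : 5 * B.card ^ 2 + 10 * arrN R m B LQ LP = ∑ x : Bk V × Bk V,
      ((if x ∈ B ×ˢ B then 5 else 0) + 5 * cn (fun t => Arr R m B LQ LP t x.1 x.2) +
        5 * cn (fun t => Arr R m B LQ LP t x.2 x.1)) := by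
    rw [sum_add_distrib, sum_add_distrib, ← mul_sum, ← mul_sum, ← a1, ← a2, ← b1]; ring
  rw [e10]
  unfold crossN ngN
  rw [cn_prod, cn_eq_sum, ← sum_add_distrib]
  apply sum_le_sum
  rintro ⟨E, F⟩ _
  simp only [mem_product]
  by_cases hc : E ∈ B ∧ F ∈ B ∧ E ≠ F
  · obtain ⟨hE, hF, hne⟩ := hc
    have c0 : cn (fun b : Fin 3 × Fin 3 => E ∈ B ∧ F ∈ B ∧ E ≠ F ∧
        Gx R m LQ LP (E, b.1) (F, b.2)) = ee R m LQ LP E F :=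
      cn_congr (fun b => by tauto)
    rw [c0]
    have c9 : ee R m LQ LP E F ≤ 9 := (cn_le_card _).trans (by simp)
    have hi : (if E ∈ B ∧ F ∈ B ∧ E ≠ F ∧ ¬ Good R m B LQ LP E F then 1 else 0) ≤ 1 := by
      split_ifs <;> simp
    rw [if_pos (⟨hE, hF⟩ : E ∈ B ∧ F ∈ B)]
    have pos : ∀ E F, (∃ t, Arr R m B LQ LP t E F) → 1 ≤ cn (fun t => Arr R m B LQ LP t E F) := by
      rintro E F ⟨t, ht⟩
      exact card_pos.2 ⟨t, by simpa using ht⟩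
    rcases dich h hE hF hne with h1 | h1 | h1 | h1
    · have := pos _ _ h1
      omega
    · have := pos _ _ h1
      omega
    · rw [if_neg (by tauto)]
      omega
    · omega
  · have c0 : cn (fun b : Fin 3 × Fin 3 => E ∈ B ∧ F ∈ B ∧ E ≠ F ∧
        Gx R m LQ LP (E, b.1) (F, b.2)) = 0 := by
      by_contra hne
      obtain ⟨b, hb⟩ := cn_pos (Nat.pos_of_ne_zero hne)
      tauto
    rw [c0, if_neg (by tauto)]
    omega

lemma arrN_le (h : Ctx Q P R m B LQ LP) (hB : B.card ≤ N) (K : ℕ) (hK : 3 * K ^ 2 ≤ N) :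
    K * arrN R m B LQ LP ≤ 27 * N ^ 2 := by
  have key : ∀ t, K * cn (fun x : Bk V × Bk V => Arr R m B LQ LP t x.1 x.2) ≤ N ^ 2 := by
    intro t
    have h1 := arr_count h t
    have h2 : B.card ^ 3 ≤ N ^ 3 := Nat.pow_le_pow_left hB 3
    rw [← Nat.pow_le_pow_iff_left (two_ne_zero), mul_pow]
    calc K ^ 2 * (cn (fun x : Bk V × Bk V => Arr R m B LQ LP t x.1 x.2)) ^ 2
        ≤ K ^ 2 * (3 * N ^ 3) := Nat.mul_le_mul_left _ (h1.trans (by omega))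
      _ = (3 * K ^ 2) * N ^ 3 := by ring
      _ ≤ N * N ^ 3 := Nat.mul_le_mul_right _ hK
      _ = _ := by ring
  unfold arrN
  rw [cn_prod', mul_sum]
  refine (sum_le_sum (fun t _ => key t)).trans ?_
  simp

lemma ngN_le (h : Ctx Q P R m B LQ LP) (hQ : Q.card = N) (hP : P.card = 3 * N)
    (hB : B.card ≤ N)
    (hdeg : ∀ q ∈ Q, ∀ u ∈ P, 5 * N ^ 2 ≤ g + cn (fun x : V × V => R q u x.1 x.2))
    (K : ℕ) (hK : 3 * K ^ 2 ≤ N) (hg : K * g ≤ N ^ 2) (hm : K * m ≤ N) (hKm : K ≤ m)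
    (hm0 : 0 < m) :
    K * ngN R m B LQ LP ≤ 478 * N ^ 2 := by
  have h1 := cross_lower h hQ hP hB hdeg
  have h2 := cross_upper h
  have h3 := arrN_le h hB K hK
  have h4 : B.card ^ 2 ≤ N ^ 2 := Nat.pow_le_pow_left hB 2
  set c := crossN R m B LQ LP
  set n := ngN R m B LQ LP
  set a := arrN R m B LQ LP
  have hKN : K ≤ N := by nlinarith
  have h5 : 3 * m ^ 2 * n ≤ 3 * m ^ 2 * (g + 10 * a) + 54 * m ^ 3 * N + 540 * m * N ^ 2 +
      27 * m ^ 2 * N := by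
    have : 3 * m ^ 2 * (c + n) ≤ 3 * m ^ 2 * (5 * N ^ 2 + 10 * a) :=
      Nat.mul_le_mul_left _ (by omega)
    nlinarith
  have h6 : 3 * m ^ 2 * (K * n) ≤ 3 * m ^ 2 * (478 * N ^ 2) := by
    calc 3 * m ^ 2 * (K * n) = K * (3 * m ^ 2 * n) := by ring
      _ ≤ K * (3 * m ^ 2 * (g + 10 * a) + 54 * m ^ 3 * N + 540 * m * N ^ 2 + 27 * m ^ 2 * N) :=
        Nat.mul_le_mul_left _ h5
      _ = 3 * m ^ 2 * (K * g) + 30 * m ^ 2 * (K * a) + 54 * m ^ 2 * N * (K * m) +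
          540 * m * N ^ 2 * K + 27 * m ^ 2 * N * K := by ring
      _ ≤ 3 * m ^ 2 * (N ^ 2) + 30 * m ^ 2 * (27 * N ^ 2) + 54 * m ^ 2 * N * N +
          540 * m * N ^ 2 * m + 27 * m ^ 2 * N * N := by gcongr
      _ = 3 * m ^ 2 * (478 * N ^ 2) := by ring
  exact Nat.le_of_mul_le_mul_left h6 (by positivity)

end
end PM13


namespace PM13
open Finset
set_option linter.unusedSectionVars false
set_option linter.unusedVariables false

section
variable {V : Type} [Fintype V] [DecidableEq V] {Q P : Finset V} {R : V → V → V → V → Prop}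
  {m N g : ℕ} {B : Finset (Bk V)} {LQ LP : Finset V}

lemma Ctx.blk (h : Ctx Q P R m B LQ LP) {x : V} (hx : x ∈ Q ∪ P) (hx' : x ∉ LQ ∪ LP) :
    ∃ E ∈ B, x ∈ vs E := by
  by_contra hc
  have : x ∉ B.biUnion vs := fun hh => hc (by
    obtain ⟨E, hE, hxE⟩ := mem_biUnion.1 hh
    exact ⟨E, hE, hxE⟩)
  rcases mem_union.1 hx with hx | hx
  · exact hx' (mem_union_left _ ((h.lq x).2 ⟨hx, this⟩))
  · exact hx' (mem_union_right _ ((h.lp x).2 ⟨hx, this⟩))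

lemma Ctx.uniq (h : Ctx Q P R m B LQ LP) {x : V} {E F : Bk V} (hE : E ∈ B) (hF : F ∈ B)
    (h1 : x ∈ vs E) (h2 : x ∈ vs F) : E = F := by
  by_contra hne
  exact Finset.disjoint_left.1 (h.fam.2 E hE F hF hne) h1 h2

lemma vs_card (E : Bk V) : (vs E).card ≤ 4 := card_le_four

def BV (Q P : Finset V) (R : V → V → V → V → Prop) (m : ℕ) (B : Finset (Bk V)) (LQ LP : Finset V)
    (x : V × V) : Prop := x.1 ∈ Q ∪ P ∧ x.2 ∈ Q ∪ P ∧
    ¬ ∃ E F, x.1 ∈ vs E ∧ x.2 ∈ vs F ∧ Good R m B LQ LP E F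

def BV0 (Q P : Finset V) (R : V → V → V → V → Prop) (m : ℕ) (B : Finset (Bk V)) (LQ LP : Finset V)
    (F0 : Bk V) (x : V) : Prop := x ∈ Q ∪ P ∧ ¬ ∃ E, x ∈ vs E ∧ Good R m B LQ LP E F0

lemma bv_count (h : Ctx Q P R m B LQ LP) (hQ : Q.card = N) (hP : P.card = 3 * N)
    (hB : B.card ≤ N) :
    cn (BV Q P R m B LQ LP) ≤ 32 * m * N + 16 * N + 16 * ngN R m B LQ LP := by
  have cL : (LQ ∪ LP).card ≤ 4 * m := (card_union_le _ _).trans (by rw [h.clq, h.clp]; omega)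
  have cA : (Q ∪ P).card ≤ 4 * N := (card_union_le _ _).trans (by omega)
  let S4 : Finset (V × V) := B.biUnion (fun E => vs E ×ˢ vs E)
  let S5 : Finset (V × V) := (FS (fun x : Bk V × Bk V => x.1 ∈ B ∧ x.2 ∈ B ∧ x.1 ≠ x.2 ∧
      ¬ Good R m B LQ LP x.1 x.2)).biUnion (fun x => vs x.1 ×ˢ vs x.2)
  have hsub : ∀ x, BV Q P R m B LQ LP x → x ∈ (LQ ∪ LP) ×ˢ (Q ∪ P) ∪ (Q ∪ P) ×ˢ (LQ ∪ LP) ∪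
      (S4 ∪ S5) := by
    rintro ⟨x, y⟩ ⟨hx, hy, hn⟩
    simp only [] at hx hy hn
    by_cases h1 : x ∈ LQ ∪ LP
    · exact mem_union_left _ (mem_union_left _ (mem_product.2 ⟨h1, hy⟩))
    by_cases h2 : y ∈ LQ ∪ LP
    · exact mem_union_left _ (mem_union_right _ (mem_product.2 ⟨hx, h2⟩))
    obtain ⟨E, hE, hxE⟩ := h.blk hx h1
    obtain ⟨F, hF, hyF⟩ := h.blk hy h2
    by_cases hEF : E = F
    · subst hEF
      exact mem_union_right _ (mem_union_left _ (mem_biUnion.2 ⟨E, hE, mem_product.2 ⟨hxE, hyF⟩⟩))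
    · refine mem_union_right _ (mem_union_right _ (mem_biUnion.2 ⟨(E, F), ?_, mem_product.2 ⟨hxE, hyF⟩⟩))
      rw [mem_FS]
      exact ⟨hE, hF, hEF, fun hG => hn ⟨E, F, hxE, hyF, hG⟩⟩
  have h44 : ∀ E F : Bk V, (vs E ×ˢ vs F).card ≤ 16 := by
    intro E F
    rw [card_product]
    exact Nat.mul_le_mul (vs_card E) (vs_card F)
  have k4 : S4.card ≤ B.card * 16 := card_biUnion_le_card_mul B _ 16 (fun E _ => h44 E E)
  have k5 : S5.card ≤ ngN R m B LQ LP * 16 := card_biUnion_le_card_mul _ _ 16 (fun x _ => h44 x.1 x.2)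
  have k0 := cn_mono hsub
  rw [cn_mem] at k0
  have u1 := card_union_le ((LQ ∪ LP) ×ˢ (Q ∪ P) ∪ (Q ∪ P) ×ˢ (LQ ∪ LP)) (S4 ∪ S5)
  have u2 := card_union_le ((LQ ∪ LP) ×ˢ (Q ∪ P)) ((Q ∪ P) ×ˢ (LQ ∪ LP))
  have u3 := card_union_le S4 S5
  have u4 : ((LQ ∪ LP) ×ˢ (Q ∪ P)).card ≤ 4 * m * (4 * N) := by
    rw [card_product]; exact Nat.mul_le_mul cL cA
  have u5 : ((Q ∪ P) ×ˢ (LQ ∪ LP)).card ≤ 4 * m * (4 * N) := by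
    rw [card_product, mul_comm]; exact Nat.mul_le_mul cL cA
  nlinarith

lemma bv0_count (h : Ctx Q P R m B LQ LP) (F0 : Bk V) (n0 : ℕ)
    (hn0 : cn (fun E : Bk V => E ∈ B ∧ F0 ∈ B ∧ E ≠ F0 ∧ ¬ Good R m B LQ LP E F0) ≤ n0)
    (hF0 : F0 ∈ B) :
    cn (BV0 Q P R m B LQ LP F0) ≤ 4 * m + 4 + 4 * n0 := by
  have cL : (LQ ∪ LP).card ≤ 4 * m := (card_union_le _ _).trans (by rw [h.clq, h.clp]; omega)
  let S5 : Finset V := (FS (fun E : Bk V => E ∈ B ∧ F0 ∈ B ∧ E ≠ F0 ∧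
      ¬ Good R m B LQ LP E F0)).biUnion vs
  have hsub : ∀ x, BV0 Q P R m B LQ LP F0 x → x ∈ (LQ ∪ LP) ∪ (vs F0 ∪ S5) := by
    rintro x ⟨hx, hn⟩
    by_cases h1 : x ∈ LQ ∪ LP
    · exact mem_union_left _ h1
    obtain ⟨E, hE, hxE⟩ := h.blk hx h1
    by_cases hEF : E = F0
    · subst hEF
      exact mem_union_right _ (mem_union_left _ hxE)
    · refine mem_union_right _ (mem_union_right _ (mem_biUnion.2 ⟨E, ?_, hxE⟩))
      rw [mem_FS]
      exact ⟨hE, hF0, hEF, fun hG => hn ⟨E, hxE, hG⟩⟩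
  have k5 : S5.card ≤ _ * 4 := card_biUnion_le_card_mul _ _ 4 (fun x _ => vs_card x)
  have k5' : S5.card ≤ n0 * 4 := k5.trans (Nat.mul_le_mul_right _ hn0)
  have k0 := cn_mono hsub
  rw [cn_mem] at k0
  have u1 := card_union_le (LQ ∪ LP) (vs F0 ∪ S5)
  have u2 := card_union_le (vs F0) S5
  have := vs_card F0
  omega

/-- tuples with a pair of coordinates in a given set -/
lemma tup_pair (A : Finset V) (b : V × V → Prop) (hb : ∀ x, b x → x.1 ∈ A ∧ x.2 ∈ A) :
    cn (fun x : V × V × V × V => (x.1 ∈ A ∧ x.2.1 ∈ A ∧ x.2.2.1 ∈ A ∧ x.2.2.2 ∈ A) ∧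
      (b (x.1, x.2.1) ∨ b (x.1, x.2.2.1) ∨ b (x.1, x.2.2.2) ∨ b (x.2.1, x.2.2.1) ∨
        b (x.2.1, x.2.2.2) ∨ b (x.2.2.1, x.2.2.2))) ≤ 6 * (cn b * A.card ^ 2) := by
  have base : cn (fun x : (V × V) × (V × V) => b x.1 ∧ x.2 ∈ A ×ˢ A) = cn b * A.card ^ 2 := by
    rw [cn_and_prod b (fun x => x ∈ A ×ˢ A), cn_mem, card_product, sq]
  have key : ∀ f : V × V × V × V → (V × V) × (V × V), Function.Injective f →
      cn (fun x : V × V × V × V => b (f x).1 ∧ (f x).2 ∈ A ×ˢ A) ≤ cn b * A.card ^ 2 := by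
    intro f hf
    rw [← base]
    exact cn_inj f (fun a h => h) (fun a b _ _ h => hf h)
  have c1 := key (fun x => ((x.1, x.2.1), (x.2.2.1, x.2.2.2))) (by intro x y; simp [Prod.ext_iff]; tauto)
  have c2 := key (fun x => ((x.1, x.2.2.1), (x.2.1, x.2.2.2))) (by intro x y; simp [Prod.ext_iff]; tauto)
  have c3 := key (fun x => ((x.1, x.2.2.2), (x.2.1, x.2.2.1))) (by intro x y; simp [Prod.ext_iff]; tauto)
  have c4 := key (fun x => ((x.2.1, x.2.2.1), (x.1, x.2.2.2))) (by intro x y; simp [Prod.ext_iff]; tauto)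
  have c5 := key (fun x => ((x.2.1, x.2.2.2), (x.1, x.2.2.1))) (by intro x y; simp [Prod.ext_iff]; tauto)
  have c6 := key (fun x => ((x.2.2.1, x.2.2.2), (x.1, x.2.1))) (by intro x y; simp [Prod.ext_iff]; tauto)
  simp only [mem_product] at c1 c2 c3 c4 c5 c6
  refine (cn_mono (q := fun x : V × V × V × V => (b (x.1, x.2.1) ∧ x.2.2.1 ∈ A ∧ x.2.2.2 ∈ A) ∨
    (b (x.1, x.2.2.1) ∧ x.2.1 ∈ A ∧ x.2.2.2 ∈ A) ∨ (b (x.1, x.2.2.2) ∧ x.2.1 ∈ A ∧ x.2.2.1 ∈ A) ∨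
    (b (x.2.1, x.2.2.1) ∧ x.1 ∈ A ∧ x.2.2.2 ∈ A) ∨ (b (x.2.1, x.2.2.2) ∧ x.1 ∈ A ∧ x.2.2.1 ∈ A) ∨
    (b (x.2.2.1, x.2.2.2) ∧ x.1 ∈ A ∧ x.2.1 ∈ A)) (fun x hx => by tauto)).trans ?_
  refine (cn_or _ _).trans ?_
  refine (Nat.add_le_add_left ((cn_or _ _).trans (Nat.add_le_add_left ((cn_or _ _).trans
    (Nat.add_le_add_left ((cn_or _ _).trans (Nat.add_le_add_left (cn_or _ _) _)) _)) _)) _).trans ?_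
  omega

lemma tup_single (A : Finset V) (b : V → Prop) (hb : ∀ x, b x → x ∈ A) :
    cn (fun x : V × V × V × V => (x.1 ∈ A ∧ x.2.1 ∈ A ∧ x.2.2.1 ∈ A ∧ x.2.2.2 ∈ A) ∧
      (b x.1 ∨ b x.2.1 ∨ b x.2.2.1 ∨ b x.2.2.2)) ≤ 4 * (cn b * A.card ^ 3) := by
  have base : cn (fun x : V × (V × V × V) => b x.1 ∧ x.2 ∈ A ×ˢ A ×ˢ A) = cn b * A.card ^ 3 := by
    rw [cn_and_prod b (fun x => x ∈ A ×ˢ A ×ˢ A), cn_mem, card_product, card_product]; ring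
  have key : ∀ f : V × V × V × V → V × (V × V × V), Function.Injective f →
      cn (fun x : V × V × V × V => b (f x).1 ∧ (f x).2 ∈ A ×ˢ A ×ˢ A) ≤ cn b * A.card ^ 3 := by
    intro f hf
    rw [← base]
    exact cn_inj f (fun a h => h) (fun a b _ _ h => hf h)
  have c1 := key (fun x => (x.1, (x.2.1, x.2.2.1, x.2.2.2))) (by intro x y; simp [Prod.ext_iff])
  have c2 := key (fun x => (x.2.1, (x.1, x.2.2.1, x.2.2.2))) (by intro x y; simp [Prod.ext_iff]; tauto)
  have c3 := key (fun x => (x.2.2.1, (x.1, x.2.1, x.2.2.2))) (by intro x y; simp [Prod.ext_iff]; tauto)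
  have c4 := key (fun x => (x.2.2.2, (x.1, x.2.1, x.2.2.1))) (by intro x y; simp [Prod.ext_iff]; tauto)
  simp only [mem_product] at c1 c2 c3 c4
  refine (cn_mono (q := fun x : V × V × V × V => (b x.1 ∧ x.2.1 ∈ A ∧ x.2.2.1 ∈ A ∧ x.2.2.2 ∈ A) ∨
    (b x.2.1 ∧ x.1 ∈ A ∧ x.2.2.1 ∈ A ∧ x.2.2.2 ∈ A) ∨ (b x.2.2.1 ∧ x.1 ∈ A ∧ x.2.1 ∈ A ∧ x.2.2.2 ∈ A) ∨
    (b x.2.2.2 ∧ x.1 ∈ A ∧ x.2.1 ∈ A ∧ x.2.2.1 ∈ A)) (fun x hx => by tauto)).trans ?_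
  refine (cn_or _ _).trans ?_
  refine (Nat.add_le_add_left ((cn_or _ _).trans (Nat.add_le_add_left (cn_or _ _) _)) _).trans ?_
  omega

set_option maxHeartbeats 4000000 in
theorem almost (hs : Sys Q P R) (hQ : Q.card = N) (hP : P.card = 3 * N)
    (hdeg : ∀ q ∈ Q, ∀ u ∈ P, 5 * N ^ 2 ≤ g + cn (fun x : V × V => R q u x.1 x.2))
    (D : ℕ) (hD : 0 < D)
    (hext : ∀ U ⊆ P, 2 * N ≤ U.card → N ^ 4 ≤ D * cn (fun x : V × V × V × V =>
      R x.1 x.2.1 x.2.2.1 x.2.2.2 ∧ x.2.1 ∈ U ∧ x.2.2.1 ∈ U ∧ x.2.2.2 ∈ U))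
    (K : ℕ) (hKD : K = 2 ^ 21 * D) (hK : 3 * K ^ 2 ≤ N) (hg : K * g ≤ N ^ 2) (hm : K * m ≤ N)
    (hKm : K ≤ m) : ∃ k S, Til R k S ∧ N < k + m := by
  classical
  by_contra hcon
  push Not at hcon
  have hK2 : 2 ^ 21 ≤ K := by rw [hKD]; nlinarith
  have hm0 : 0 < m := by omega
  have hmN : 2 * m ≤ N := by nlinarith
  obtain ⟨B, LQ, LP, h, hBc⟩ := exists_ctx hs hQ hP (by omega) hcon
  have hB : B.card ≤ N := by omega
  have hKN : K ≤ N := by nlinarith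
  have hng := ngN_le h hQ hP hB hdeg K hK hg hm hKm hm0
  have hBpos : B.Nonempty := card_pos.1 (by omega)
  -- choose F0
  obtain ⟨F0, hF0, hF0c⟩ : ∃ F0 ∈ B, K * cn (fun E : Bk V => E ∈ B ∧ F0 ∈ B ∧ E ≠ F0 ∧
      ¬ Good R m B LQ LP E F0) ≤ 956 * N := by
    by_contra hc
    push Not at hc
    have h1 : B.card * (956 * N + 1) ≤ K * ngN R m B LQ LP := by
      unfold ngN
      rw [cn_prod', mul_sum, ← smul_eq_mul]
      refine (card_nsmul_le_sum B _ (956 * N + 1) (fun F hF => hc F hF)).trans ?_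
      exact sum_le_sum_of_subset (subset_univ _)
    have h2 : N ≤ 2 * B.card := by omega
    have h3 := h1.trans hng
    nlinarith
  set n0 := cn (fun E : Bk V => E ∈ B ∧ F0 ∈ B ∧ E ≠ F0 ∧ ¬ Good R m B LQ LP E F0) with hn0
  have hb := bv_count h hQ hP hB
  have hb0 := bv0_count h F0 n0 le_rfl hF0
  have hch : ∀ E : Bk V, ∃ a : Fin 3, Good R m B LQ LP E F0 →
      ∃ b, ∀ i j, (i = a ∨ j = b) → Gx R m LQ LP (E, i) (F0, j) := by
    intro E
    by_cases hG : Good R m B LQ LP E F0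
    · obtain ⟨_, _, _, a, b, hab⟩ := hG
      exact ⟨a, fun _ => ⟨b, hab⟩⟩
    · exact ⟨0, fun hh => absurd hh hG⟩
  choose w hw using hch
  set W := B.image (fun E => E.2 (w E)) with hW
  have hWc : W.card ≤ N := card_image_le.trans hB
  have hUc : 2 * N ≤ (P \ W).card := by
    have := le_card_sdiff W P
    omega
  have hE := hext (P \ W) sdiff_subset hUc
  set A := Q ∪ P with hA
  have cA : A.card ≤ 4 * N := (card_union_le _ _).trans (by omega)
  have t1 := tup_pair A (BV Q P R m B LQ LP) (fun x hx => ⟨hx.1, hx.2.1⟩)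
  have t2 := tup_single A (BV0 Q P R m B LQ LP F0) (fun x hx => hx.1)
  have cov := cn_cover (p := fun x : V × V × V × V => R x.1 x.2.1 x.2.2.1 x.2.2.2 ∧ x.2.1 ∈ P \ W ∧
      x.2.2.1 ∈ P \ W ∧ x.2.2.2 ∈ P \ W)
    (q := fun x : V × V × V × V => (x.1 ∈ A ∧ x.2.1 ∈ A ∧ x.2.2.1 ∈ A ∧ x.2.2.2 ∈ A) ∧
      (BV Q P R m B LQ LP (x.1, x.2.1) ∨ BV Q P R m B LQ LP (x.1, x.2.2.1) ∨
        BV Q P R m B LQ LP (x.1, x.2.2.2) ∨ BV Q P R m B LQ LP (x.2.1, x.2.2.1) ∨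
        BV Q P R m B LQ LP (x.2.1, x.2.2.2) ∨ BV Q P R m B LQ LP (x.2.2.1, x.2.2.2)))
    (r := fun x : V × V × V × V => (x.1 ∈ A ∧ x.2.1 ∈ A ∧ x.2.2.1 ∈ A ∧ x.2.2.2 ∈ A) ∧
      (BV0 Q P R m B LQ LP F0 x.1 ∨ BV0 Q P R m B LQ LP F0 x.2.1 ∨
        BV0 Q P R m B LQ LP F0 x.2.2.1 ∨ BV0 Q P R m B LQ LP F0 x.2.2.2)) (by
    rintro ⟨q, x, y, z⟩ ⟨hR, hx, hy, hz⟩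
    simp only [] at hR hx hy hz ⊢
    obtain ⟨mq, mx, my, mz⟩ := hs.mem _ _ _ _ hR
    have Aq : q ∈ A := mem_union_left _ mq
    have Ax : x ∈ A := mem_union_right _ mx
    have Ay : y ∈ A := mem_union_right _ my
    have Az : z ∈ A := mem_union_right _ mz
    by_contra hnot
    have hn1 := fun hh => hnot (Or.inl ⟨⟨Aq, Ax, Ay, Az⟩, hh⟩)
    have hn2 := fun hh => hnot (Or.inr ⟨⟨Aq, Ax, Ay, Az⟩, hh⟩)
    clear hnot
    have n1 : ¬ BV Q P R m B LQ LP (q, x) := fun hh => hn1 (Or.inl hh)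
    have n2 : ¬ BV Q P R m B LQ LP (q, y) := fun hh => hn1 (Or.inr (Or.inl hh))
    have n3 : ¬ BV Q P R m B LQ LP (q, z) := fun hh => hn1 (Or.inr (Or.inr (Or.inl hh)))
    have n4 : ¬ BV Q P R m B LQ LP (x, y) := fun hh => hn1 (Or.inr (Or.inr (Or.inr (Or.inl hh))))
    have n5 : ¬ BV Q P R m B LQ LP (x, z) :=
      fun hh => hn1 (Or.inr (Or.inr (Or.inr (Or.inr (Or.inl hh)))))
    have n6 : ¬ BV Q P R m B LQ LP (y, z) :=
      fun hh => hn1 (Or.inr (Or.inr (Or.inr (Or.inr (Or.inr hh)))))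
    have k1 : ¬ BV0 Q P R m B LQ LP F0 q := fun hh => hn2 (Or.inl hh)
    have k2 : ¬ BV0 Q P R m B LQ LP F0 x := fun hh => hn2 (Or.inr (Or.inl hh))
    have k3 : ¬ BV0 Q P R m B LQ LP F0 y := fun hh => hn2 (Or.inr (Or.inr (Or.inl hh)))
    have k4 : ¬ BV0 Q P R m B LQ LP F0 z := fun hh => hn2 (Or.inr (Or.inr (Or.inr hh)))
    have P1 : ∀ a b, a ∈ A → b ∈ A → ¬ BV Q P R m B LQ LP (a, b) →
        ∃ E F, a ∈ vs E ∧ b ∈ vs F ∧ Good R m B LQ LP E F := by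
      intro a b ha hb hn
      by_contra hc
      exact hn ⟨ha, hb, hc⟩
    have P0 : ∀ a, a ∈ A → ¬ BV0 Q P R m B LQ LP F0 a →
        ∃ E, a ∈ vs E ∧ Good R m B LQ LP E F0 := by
      intro a ha hn
      by_contra hc
      exact hn ⟨ha, hc⟩
    obtain ⟨F, fq, gF⟩ := P0 q Aq k1
    obtain ⟨E1, fx, g1⟩ := P0 x Ax k2
    obtain ⟨E2, fy, g2⟩ := P0 y Ay k3
    obtain ⟨E3, fz, g3⟩ := P0 z Az k4
    have P2 : ∀ a b E F, a ∈ A → b ∈ A → ¬ BV Q P R m B LQ LP (a, b) → a ∈ vs E → b ∈ vs F →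
        E ∈ B → F ∈ B → Good R m B LQ LP E F := by
      intro a b E F ha hb hn haE hbF hE hF
      obtain ⟨E', F', h1, h2, h3⟩ := P1 a b ha hb hn
      rw [h.uniq hE h3.1 haE h1, h.uniq hF h3.2.1 hbF h2]
      exact h3
    have gq1 := P2 q x F E1 Aq Ax n1 fq fx gF.1 g1.1
    have gq2 := P2 q y F E2 Aq Ay n2 fq fy gF.1 g2.1
    have gq3 := P2 q z F E3 Aq Az n3 fq fz gF.1 g3.1
    have g12 := P2 x y E1 E2 Ax Ay n4 fx fy g1.1 g2.1
    have g13 := P2 x z E1 E3 Ax Az n5 fx fz g1.1 g3.1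
    have g23 := P2 y z E2 E3 Ay Az n6 fy fz g2.1 g3.1
    have hqF : q = F.1 := by
      rcases mem_vs.1 fq with h1 | ⟨i, h1⟩
      · exact h1
      · exact absurd ((h.fam.1 F gF.1).2.1 i) (fun hh => Finset.disjoint_left.1 hs.disj mq (h1 ▸ hh))
    have idx : ∀ a E, E ∈ B → a ∈ P \ W → a ∈ vs E → ∃ k, k ≠ w E ∧ a = E.2 k := by
      intro a E hE ha haE
      obtain ⟨haP, haW⟩ := mem_sdiff.1 ha
      rcases mem_vs.1 haE with h1 | ⟨i, h1⟩
      · exact absurd (h.fam.1 E hE).1 (fun hh => Finset.disjoint_left.1 hs.disj hh (h1 ▸ haP))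
      · refine ⟨i, ?_, h1⟩
        rintro rfl
        exact haW (mem_image.2 ⟨E, hE, h1.symm⟩)
    obtain ⟨k1, hk1, rfl⟩ := idx x E1 g1.1 hx fx
    obtain ⟨k2, hk2, rfl⟩ := idx y E2 g2.1 hy fy
    obtain ⟨k3, hk3, rfl⟩ := idx z E3 g3.1 hz fz
    subst hqF
    exact final_gadget h w hw hk1 hk2 hk3 hR gF g1 g2 g3 gq1 gq2.2.2.1 (gq3.symm h) g12 g13.2.2.1 g23)
  set bv := cn (BV Q P R m B LQ LP) with hbv
  set bv0 := cn (BV0 Q P R m B LQ LP F0) with hbv0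
  have f1 : K * bv ≤ 7696 * N ^ 2 := by
    have : K * bv ≤ K * (32 * m * N + 16 * N + 16 * ngN R m B LQ LP) := Nat.mul_le_mul_left _ hb
    have e : K * (32 * m * N + 16 * N + 16 * ngN R m B LQ LP) = 32 * (K * m) * N + 16 * (K * N) +
      16 * (K * ngN R m B LQ LP) := by ring
    have e1 : (K * m) * N ≤ N * N := Nat.mul_le_mul_right _ hm
    have e2 : K * N ≤ N * N := Nat.mul_le_mul_right _ hKN
    nlinarith
  have f2 : K * bv0 ≤ 3832 * N := by
    have : K * bv0 ≤ K * (4 * m + 4 + 4 * n0) := Nat.mul_le_mul_left _ hb0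
    have e : K * (4 * m + 4 + 4 * n0) = 4 * (K * m) + 4 * K + 4 * (K * n0) := by ring
    omega
  have q2 : A.card ^ 2 ≤ (4 * N) ^ 2 := Nat.pow_le_pow_left cA 2
  have q3 : A.card ^ 3 ≤ (4 * N) ^ 3 := Nat.pow_le_pow_left cA 3
  have hfin : K * cn (fun x : V × V × V × V => R x.1 x.2.1 x.2.2.1 x.2.2.2 ∧ x.2.1 ∈ P \ W ∧
      x.2.2.1 ∈ P \ W ∧ x.2.2.2 ∈ P \ W) ≤ 1719808 * N ^ 4 := by
    calc _ ≤ K * (6 * (bv * A.card ^ 2) + 4 * (bv0 * A.card ^ 3)) :=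
          Nat.mul_le_mul_left _ (cov.trans (Nat.add_le_add t1 t2))
      _ = 6 * ((K * bv) * A.card ^ 2) + 4 * ((K * bv0) * A.card ^ 3) := by ring
      _ ≤ 6 * ((7696 * N ^ 2) * (4 * N) ^ 2) + 4 * ((3832 * N) * (4 * N) ^ 3) := by gcongr
      _ = _ := by ring
  have hN4 : 0 < N ^ 4 := by
    have : 0 < N := by omega
    positivity
  rw [hKD, mul_assoc] at hfin
  have := Nat.mul_le_mul_left (2 ^ 21) hE
  omega

end
end PM13


namespace PM13
open Finset
set_option linter.unusedSectionVars false
set_option linter.unusedVariables false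

section ext
variable {V : Type} [Fintype V] [DecidableEq V] {Q P W U W' U' B : Finset V}
  {R : V → V → V → V → Prop} {N : ℕ}

lemma cn_true3 : cn (fun x : V × V => True) ≤ Fintype.card V ^ 2 := by
  refine (cn_le_card _).trans ?_
  rw [Fintype.card_prod, sq]

lemma touch1 (X : Finset V) {β : Type} [Fintype β] :
    cn (fun x : V × β => x.1 ∈ X) = X.card * Fintype.card β := by
  have := cn_and_prod (fun a : V => a ∈ X) (fun b : β => True)
  rw [cn_mem] at this
  have h2 : cn (fun b : β => True) = Fintype.card β := by
    have := cn_not (fun b : β => True)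
    have h0 : cn (fun b : β => ¬ True) = 0 := by
      by_contra h
      obtain ⟨a, ha⟩ := cn_pos (Nat.pos_of_ne_zero h)
      exact ha trivial
    omega
  rw [h2] at this
  rw [← this]
  exact cn_congr (fun a => by simp)

lemma touch2 (X : Finset V) {α β : Type} [Fintype α] [Fintype β] (f : α → V × β)
    (hf : Function.Injective f) :
    cn (fun x : α => (f x).1 ∈ X) ≤ X.card * Fintype.card β := by
  rw [← touch1 (β := β) X]
  exact cn_inj f (fun _ h => h) (fun _ _ _ _ h => hf h)

lemma avoid3 (X : Finset V) (p : V × V × V → Prop)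
    (h : 3 * X.card * Fintype.card V ^ 2 < cn p) :
    ∃ x y z, p (x, y, z) ∧ x ∉ X ∧ y ∉ X ∧ z ∉ X := by
  have h1 := touch2 X (fun x : V × V × V => (x.1, (x.2.1, x.2.2))) (by
    rintro ⟨a, b, c⟩ ⟨a', b', c'⟩ h; simp at h ⊢; tauto)
  have h2 := touch2 X (fun x : V × V × V => (x.2.1, (x.1, x.2.2))) (by
    rintro ⟨a, b, c⟩ ⟨a', b', c'⟩ h; simp at h ⊢; tauto)
  have h3 := touch2 X (fun x : V × V × V => (x.2.2, (x.1, x.2.1))) (by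
    rintro ⟨a, b, c⟩ ⟨a', b', c'⟩ h; simp at h ⊢; tauto)
  have h23 := cn_or (fun x : V × V × V => x.2.1 ∈ X) (fun x : V × V × V => x.2.2 ∈ X)
  have h123 := cn_or (fun x : V × V × V => x.1 ∈ X) (fun x : V × V × V => x.2.1 ∈ X ∨ x.2.2 ∈ X)
  simp only [Fintype.card_prod] at h1 h2 h3
  obtain ⟨⟨x, y, z⟩, hp, hn⟩ := cn_exists (p := p)
    (q := fun x : V × V × V => x.1 ∈ X ∨ x.2.1 ∈ X ∨ x.2.2 ∈ X) (by nlinarith)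
  simp only [not_or] at hn
  exact ⟨x, y, z, hp, hn.1, hn.2.1, hn.2.2⟩

lemma avoid4 (X : Finset V) (p : V × V × V × V → Prop)
    (h : 4 * X.card * Fintype.card V ^ 3 < cn p) :
    ∃ x y z t, p (x, y, z, t) ∧ x ∉ X ∧ y ∉ X ∧ z ∉ X ∧ t ∉ X := by
  have h1 := touch2 X (fun x : V × V × V × V => (x.1, (x.2.1, x.2.2.1, x.2.2.2))) (by
    rintro ⟨a, b, c, d⟩ ⟨a', b', c', d'⟩ h; simp at h ⊢; tauto)
  have h2 := touch2 X (fun x : V × V × V × V => (x.2.1, (x.1, x.2.2.1, x.2.2.2))) (by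
    rintro ⟨a, b, c, d⟩ ⟨a', b', c', d'⟩ h; simp at h ⊢; tauto)
  have h3 := touch2 X (fun x : V × V × V × V => (x.2.2.1, (x.1, x.2.1, x.2.2.2))) (by
    rintro ⟨a, b, c, d⟩ ⟨a', b', c', d'⟩ h; simp at h ⊢; tauto)
  have h4 := touch2 X (fun x : V × V × V × V => (x.2.2.2, (x.1, x.2.1, x.2.2.1))) (by
    rintro ⟨a, b, c, d⟩ ⟨a', b', c', d'⟩ h; simp at h ⊢; tauto)
  have h34 := cn_or (fun x : V × V × V × V => x.2.2.1 ∈ X) (fun x : V × V × V × V => x.2.2.2 ∈ X)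
  have h234 := cn_or (fun x : V × V × V × V => x.2.1 ∈ X)
    (fun x : V × V × V × V => x.2.2.1 ∈ X ∨ x.2.2.2 ∈ X)
  have h1234 := cn_or (fun x : V × V × V × V => x.1 ∈ X)
    (fun x : V × V × V × V => x.2.1 ∈ X ∨ x.2.2.1 ∈ X ∨ x.2.2.2 ∈ X)
  simp only [Fintype.card_prod] at h1 h2 h3 h4
  obtain ⟨⟨x, y, z, t⟩, hp, hn⟩ := cn_exists (p := p)
    (q := fun x : V × V × V × V => x.1 ∈ X ∨ x.2.1 ∈ X ∨ x.2.2.1 ∈ X ∨ x.2.2.2 ∈ X) (by nlinarith)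
  simp only [not_or] at hn
  exact ⟨x, y, z, t, hp, hn.1, hn.2.1, hn.2.2.1, hn.2.2.2⟩

lemma inter_cards_WUU {q w u u' : V} (hQW : Disjoint Q W') (hQU : Disjoint Q U')
    (hWU : Disjoint W' U') (hq : q ∈ Q) (hw : w ∈ W') (hu : u ∈ U') (hu' : u' ∈ U') (hn : u ≠ u') :
    (({q, w, u, u'} : Finset V) ∩ Q).card = 1 ∧ (({q, w, u, u'} : Finset V) ∩ W').card = 1 ∧
    (({q, w, u, u'} : Finset V) ∩ U').card = 2 := by
  rw [Finset.disjoint_left] at hQW hQU hWU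
  refine ⟨?_, ?_, ?_⟩
  · have : ({q, w, u, u'} : Finset V) ∩ Q = {q} := by
      ext v; simp only [mem_inter, mem_insert, mem_singleton]; grind
    rw [this, card_singleton]
  · have : ({q, w, u, u'} : Finset V) ∩ W' = {w} := by
      ext v; simp only [mem_inter, mem_insert, mem_singleton]; grind
    rw [this, card_singleton]
  · have : ({q, w, u, u'} : Finset V) ∩ U' = {u, u'} := by
      ext v; simp only [mem_inter, mem_insert, mem_singleton]; grind
    rw [this, card_pair hn]

lemma inter_cards_UUU {q w u u' : V} (hQW : Disjoint Q W') (hQU : Disjoint Q U')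
    (hWU : Disjoint W' U') (hq : q ∈ Q) (hw : w ∈ U') (hu : u ∈ U') (hu' : u' ∈ U') (hn : u ≠ u')
    (hn1 : w ≠ u) (hn2 : w ≠ u') :
    (({q, w, u, u'} : Finset V) ∩ Q).card = 1 ∧ (({q, w, u, u'} : Finset V) ∩ W').card = 0 ∧
    (({q, w, u, u'} : Finset V) ∩ U').card = 3 := by
  rw [Finset.disjoint_left] at hQW hQU hWU
  refine ⟨?_, ?_, ?_⟩
  · have : ({q, w, u, u'} : Finset V) ∩ Q = {q} := by
      ext v; simp only [mem_inter, mem_insert, mem_singleton]; grind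
    rw [this, card_singleton]
  · have : ({q, w, u, u'} : Finset V) ∩ W' = ∅ := by
      ext v; simp only [mem_inter, mem_insert, mem_singleton]; grind
    rw [this, card_empty]
  · have : ({q, w, u, u'} : Finset V) ∩ U' = {w, u, u'} := by
      ext v; simp only [mem_inter, mem_insert, mem_singleton]; grind
    rw [this, card_eq_three]
    exact ⟨w, u, u', hn1, hn2, hn, rfl⟩

/-- the final good part -/
lemma good_part (hs : Sys Q P R) (hQP : Q ∪ P = univ) (hWU' : Disjoint W' U') (hP' : W' ∪ U' = P)
    (T : Finset V) (t m : ℕ)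
    (tQ : (T ∩ Q).card = t) (tW : (T ∩ W').card = t) (tU : (T ∩ U').card = 2 * t)
    (gq : ∀ q ∈ T, q ∈ Q → cn (fun x : V × V × V => x.1 ∈ T ∩ W' ∧ x.2.1 ∈ T ∩ U' ∧ x.2.2 ∈ T ∩ U' ∧
      ¬ R q x.1 x.2.1 x.2.2) ≤ m)
    (gw : ∀ w ∈ T, w ∈ W' → cn (fun x : V × V × V => x.1 ∈ T ∩ Q ∧ x.2.1 ∈ T ∩ U' ∧ x.2.2 ∈ T ∩ U' ∧
      ¬ R x.1 w x.2.1 x.2.2) ≤ m)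
    (gu : ∀ u ∈ T, u ∈ U' → cn (fun x : V × V × V => x.1 ∈ T ∩ Q ∧ x.2.1 ∈ T ∩ W' ∧ x.2.2 ∈ T ∩ U' ∧
      ¬ R x.1 x.2.1 u x.2.2) ≤ m)
    (hm : 4 * m + 6 * t ^ 2 < t ^ 3) : ∃ k, Til R k T := by
  obtain ⟨U1, hU1, cU1⟩ := exists_subset_card_eq (s := T ∩ U') (n := t) (by omega)
  have cU2 : ((T ∩ U') \ U1).card = t := by rw [card_sdiff_of_subset hU1]; omega
  obtain ⟨f1⟩ : Nonempty (Fin t ≃ {x // x ∈ T ∩ Q}) := ⟨(Finset.equivFinOfCardEq tQ).symm⟩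
  obtain ⟨f2⟩ : Nonempty (Fin t ≃ {x // x ∈ T ∩ W'}) := ⟨(Finset.equivFinOfCardEq tW).symm⟩
  obtain ⟨f3⟩ : Nonempty (Fin t ≃ {x // x ∈ U1}) := ⟨(Finset.equivFinOfCardEq cU1).symm⟩
  obtain ⟨f4⟩ : Nonempty (Fin t ≃ {x // x ∈ (T ∩ U') \ U1}) := ⟨(Finset.equivFinOfCardEq cU2).symm⟩
  have m1 : ∀ i, (f1 i : V) ∈ T ∩ Q := fun i => (f1 i).2
  have m2 : ∀ i, (f2 i : V) ∈ T ∩ W' := fun i => (f2 i).2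
  have m3' : ∀ i, (f3 i : V) ∈ U1 := fun i => (f3 i).2
  have m3 : ∀ i, (f3 i : V) ∈ T ∩ U' := fun i => hU1 (f3 i).2
  have m4' : ∀ i, (f4 i : V) ∉ U1 := fun i => (mem_sdiff.1 (f4 i).2).2
  have m4 : ∀ i, (f4 i : V) ∈ T ∩ U' := fun i => (mem_sdiff.1 (f4 i).2).1
  have i1 : ∀ i j, (f1 i : V) = f1 j → i = j := fun i j h => f1.injective (Subtype.ext h)
  have i2 : ∀ i j, (f2 i : V) = f2 j → i = j := fun i j h => f2.injective (Subtype.ext h)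
  have i3 : ∀ i j, (f3 i : V) = f3 j → i = j := fun i j h => f3.injective (Subtype.ext h)
  have i4 : ∀ i j, (f4 i : V) = f4 j → i = j := fun i j h => f4.injective (Subtype.ext h)
  obtain ⟨s2, s3, s4, hR⟩ := latin t (fun a b c d => R (f1 a) (f2 b) (f3 c) (f4 d)) m
    (fun a => (cn_inj (fun p => ((f2 p.1 : V), (f3 p.2.1 : V), (f4 p.2.2 : V)))
      (fun p hp => ⟨m2 _, m3 _, m4 _, hp⟩) (by
        rintro ⟨a, b, c⟩ ⟨a', b', c'⟩ _ _ h
        simp only [Prod.mk.injEq] at h ⊢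
        exact ⟨i2 _ _ h.1, i3 _ _ h.2.1, i4 _ _ h.2.2⟩)).trans
      (gq (f1 a) (mem_inter.1 (m1 a)).1 (mem_inter.1 (m1 a)).2))
    (fun a => (cn_inj (fun p => ((f1 p.2.2 : V), (f3 p.1 : V), (f4 p.2.1 : V)))
      (fun p hp => ⟨m1 _, m3 _, m4 _, hp⟩) (by
        rintro ⟨a, b, c⟩ ⟨a', b', c'⟩ _ _ h
        simp only [Prod.mk.injEq] at h ⊢
        exact ⟨i3 _ _ h.2.1, i4 _ _ h.2.2, i1 _ _ h.1⟩)).trans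
      (gw (f2 a) (mem_inter.1 (m2 a)).1 (mem_inter.1 (m2 a)).2))
    (fun a => (cn_inj (fun p => ((f1 p.2.1 : V), (f2 p.2.2 : V), (f4 p.1 : V)))
      (fun p hp => ⟨m1 _, m2 _, m4 _, hp⟩) (by
        rintro ⟨a, b, c⟩ ⟨a', b', c'⟩ _ _ h
        simp only [Prod.mk.injEq] at h ⊢
        exact ⟨i4 _ _ h.2.2, i1 _ _ h.1, i2 _ _ h.2.1⟩)).trans
      (gu (f3 a) (mem_inter.1 (m3 a)).1 (mem_inter.1 (m3 a)).2))
    (fun a => (cn_inj (fun p => ((f1 p.1 : V), (f2 p.2.1 : V), (f3 p.2.2 : V)))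
      (fun p hp => ⟨m1 _, m2 _, m3 _, fun h => hp (hs.sw2 _ _ _ _ h)⟩) (by
        rintro ⟨a, b, c⟩ ⟨a', b', c'⟩ _ _ h
        simp only [Prod.mk.injEq] at h ⊢
        exact ⟨i1 _ _ h.1, i2 _ _ h.2.1, i3 _ _ h.2.2⟩)).trans
      (gu (f4 a) (mem_inter.1 (m4 a)).1 (mem_inter.1 (m4 a)).2)) hm
  have hQPd := Finset.disjoint_left.1 hs.disj
  have hWUd := Finset.disjoint_left.1 hWU'
  have hW'P : ∀ x, x ∈ W' → x ∈ P := fun x hx => hP' ▸ mem_union_left _ hx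
  have hU'P : ∀ x, x ∈ U' → x ∈ P := fun x hx => hP' ▸ mem_union_right _ hx
  simp only [mem_inter] at m1 m2 m3 m4
  have key : ∀ A : Finset (Fin t), ∃ k, Til R k (A.biUnion (fun i =>
      ({(f1 i : V), (f2 (s2 i) : V), (f3 (s3 i) : V), (f4 (s4 i) : V)} : Finset V))) := by
    intro A
    induction A using Finset.induction_on with
    | empty => exact ⟨0, by simpa using Til.nil⟩
    | insert i A hi ih =>
      obtain ⟨k, hk⟩ := ih
      refine ⟨1 + k, ?_⟩
      rw [biUnion_insert]
      refine (Til.single (hR i)).union hk ?_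
      rw [disjoint_biUnion_right]
      intro j hj
      have hij : i ≠ j := fun h => hi (h ▸ hj)
      have e1 : (f1 i : V) ≠ f1 j := fun h => hij (i1 _ _ h)
      have e2 : (f2 (s2 i) : V) ≠ f2 (s2 j) := fun h => hij (s2.injective (i2 _ _ h))
      have e3 : (f3 (s3 i) : V) ≠ f3 (s3 j) := fun h => hij (s3.injective (i3 _ _ h))
      have e4 : (f4 (s4 i) : V) ≠ f4 (s4 j) := fun h => hij (s4.injective (i4 _ _ h))
      have a1 := fun i => (m1 i).2
      have a2 := fun i => (m2 i).2
      have a3 := fun i => (m3 i).2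
      have a4 := fun i => (m4 i).2
      have n12 : ∀ i j, (f1 i : V) ≠ f2 j := fun i j h => hQPd (a1 i) (h ▸ hW'P _ (a2 j))
      have n13 : ∀ i j, (f1 i : V) ≠ f3 j := fun i j h => hQPd (a1 i) (h ▸ hU'P _ (a3 j))
      have n14 : ∀ i j, (f1 i : V) ≠ f4 j := fun i j h => hQPd (a1 i) (h ▸ hU'P _ (a4 j))
      have n23 : ∀ i j, (f2 i : V) ≠ f3 j := fun i j h => hWUd (a2 i) (h ▸ (a3 j))
      have n24 : ∀ i j, (f2 i : V) ≠ f4 j := fun i j h => hWUd (a2 i) (h ▸ (a4 j))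
      have n34 : ∀ i j, (f3 i : V) ≠ f4 j := fun i j h => m4' j (h ▸ (m3' i))
      simp only [disjoint_insert_left, disjoint_singleton_left, mem_insert, mem_singleton, not_or]
      exact ⟨⟨e1, n12 _ _, n13 _ _, n14 _ _⟩, ⟨(n12 _ _).symm, e2, n23 _ _, n24 _ _⟩,
        ⟨(n13 _ _).symm, (n23 _ _).symm, e3, n34 _ _⟩,
        ⟨(n14 _ _).symm, (n24 _ _).symm, (n34 _ _).symm, e4⟩⟩
  obtain ⟨k, hk⟩ := key univ
  refine ⟨k, ?_⟩
  convert hk using 1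
  ext v
  simp only [mem_biUnion, mem_univ, true_and, mem_insert, mem_singleton]
  constructor
  · intro hv
    have : v ∈ Q ∪ P := hQP ▸ mem_univ v
    rcases mem_union.1 this with h | h
    · refine ⟨f1.symm ⟨v, mem_inter.2 ⟨hv, h⟩⟩, Or.inl ?_⟩
      simp
    · rw [← hP'] at h
      rcases mem_union.1 h with h | h
      · refine ⟨s2.symm (f2.symm ⟨v, mem_inter.2 ⟨hv, h⟩⟩), Or.inr (Or.inl ?_)⟩
        simp
      · by_cases hu : v ∈ U1
        · refine ⟨s3.symm (f3.symm ⟨v, hu⟩), Or.inr (Or.inr (Or.inl ?_))⟩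
          simp
        · refine ⟨s4.symm (f4.symm ⟨v, mem_sdiff.2 ⟨mem_inter.2 ⟨hv, h⟩, hu⟩⟩),
            Or.inr (Or.inr (Or.inr ?_))⟩
          simp
  · rintro ⟨i, h | h | h | h⟩ <;> subst h
    exacts [(m1 _).1, (m2 _).1, (m3 _).1, (m4 _).1]

end ext
end PM13


namespace PM13
open Finset
set_option linter.unusedSectionVars false
set_option linter.unusedVariables false

section ext
variable {V : Type} [Fintype V] [DecidableEq V] {Q P W U W' U' B : Finset V}
  {R : V → V → V → V → Prop} {N : ℕ}

/-- data of an almost extremal configuration -/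
structure Xt (Q P W U W' U' B : Finset V) (R : V → V → V → V → Prop) (N : ℕ) : Prop where
  hs : Sys Q P R
  hQP : Q ∪ P = univ
  cV : Fintype.card V = 4 * N
  hWU : Disjoint W U
  hP : W ∪ U = P
  hWU' : Disjoint W' U'
  hP' : W' ∪ U' = P
  hBW : ∀ v, v ∉ B → v ∈ W → v ∈ W'
  hBU : ∀ v, v ∉ B → v ∈ U → v ∈ U'
  gq : ∀ q, q ∉ B → q ∈ Q → 100 * cn (fun x : V × V × V => x.1 ∈ W ∧ x.2.1 ∈ U ∧ x.2.2 ∈ U ∧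
      ¬ R q x.1 x.2.1 x.2.2) ≤ N ^ 3
  gw : ∀ w, w ∉ B → w ∈ W → 100 * cn (fun x : V × V × V => x.1 ∈ Q ∧ x.2.1 ∈ U ∧ x.2.2 ∈ U ∧
      ¬ R x.1 w x.2.1 x.2.2) ≤ N ^ 3
  gu : ∀ u, u ∉ B → u ∈ U → 100 * cn (fun x : V × V × V => x.1 ∈ Q ∧ x.2.1 ∈ W ∧ x.2.2 ∈ U ∧
      ¬ R x.1 x.2.1 u x.2.2) ≤ N ^ 3
  bq : ∀ q ∈ Q, N ^ 3 ≤ 4 * cn (fun x : V × V × V => x.1 ∈ W ∧ x.2.1 ∈ U ∧ x.2.2 ∈ U ∧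
      R q x.1 x.2.1 x.2.2) ∨ N ^ 3 ≤ 4 * cn (fun x : V × V × V => x.1 ∈ U ∧ x.2.1 ∈ U ∧ x.2.2 ∈ U ∧
      R q x.1 x.2.1 x.2.2)
  bw : ∀ w ∈ W', N ^ 3 ≤ 4 * cn (fun x : V × V × V => x.1 ∈ Q ∧ x.2.1 ∈ U ∧ x.2.2 ∈ U ∧
      R x.1 w x.2.1 x.2.2)
  bu : ∀ u ∈ U', N ^ 3 ≤ 4 * cn (fun x : V × V × V => x.1 ∈ Q ∧ x.2.1 ∈ W ∧ x.2.2 ∈ U ∧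
      R x.1 u x.2.1 x.2.2)
  ww : N ^ 4 ≤ cn (fun x : V × V × V × V => x.1 ∈ Q ∧ x.2.1 ∈ W ∧ x.2.2.1 ∈ W ∧ x.2.2.2 ∈ U ∧
      R x.1 x.2.1 x.2.2.1 x.2.2.2)

lemma Xt.finish (X : Xt Q P W U W' U' B R N) (L : ℕ) (hL : 1000 * L ≤ N) (hN : 1000 ≤ N) (r : ℕ) :
    ∀ (T : Finset V) (t : ℕ), (T ∩ Q).card = t → (T ∩ W').card = t → (T ∩ U').card = 2 * t →
      (B ∩ T).card = r → Tᶜ.card + 8 * r ≤ L → ∃ k, Til R k T := by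
  induction r using Nat.strong_induction_on with
  | _ r ih =>
  intro T t tQ tW tU hr hTL
  have dQP := Finset.disjoint_left.1 X.hs.disj
  have W'P : W' ⊆ P := X.hP' ▸ subset_union_left
  have U'P : U' ⊆ P := X.hP' ▸ subset_union_right
  have WP : W ⊆ P := X.hP ▸ subset_union_left
  have UP : U ⊆ P := X.hP ▸ subset_union_right
  have dQW : Disjoint Q W' := disjoint_of_subset_right W'P X.hs.disj
  have dQU : Disjoint Q U' := disjoint_of_subset_right U'P X.hs.disj
  have dW'U' := Finset.disjoint_left.1 X.hWU'
  have dWU := Finset.disjoint_left.1 X.hWU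
  have hBW' : ∀ v, v ∉ B → v ∈ W' → v ∈ W := by
    intro v hv hw
    have := W'P hw
    rw [← X.hP] at this
    rcases mem_union.1 this with h | h
    · exact h
    · exact absurd (X.hBU v hv h) (dW'U' hw)
  have hBU' : ∀ v, v ∉ B → v ∈ U' → v ∈ U := by
    intro v hv hw
    have := U'P hw
    rw [← X.hP] at this
    rcases mem_union.1 this with h | h
    · exact absurd hw (dW'U' (X.hBW v hv h))
    · exact h
  have hT4 : T.card = 4 * t := by
    have h1 : T = (T ∩ Q) ∪ ((T ∩ W') ∪ (T ∩ U')) := by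
      rw [← inter_union_distrib_left, ← inter_union_distrib_left, X.hP', X.hQP, inter_univ]
    rw [h1, card_union_of_disjoint, card_union_of_disjoint, tQ, tW, tU]
    · ring
    · exact disjoint_of_subset_left inter_subset_right
        (disjoint_of_subset_right inter_subset_right X.hWU')
    · refine disjoint_of_subset_left inter_subset_right ?_
      rw [disjoint_union_right]
      exact ⟨disjoint_of_subset_right inter_subset_right dQW,
        disjoint_of_subset_right inter_subset_right dQU⟩
  have hTc : Tᶜ.card + 4 * t = 4 * N := by
    have := card_compl_add_card T
    rw [X.cV, hT4] at this; exact this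
  rcases Nat.eq_zero_or_pos r with h0 | hrpos
  · -- base case
    have hTB : ∀ v ∈ T, v ∉ B := by
      intro v hv hb
      have : v ∈ B ∩ T := mem_inter.2 ⟨hb, hv⟩
      rw [card_eq_zero.1 (hr.trans h0)] at this
      simp at this
    have ht : N ≤ 2 * t := by omega
    have ht' : t ≤ N := by omega
    have hWi : ∀ x, x ∈ T ∩ W' → x ∈ W := fun x hx =>
      hBW' x (hTB x (mem_inter.1 hx).1) (mem_inter.1 hx).2
    have hUi : ∀ x, x ∈ T ∩ U' → x ∈ U := fun x hx =>
      hBU' x (hTB x (mem_inter.1 hx).1) (mem_inter.1 hx).2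
    have hQi : ∀ x, x ∈ T ∩ Q → x ∈ Q := fun x hx => (mem_inter.1 hx).2
    refine good_part X.hs X.hQP X.hWU' X.hP' T t (N ^ 3 / 100) tQ tW tU ?_ ?_ ?_ ?_
    · intro q hq hqQ
      rw [Nat.le_div_iff_mul_le (by norm_num), mul_comm]
      refine le_trans (Nat.mul_le_mul_left _ (cn_mono ?_)) (X.gq q (hTB q hq) hqQ)
      rintro x ⟨h1, h2, h3, h4⟩
      exact ⟨hWi _ h1, hUi _ h2, hUi _ h3, h4⟩
    · intro q hq hqQ
      rw [Nat.le_div_iff_mul_le (by norm_num), mul_comm]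
      refine le_trans (Nat.mul_le_mul_left _ (cn_mono ?_))
        (X.gw q (hTB q hq) (hWi q (mem_inter.2 ⟨hq, hqQ⟩)))
      rintro x ⟨h1, h2, h3, h4⟩
      exact ⟨hQi _ h1, hUi _ h2, hUi _ h3, h4⟩
    · intro q hq hqQ
      rw [Nat.le_div_iff_mul_le (by norm_num), mul_comm]
      refine le_trans (Nat.mul_le_mul_left _ (cn_mono ?_))
        (X.gu q (hTB q hq) (hUi q (mem_inter.2 ⟨hq, hqQ⟩)))
      rintro x ⟨h1, h2, h3, h4⟩
      exact ⟨hQi _ h1, hWi _ h2, hUi _ h3, h4⟩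
    · have h1 : 100 * (N ^ 3 / 100) ≤ N ^ 3 := Nat.mul_div_le _ _
      have h2 : N ^ 3 ≤ (2 * t) ^ 3 := Nat.pow_le_pow_left ht 3
      have h3 : (2 * t) ^ 3 = 8 * t ^ 3 := by ring
      have h4 : t ^ 3 = t * t ^ 2 := by ring
      have h5 : 500 * t ^ 2 ≤ t * t ^ 2 := Nat.mul_le_mul_right _ (by omega)
      have h6 : 0 < t ^ 2 := by
        have : 0 < t := by omega
        positivity
      omega
  -- induction step
  have step : ∀ e : Finset V, ∀ j, j ≤ 2 → Til R j e → e ⊆ T → (e ∩ Q).card = j →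
      (e ∩ W').card = j → (e ∩ U').card = 2 * j → (∃ b ∈ e, b ∈ B) → e.card ≤ 8 → ∃ k, Til R k T := by
    intro e j hj hTil heT eQ eW eU ⟨b, hbe, hbB⟩ he8
    have s1 := card_sdiff_inter Q heT
    have s2 := card_sdiff_inter W' heT
    have s3 := card_sdiff_inter U' heT
    have s4 := card_sdiff_inter B heT
    have hb1 : 1 ≤ (e ∩ B).card := card_pos.2 ⟨b, mem_inter.2 ⟨hbe, hbB⟩⟩
    have hcc : (T \ e)ᶜ.card ≤ Tᶜ.card + 8 := by
      have : (T \ e)ᶜ ⊆ Tᶜ ∪ e := by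
        intro v; simp only [mem_compl, mem_sdiff, mem_union]; tauto
      exact (card_le_card this).trans ((card_union_le _ _).trans (by omega))
    rw [inter_comm T B, hr] at s4
    obtain ⟨k, hk⟩ := ih ((T \ e) ∩ B).card (by omega) (T \ e) (t - j) (by omega) (by omega) (by omega)
      (by rw [inter_comm]) (by omega)
    refine ⟨j + k, ?_⟩
    have := hTil.union hk disjoint_sdiff
    rwa [union_sdiff_of_subset heT] at this
  obtain ⟨b, hb⟩ : (B ∩ T).Nonempty := card_pos.1 (by omega)
  obtain ⟨hbB, hbT⟩ := mem_inter.1 hb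
  -- the forbidden set
  have hF : (Tᶜ ∪ B).card ≤ L := by
    have h1 : Tᶜ ∪ B = Tᶜ ∪ (B ∩ T) := by
      ext v; simp only [mem_compl, mem_inter, mem_union]; tauto
    rw [h1]
    exact (card_union_le _ _).trans (by omega)
  have hF4 : Tᶜ.card + r + 4 ≤ L := by omega
  have hFn : ∀ v, v ∉ Tᶜ ∪ B → v ∈ T ∧ v ∉ B := by
    intro v; simp only [mem_compl, mem_union]; tauto
  have n3 : ∀ p : V × V × V → Prop, N ^ 3 ≤ 4 * cn p →
      ∃ x y z, p (x, y, z) ∧ x ∉ Tᶜ ∪ B ∧ y ∉ Tᶜ ∪ B ∧ z ∉ Tᶜ ∪ B := by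
    intro p hp
    refine avoid3 _ p ?_
    rw [X.cV]
    have h1 : 3 * (Tᶜ ∪ B).card * (4 * N) ^ 2 ≤ 3 * L * (4 * N) ^ 2 := by gcongr
    have h2 : 1000 * L * N ^ 2 ≤ N * N ^ 2 := by gcongr
    have h3 : 0 < N ^ 3 := by positivity
    nlinarith
  have c4 : ∀ a b c d : V, ({a, b, c, d} : Finset V).card ≤ 4 := fun a b c d => card_le_four
  have hbV : b ∈ Q ∪ P := X.hQP ▸ mem_univ b
  rcases mem_union.1 hbV with hbQ | hbP
  · rcases X.bq b hbQ with h | h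
    · obtain ⟨w, u, u', ⟨hw, hu, hu', hR⟩, fw, fu, fu'⟩ := n3 _ h
      obtain ⟨aw, nw⟩ := hFn _ fw
      obtain ⟨au, nu⟩ := hFn _ fu
      obtain ⟨au', nu'⟩ := hFn _ fu'
      obtain ⟨g1, g2, g3⟩ := inter_cards_WUU dQW dQU X.hWU' hbQ (X.hBW _ nw hw) (X.hBU _ nu hu)
        (X.hBU _ nu' hu') (X.hs.ne _ _ _ _ hR).2.2
      refine step _ 1 (by norm_num) (Til.single hR) ?_ g1 g2 g3 ⟨b, by simp, hbB⟩
        ((c4 _ _ _ _).trans (by norm_num))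
      intro v; simp only [mem_insert, mem_singleton]; rintro (h | h | h | h) <;> subst h <;> assumption
    · obtain ⟨w, u, u', ⟨hw, hu, hu', hR⟩, fw, fu, fu'⟩ := n3 _ h
      obtain ⟨aw, nw⟩ := hFn _ fw
      obtain ⟨au, nu⟩ := hFn _ fu
      obtain ⟨au', nu'⟩ := hFn _ fu'
      obtain ⟨e1, e2, e3⟩ := X.hs.ne _ _ _ _ hR
      obtain ⟨g1, g2, g3⟩ := inter_cards_UUU dQW dQU X.hWU' hbQ (X.hBU _ nw hw) (X.hBU _ nu hu)
        (X.hBU _ nu' hu') e3 e1 e2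
      have hE : ({b, w, u, u'} : Finset V) ⊆ T := by
        intro v; simp only [mem_insert, mem_singleton]; rintro (h | h | h | h) <;> subst h <;> assumption
      obtain ⟨q', w1, w2, u1, ⟨hq', hw1, hw2, hu1, hR'⟩, fq', fw1, fw2, fu1⟩ :=
        avoid4 ((Tᶜ ∪ B) ∪ {b, w, u, u'}) _ (lt_of_lt_of_le (by
          have h1 : ((Tᶜ ∪ B) ∪ {b, w, u, u'}).card ≤ L := by
            have h1 : Tᶜ ∪ B = Tᶜ ∪ (B ∩ T) := by
              ext v; simp only [mem_compl, mem_inter, mem_union]; tauto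
            have h2 : (Tᶜ ∪ B).card ≤ Tᶜ.card + r := by
              rw [h1, ← hr]; exact card_union_le _ _
            exact (card_union_le _ _).trans (by have := c4 b w u u'; omega)
          rw [X.cV]
          have h2 : 4 * ((Tᶜ ∪ B) ∪ {b, w, u, u'}).card * (4 * N) ^ 3 ≤ 4 * L * (4 * N) ^ 3 := by gcongr
          have h3 : 1000 * L * N ^ 3 ≤ N * N ^ 3 := by gcongr
          have h4 : 0 < N ^ 4 := by positivity
          nlinarith) X.ww)
      rw [mem_union (s := Tᶜ ∪ B), not_or] at fq' fw1 fw2 fu1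
      obtain ⟨aq', nq'⟩ := hFn _ fq'.1
      obtain ⟨aw1, nw1⟩ := hFn _ fw1.1
      obtain ⟨aw2, nw2⟩ := hFn _ fw2.1
      obtain ⟨au1, nu1⟩ := hFn _ fu1.1
      obtain ⟨e1', e2', e3'⟩ := X.hs.ne _ _ _ _ hR'
      obtain ⟨k1, k2, k3⟩ := inter_cards_WUU dQU dQW X.hWU'.symm hq' (X.hBU _ nu1 hu1)
        (X.hBW _ nw1 hw1) (X.hBW _ nw2 hw2) e1'
      have hR2 : R q' u1 w1 w2 := X.hs.rot' hR'
      have hE' : ({q', u1, w1, w2} : Finset V) ⊆ T := by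
        intro v; simp only [mem_insert, mem_singleton]; rintro (h | h | h | h) <;> subst h <;> assumption
      have hdis : Disjoint ({b, w, u, u'} : Finset V) {q', u1, w1, w2} := by
        rw [Finset.disjoint_right]
        intro v hv
        simp only [mem_insert, mem_singleton] at hv
        rcases hv with h | h | h | h <;> rw [h]
        exacts [fq'.2, fu1.2, fw1.2, fw2.2]
      have uc : ∀ Y : Finset V, ((({b, w, u, u'} : Finset V) ∪ {q', u1, w1, w2}) ∩ Y).card =
          (({b, w, u, u'} : Finset V) ∩ Y).card + (({q', u1, w1, w2} : Finset V) ∩ Y).card := by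
        intro Y
        rw [union_inter_distrib_right, card_union_of_disjoint]
        exact disjoint_of_subset_left inter_subset_left
          (disjoint_of_subset_right inter_subset_left hdis)
      refine step _ 2 le_rfl ((Til.single hR).union (Til.single hR2) hdis) (union_subset hE hE')
        ?_ ?_ ?_ ⟨b, by simp, hbB⟩ ?_
      · rw [uc, g1, k1]
      · rw [uc, g2, k3]
      · rw [uc, g3, k2]
      · exact (card_union_le _ _).trans (Nat.add_le_add (c4 _ _ _ _) (c4 _ _ _ _))
  · rw [← X.hP'] at hbP
    rcases mem_union.1 hbP with hbW | hbU
    · obtain ⟨q, u, u', ⟨hq, hu, hu', hR⟩, fq, fu, fu'⟩ := n3 _ (X.bw b hbW)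
      obtain ⟨aq, nq⟩ := hFn _ fq
      obtain ⟨au, nu⟩ := hFn _ fu
      obtain ⟨au', nu'⟩ := hFn _ fu'
      obtain ⟨g1, g2, g3⟩ := inter_cards_WUU dQW dQU X.hWU' hq hbW (X.hBU _ nu hu)
        (X.hBU _ nu' hu') (X.hs.ne _ _ _ _ hR).2.2
      refine step _ 1 (by norm_num) (Til.single hR) ?_ g1 g2 g3 ⟨b, by simp, hbB⟩
        ((c4 _ _ _ _).trans (by norm_num))
      intro v; simp only [mem_insert, mem_singleton]; rintro (h | h | h | h) <;> subst h <;> assumption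
    · obtain ⟨q, w, u', ⟨hq, hw, hu', hR⟩, fq, fw, fu'⟩ := n3 _ (X.bu b hbU)
      obtain ⟨aq, nq⟩ := hFn _ fq
      obtain ⟨aw, nw⟩ := hFn _ fw
      obtain ⟨au', nu'⟩ := hFn _ fu'
      have hR2 : R q w b u' := X.hs.sw1 _ _ _ _ hR
      obtain ⟨g1, g2, g3⟩ := inter_cards_WUU dQW dQU X.hWU' hq (X.hBW _ nw hw) hbU
        (X.hBU _ nu' hu') (X.hs.ne _ _ _ _ hR2).2.2
      refine step _ 1 (by norm_num) (Til.single hR2) ?_ g1 g2 g3 ⟨b, by simp, hbB⟩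
        ((c4 _ _ _ _).trans (by norm_num))
      intro v; simp only [mem_insert, mem_singleton]; rintro (h | h | h | h) <;> subst h <;> assumption

end ext
end PM13


namespace PM13
open Finset
set_option linter.unusedSectionVars false
set_option linter.unusedVariables false

section ext
variable {V : Type} [Fintype V] [DecidableEq V] {Q P W U W' U' B : Finset V}
  {R : V → V → V → V → Prop} {N M : ℕ}

lemma cn_sum_le {α β : Type} [Fintype α] [Fintype β] (p p' : α × β → Prop) (s : Finset α) (c : ℕ)
    (hs : ∀ a b, p (a, b) → a ∈ s)
    (h : ∀ a ∈ s, cn (fun b => p (a, b)) ≤ c + cn (fun b => p' (a, b))) :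
    cn p ≤ s.card * c + cn p' := by
  rw [cn_prod, cn_prod p', ← sum_subset (subset_univ s)]
  · calc ∑ a ∈ s, cn (fun b => p (a, b)) ≤ ∑ a ∈ s, (c + cn (fun b => p' (a, b))) := sum_le_sum h
      _ = s.card * c + ∑ a ∈ s, cn (fun b => p' (a, b)) := by
        rw [sum_add_distrib, sum_const, smul_eq_mul]
      _ ≤ _ := Nat.add_le_add_left (sum_le_sum_of_subset (subset_univ s)) _
  · intro a _ ha
    by_contra hne
    obtain ⟨b, hb⟩ := cn_pos (Nat.pos_of_ne_zero hne)
    exact ha (hs a b hb)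

lemma few {α β : Type} [Fintype α] [Fintype β] (s : Finset α) (p : α × β → Prop) (c N M d : ℕ)
    (h : ∀ a ∈ s, N ^ 3 ≤ c * cn (fun b => p (a, b))) (hp : M * cn p ≤ d * N ^ 4) (hN : 0 < N) :
    s.card * M ≤ d * c * N := by
  have h1 : s.card * N ^ 3 ≤ c * cn p := by
    rw [cn_prod, mul_sum, ← smul_eq_mul]
    refine (card_nsmul_le_sum s _ _ h).trans ?_
    exact sum_le_sum_of_subset (subset_univ _)
  have h2 : s.card * M * N ^ 3 ≤ d * c * N * N ^ 3 := by
    calc s.card * M * N ^ 3 = M * (s.card * N ^ 3) := by ring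
      _ ≤ M * (c * cn p) := by gcongr
      _ = c * (M * cn p) := by ring
      _ ≤ c * (d * N ^ 4) := by gcongr
      _ = _ := by ring
  exact Nat.le_of_mul_le_mul_right h2 (by positivity)

lemma box2 (A B : Finset V) : cn (fun x : V × V => x.1 ∈ A ∧ x.2 ∈ B) = A.card * B.card := by
  rw [cn_and_prod (fun a => a ∈ A) (fun b => b ∈ B), cn_mem, cn_mem]

lemma box3 (A B C : Finset V) : cn (fun x : V × V × V => x.1 ∈ A ∧ x.2.1 ∈ B ∧ x.2.2 ∈ C) =
    A.card * B.card * C.card := by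
  rw [cn_and_prod (fun a => a ∈ A) (fun x : V × V => x.1 ∈ B ∧ x.2 ∈ C), cn_mem, box2, mul_assoc]

lemma box4 (A B C D : Finset V) : cn (fun x : V × V × V × V => x.1 ∈ A ∧ x.2.1 ∈ B ∧ x.2.2.1 ∈ C ∧
    x.2.2.2 ∈ D) = A.card * B.card * C.card * D.card := by
  rw [cn_and_prod (fun a => a ∈ A) (fun x : V × V × V => x.1 ∈ B ∧ x.2.1 ∈ C ∧ x.2.2 ∈ D),
    cn_mem, box3]; ring

lemma box3_split (A B C : Finset V) (p : V × V × V → Prop) :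
    A.card * B.card * C.card ≤
      cn (fun x : V × V × V => x.1 ∈ A ∧ x.2.1 ∈ B ∧ x.2.2 ∈ C ∧ p x) +
      cn (fun x : V × V × V => x.1 ∈ A ∧ x.2.1 ∈ B ∧ x.2.2 ∈ C ∧ ¬ p x) := by
  rw [← box3]
  exact cn_cover (fun a => by tauto)

/-- the extremal situation -/
structure Ex (Q P W U : Finset V) (R : V → V → V → V → Prop) (N M : ℕ) : Prop where
  hs : Sys Q P R
  hQP : Q ∪ P = univ
  cV : Fintype.card V = 4 * N
  hWU : Disjoint W U
  hP : W ∪ U = P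
  cQ : Q.card = N
  cW : W.card = N
  cU : U.card = 2 * N
  hdeg : ∀ q ∈ Q, ∀ u ∈ P, 5 * N ^ 2 + 4 ≤ 7 * N + cn (fun x : V × V => R q u x.1 x.2)
  hE : M * cn (fun x : V × V × V × V => x.1 ∈ Q ∧ x.2.1 ∈ U ∧ x.2.2.1 ∈ U ∧ x.2.2.2 ∈ U ∧
    R x.1 x.2.1 x.2.2.1 x.2.2.2) ≤ N ^ 4
  hM : 10 ^ 7 ≤ M
  hN : 14 * M ≤ N

lemma Ex.miss1 (E : Ex Q P W U R N M) : M * cn (fun x : (V × V) × (V × V) =>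
    (x.1.1 ∈ Q ∧ x.1.2 ∈ U) ∧ (x.2.1 ∈ P ∧ x.2.2 ∈ P ∧ ¬ (x.2.1 ∈ U ∧ x.2.2 ∈ U)) ∧
      ¬ R x.1.1 x.1.2 x.2.1 x.2.2) ≤ 2 * N ^ 4 := by
  have UP : U ⊆ P := E.hP ▸ subset_union_right
  have cP : P.card = 3 * N := by
    rw [← E.hP, card_union_of_disjoint E.hWU, E.cW, E.cU]; ring
  have h := cn_sum_le (fun x : (V × V) × (V × V) =>
    (x.1.1 ∈ Q ∧ x.1.2 ∈ U) ∧ (x.2.1 ∈ P ∧ x.2.2 ∈ P ∧ ¬ (x.2.1 ∈ U ∧ x.2.2 ∈ U)) ∧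
      ¬ R x.1.1 x.1.2 x.2.1 x.2.2) (fun x : (V × V) × (V × V) =>
    x.1.1 ∈ Q ∧ x.1.2 ∈ U ∧ x.2.1 ∈ U ∧ x.2.2 ∈ U ∧ R x.1.1 x.1.2 x.2.1 x.2.2) (Q ×ˢ U) (7 * N)
    (fun a b h => mem_product.2 h.1) (by
      rintro ⟨q, u⟩ hqu
      obtain ⟨hq, hu⟩ := mem_product.1 hqu
      simp only at hq hu
      have d := E.hdeg q hq u (UP hu)
      have a1 : cn (fun x : V × V => R q u x.1 x.2) +
          cn (fun x : V × V => (x.1 ∈ P ∧ x.2 ∈ P ∧ ¬ (x.1 ∈ U ∧ x.2 ∈ U)) ∧ ¬ R q u x.1 x.2) +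
          cn (fun x : V × V => x.1 ∈ U ∧ x.2 ∈ U) ≤
          cn (fun x : V × V => x.1 ∈ P ∧ x.2 ∈ P) +
          cn (fun x : V × V => x.1 ∈ U ∧ x.2 ∈ U ∧ R q u x.1 x.2) := by
        have b1 := cn_and_or (p := fun x : V × V => R q u x.1 x.2)
          (q := fun x : V × V => (x.1 ∈ P ∧ x.2 ∈ P ∧ ¬ (x.1 ∈ U ∧ x.2 ∈ U)) ∧ ¬ R q u x.1 x.2)
          (r := fun x : V × V => x.1 ∈ P ∧ x.2 ∈ P ∧ (¬ (x.1 ∈ U ∧ x.2 ∈ U) ∨ R q u x.1 x.2)) (by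
            rintro x (h | h)
            · obtain ⟨_, _, h1, h2⟩ := E.hs.mem _ _ _ _ h
              exact ⟨h1, h2, Or.inr h⟩
            · exact ⟨h.1.1, h.1.2.1, Or.inl h.1.2.2⟩)
        have b0 : cn (fun x : V × V => R q u x.1 x.2 ∧
          (x.1 ∈ P ∧ x.2 ∈ P ∧ ¬ (x.1 ∈ U ∧ x.2 ∈ U)) ∧ ¬ R q u x.1 x.2) = 0 := by
          by_contra h
          obtain ⟨a, ha⟩ := cn_pos (Nat.pos_of_ne_zero h)
          tauto
        have b2 := cn_and_or
          (p := fun x : V × V => x.1 ∈ P ∧ x.2 ∈ P ∧ (¬ (x.1 ∈ U ∧ x.2 ∈ U) ∨ R q u x.1 x.2))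
          (q := fun x : V × V => x.1 ∈ U ∧ x.2 ∈ U)
          (r := fun x : V × V => x.1 ∈ P ∧ x.2 ∈ P) (by
            rintro x (h | h)
            · exact ⟨h.1, h.2.1⟩
            · exact ⟨UP h.1, UP h.2⟩)
        have b3 : cn (fun x : V × V => (x.1 ∈ P ∧ x.2 ∈ P ∧ (¬ (x.1 ∈ U ∧ x.2 ∈ U) ∨ R q u x.1 x.2)) ∧
          (x.1 ∈ U ∧ x.2 ∈ U)) ≤ cn (fun x : V × V => x.1 ∈ U ∧ x.2 ∈ U ∧ R q u x.1 x.2) :=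
          cn_mono (fun x => by tauto)
        omega
      rw [box2, box2, cP, E.cU] at a1
      have a2 : cn (fun b : V × V => (q ∈ Q ∧ u ∈ U) ∧ (b.1 ∈ P ∧ b.2 ∈ P ∧ ¬ (b.1 ∈ U ∧ b.2 ∈ U)) ∧
        ¬ R q u b.1 b.2) ≤ cn (fun x : V × V => (x.1 ∈ P ∧ x.2 ∈ P ∧ ¬ (x.1 ∈ U ∧ x.2 ∈ U)) ∧
        ¬ R q u x.1 x.2) := cn_mono (fun x h => h.2)
      have a3 : cn (fun x : V × V => x.1 ∈ U ∧ x.2 ∈ U ∧ R q u x.1 x.2) ≤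
        cn (fun b : V × V => q ∈ Q ∧ u ∈ U ∧ b.1 ∈ U ∧ b.2 ∈ U ∧ R q u b.1 b.2) :=
        cn_mono (fun x h => ⟨hq, hu, h⟩)
      refine a2.trans (le_trans ?_ (Nat.add_le_add_left a3 _))
      nlinarith)
  rw [card_product, E.cQ, E.cU] at h
  have h2 : cn (fun x : (V × V) × (V × V) =>
    x.1.1 ∈ Q ∧ x.1.2 ∈ U ∧ x.2.1 ∈ U ∧ x.2.2 ∈ U ∧ R x.1.1 x.1.2 x.2.1 x.2.2) ≤
      cn (fun x : V × V × V × V => x.1 ∈ Q ∧ x.2.1 ∈ U ∧ x.2.2.1 ∈ U ∧ x.2.2.2 ∈ U ∧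
    R x.1 x.2.1 x.2.2.1 x.2.2.2) := cn_inj (fun x => (x.1.1, x.1.2, x.2.1, x.2.2)) (fun x h => h) (by
      rintro ⟨⟨a, b⟩, c, d⟩ ⟨⟨a', b'⟩, c', d'⟩ _ _ h; simp at h ⊢; tauto)
  have h3 := E.hE
  have h4 : 14 * M * N ^ 3 ≤ N * N ^ 3 := Nat.mul_le_mul_right _ E.hN
  have h5 := Nat.mul_le_mul_left M (h.trans (Nat.add_le_add_left h2 _))
  refine h5.trans ?_
  nlinarith

lemma Ex.mWUU (E : Ex Q P W U R N M) : M * cn (fun x : V × V × V × V =>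
    x.1 ∈ Q ∧ x.2.1 ∈ W ∧ x.2.2.1 ∈ U ∧ x.2.2.2 ∈ U ∧ ¬ R x.1 x.2.1 x.2.2.1 x.2.2.2) ≤ 2 * N ^ 4 := by
  have UP : U ⊆ P := E.hP ▸ subset_union_right
  have WP : W ⊆ P := E.hP ▸ subset_union_left
  have dWU := Finset.disjoint_left.1 E.hWU
  refine (Nat.mul_le_mul_left _ ?_).trans E.miss1
  refine cn_inj (fun x => ((x.1, x.2.2.1), (x.2.1, x.2.2.2))) ?_ ?_
  · rintro x ⟨h1, h2, h3, h4, h5⟩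
    exact ⟨⟨h1, h3⟩, ⟨WP h2, UP h4, fun h => dWU h2 h.1⟩, fun h => h5 (E.hs.sw1 _ _ _ _ h)⟩
  · rintro ⟨a, b, c, d⟩ ⟨a', b', c', d'⟩ _ _ h; simp at h ⊢; tauto

lemma Ex.mWWU (E : Ex Q P W U R N M) : M * cn (fun x : V × V × V × V =>
    x.1 ∈ Q ∧ x.2.1 ∈ W ∧ x.2.2.1 ∈ W ∧ x.2.2.2 ∈ U ∧ ¬ R x.1 x.2.1 x.2.2.1 x.2.2.2) ≤ 2 * N ^ 4 := by
  have UP : U ⊆ P := E.hP ▸ subset_union_right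
  have WP : W ⊆ P := E.hP ▸ subset_union_left
  have dWU := Finset.disjoint_left.1 E.hWU
  refine (Nat.mul_le_mul_left _ ?_).trans E.miss1
  refine cn_inj (fun x => ((x.1, x.2.2.2), (x.2.1, x.2.2.1))) ?_ ?_
  · rintro x ⟨h1, h2, h3, h4, h5⟩
    exact ⟨⟨h1, h4⟩, ⟨WP h2, WP h3, fun h => dWU h2 h.1⟩, fun h => h5 (E.hs.rot h)⟩
  · rintro ⟨a, b, c, d⟩ ⟨a', b', c', d'⟩ _ _ h; simp at h ⊢; tauto

lemma few_perm {α β γ : Type} [Fintype α] [Fintype β] [Fintype γ] (s : Finset α) (p : α × β → Prop)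
    (q : γ → Prop) (f : α × β → γ) (hf : Function.Injective f) (hpq : ∀ x, p x → q (f x)) (c N M d : ℕ)
    (h : ∀ a ∈ s, N ^ 3 ≤ c * cn (fun b => p (a, b))) (hp : M * cn q ≤ d * N ^ 4) (hN : 0 < N) :
    s.card * M ≤ d * c * N :=
  few s p c N M d h ((Nat.mul_le_mul_left _ (cn_inj f hpq (fun _ _ _ _ h => hf h))).trans hp) hN

noncomputable def wc (Q U : Finset V) (R : V → V → V → V → Prop) (v : V) : ℕ :=
  cn (fun x : V × V × V => x.1 ∈ Q ∧ x.2.1 ∈ U ∧ x.2.2 ∈ U ∧ R x.1 v x.2.1 x.2.2)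

noncomputable def uc (Q W U : Finset V) (R : V → V → V → V → Prop) (v : V) : ℕ :=
  cn (fun x : V × V × V => x.1 ∈ Q ∧ x.2.1 ∈ W ∧ x.2.2 ∈ U ∧ R x.1 v x.2.1 x.2.2)

lemma Ex.wcuc (E : Ex Q P W U R N M) {v : V} (hv : v ∈ P) :
    4 * N ^ 3 ≤ wc Q U R v + 2 * uc Q W U R v + 7 * N ^ 2 := by
  have h1 : Q.card * (5 * N ^ 2 - 7 * N) ≤ cn (fun x : V × (V × V) => R x.1 v x.2.1 x.2.2) :=
    cn_prod_ge Q _ (fun q hq => by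
      have := E.hdeg q hq v hv
      show 5 * N ^ 2 - 7 * N ≤ cn (fun x : V × V => R q v x.1 x.2)
      omega)
  have h2 : cn (fun x : V × (V × V) => R x.1 v x.2.1 x.2.2) ≤
      (wc Q U R v + uc Q W U R v) + (uc Q W U R v +
        cn (fun x : V × V × V => x.1 ∈ Q ∧ x.2.1 ∈ W ∧ x.2.2 ∈ W)) := by
    refine le_trans (cn_cover (q := fun x : V × V × V => (x.1 ∈ Q ∧ x.2.1 ∈ U ∧ x.2.2 ∈ U ∧ R x.1 v x.2.1 x.2.2) ∨
      (x.1 ∈ Q ∧ x.2.1 ∈ W ∧ x.2.2 ∈ U ∧ R x.1 v x.2.1 x.2.2))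
      (r := fun x : V × V × V => (x.1 ∈ Q ∧ x.2.2 ∈ W ∧ x.2.1 ∈ U ∧ R x.1 v x.2.2 x.2.1) ∨
      (x.1 ∈ Q ∧ x.2.1 ∈ W ∧ x.2.2 ∈ W)) ?_) ?_
    · intro x h
      obtain ⟨a, _, b, c⟩ := E.hs.mem _ _ _ _ h
      have h' := E.hs.sw2 _ _ _ _ h
      rw [← E.hP, mem_union] at b c
      tauto
    · refine Nat.add_le_add (cn_or _ _) ((cn_or _ _).trans (Nat.add_le_add_right ?_ _))
      exact cn_inj (fun x => (x.1, x.2.2, x.2.1)) (fun x h => h) (by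
        rintro ⟨a, b, c⟩ ⟨a', b', c'⟩ _ _ h; simp at h ⊢; tauto)
  rw [box3, E.cQ, E.cW] at h2
  rw [E.cQ] at h1
  have h3 : 7 * N ≤ 5 * N ^ 2 := by have := E.hN; have := E.hM; nlinarith
  have h4 : N * (5 * N ^ 2 - 7 * N) + 7 * N ^ 2 = 5 * N ^ 3 := by
    have : N * (5 * N ^ 2 - 7 * N) + N * (7 * N) = N * (5 * N ^ 2) := by
      rw [← mul_add, Nat.sub_add_cancel h3]
    nlinarith
  nlinarith

lemma Ex.bq (E : Ex Q P W U R N M) : ∀ q ∈ Q,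
    N ^ 3 ≤ 4 * cn (fun x : V × V × V => x.1 ∈ W ∧ x.2.1 ∈ U ∧ x.2.2 ∈ U ∧
      R q x.1 x.2.1 x.2.2) ∨ N ^ 3 ≤ 4 * cn (fun x : V × V × V => x.1 ∈ U ∧ x.2.1 ∈ U ∧ x.2.2 ∈ U ∧
      R q x.1 x.2.1 x.2.2) := by
  intro q hq
  have UP : U ⊆ P := E.hP ▸ subset_union_right
  have h1 : U.card * (5 * N ^ 2 - 7 * N) ≤ cn (fun x : V × (V × V) => x.1 ∈ U ∧ R q x.1 x.2.1 x.2.2) :=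
    cn_prod_ge U _ (fun u hu => by
      have := E.hdeg q hq u (UP hu)
      have h2 : cn (fun x : V × V => R q u x.1 x.2) ≤ cn (fun b : V × V => u ∈ U ∧ R q u b.1 b.2) :=
        cn_mono (fun x h => ⟨hu, h⟩)
      show 5 * N ^ 2 - 7 * N ≤ cn (fun b : V × V => u ∈ U ∧ R q u b.1 b.2)
      omega)
  set a := cn (fun x : V × V × V => x.1 ∈ W ∧ x.2.1 ∈ U ∧ x.2.2 ∈ U ∧ R q x.1 x.2.1 x.2.2)
  set b := cn (fun x : V × V × V => x.1 ∈ U ∧ x.2.1 ∈ U ∧ x.2.2 ∈ U ∧ R q x.1 x.2.1 x.2.2)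
  have h2 : cn (fun x : V × (V × V) => x.1 ∈ U ∧ R q x.1 x.2.1 x.2.2) ≤ (b + a) + (a +
        cn (fun x : V × V × V => x.1 ∈ U ∧ x.2.1 ∈ W ∧ x.2.2 ∈ W)) := by
    refine le_trans (cn_cover (q := fun x : V × V × V => (x.1 ∈ U ∧ x.2.1 ∈ U ∧ x.2.2 ∈ U ∧ R q x.1 x.2.1 x.2.2) ∨
      (x.2.1 ∈ W ∧ x.1 ∈ U ∧ x.2.2 ∈ U ∧ R q x.2.1 x.1 x.2.2))
      (r := fun x : V × V × V => (x.2.2 ∈ W ∧ x.1 ∈ U ∧ x.2.1 ∈ U ∧ R q x.2.2 x.1 x.2.1) ∨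
      (x.1 ∈ U ∧ x.2.1 ∈ W ∧ x.2.2 ∈ W)) ?_) ?_
    · rintro x ⟨h0, h⟩
      obtain ⟨a, _, b, c⟩ := E.hs.mem _ _ _ _ h
      have h' := E.hs.sw1 _ _ _ _ h
      have h'' := E.hs.rot' h
      rw [← E.hP, mem_union] at b c
      tauto
    · refine Nat.add_le_add ((cn_or _ _).trans (Nat.add_le_add_left ?_ _))
        ((cn_or _ _).trans (Nat.add_le_add_right ?_ _))
      · exact cn_inj (fun x => (x.2.1, x.1, x.2.2)) (fun x h => h) (by
          rintro ⟨a, b, c⟩ ⟨a', b', c'⟩ _ _ h; simp at h ⊢; tauto)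
      · exact cn_inj (fun x => (x.2.2, x.1, x.2.1)) (fun x h => h) (by
          rintro ⟨a, b, c⟩ ⟨a', b', c'⟩ _ _ h; simp at h ⊢; tauto)
  rw [box3, E.cU, E.cW] at h2
  rw [E.cU] at h1
  have hN : 100 ≤ N := by have := E.hN; have := E.hM; omega
  have h3 : 7 * N ≤ 5 * N ^ 2 := by nlinarith
  have h4 : 2 * N * (5 * N ^ 2 - 7 * N) + 14 * N ^ 2 = 10 * N ^ 3 := by
    have : 2 * N * (5 * N ^ 2 - 7 * N) + 2 * N * (7 * N) = 2 * N * (5 * N ^ 2) := by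
      rw [← mul_add, Nat.sub_add_cancel h3]
    nlinarith
  have h5 : 100 * N ^ 2 ≤ N * N ^ 2 := Nat.mul_le_mul_right _ hN
  by_contra hc
  push Not at hc
  nlinarith

lemma Ex.ww (E : Ex Q P W U R N M) : N ^ 4 ≤ cn (fun x : V × V × V × V =>
    x.1 ∈ Q ∧ x.2.1 ∈ W ∧ x.2.2.1 ∈ W ∧ x.2.2.2 ∈ U ∧ R x.1 x.2.1 x.2.2.1 x.2.2.2) := by
  have h1 := box4 Q W W U
  rw [E.cQ, E.cW, E.cU] at h1
  have h2 := cn_cover (p := fun x : V × V × V × V => x.1 ∈ Q ∧ x.2.1 ∈ W ∧ x.2.2.1 ∈ W ∧ x.2.2.2 ∈ U)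
    (q := fun x : V × V × V × V =>
      x.1 ∈ Q ∧ x.2.1 ∈ W ∧ x.2.2.1 ∈ W ∧ x.2.2.2 ∈ U ∧ R x.1 x.2.1 x.2.2.1 x.2.2.2)
    (r := fun x : V × V × V × V =>
      x.1 ∈ Q ∧ x.2.1 ∈ W ∧ x.2.2.1 ∈ W ∧ x.2.2.2 ∈ U ∧ ¬ R x.1 x.2.1 x.2.2.1 x.2.2.2)
    (fun x => by tauto)
  have h3 := E.mWWU
  have h4 : 2 * cn (fun x : V × V × V × V =>
      x.1 ∈ Q ∧ x.2.1 ∈ W ∧ x.2.2.1 ∈ W ∧ x.2.2.2 ∈ U ∧ ¬ R x.1 x.2.1 x.2.2.1 x.2.2.2) ≤ 2 * N ^ 4 :=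
    (Nat.mul_le_mul_right _ (by have := E.hM; omega)).trans h3
  nlinarith

end ext
end PM13


namespace PM13
open Finset
set_option linter.unusedSectionVars false
set_option linter.unusedVariables false

section ext
variable {V : Type} [Fintype V] [DecidableEq V] {Q P W U W' U' B : Finset V}
  {R : V → V → V → V → Prop} {N M : ℕ}

lemma Ex.Npos (E : Ex Q P W U R N M) : 10 ^ 8 ≤ N := by
  have := E.hN; have := E.hM; omega

/-- few vertices outside the good set -/
lemma Ex.bad (E : Ex Q P W U R N M) : ∃ B : Finset V, B.card * M ≤ 600 * N ∧
  (∀ q, q ∉ B → q ∈ Q → 100 * cn (fun x : V × V × V => x.1 ∈ W ∧ x.2.1 ∈ U ∧ x.2.2 ∈ U ∧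
      ¬ R q x.1 x.2.1 x.2.2) ≤ N ^ 3) ∧
  (∀ w, w ∉ B → w ∈ W → 100 * cn (fun x : V × V × V => x.1 ∈ Q ∧ x.2.1 ∈ U ∧ x.2.2 ∈ U ∧
      ¬ R x.1 w x.2.1 x.2.2) ≤ N ^ 3) ∧
  (∀ u, u ∉ B → u ∈ U → 100 * cn (fun x : V × V × V => x.1 ∈ Q ∧ x.2.1 ∈ W ∧ x.2.2 ∈ U ∧
      ¬ R x.1 x.2.1 u x.2.2) ≤ N ^ 3) := by
  have hN : 0 < N := by have := E.Npos; omega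
  set B1 := FS (fun q : V => q ∈ Q ∧ ¬ 100 * cn (fun x : V × V × V => x.1 ∈ W ∧ x.2.1 ∈ U ∧ x.2.2 ∈ U ∧
      ¬ R q x.1 x.2.1 x.2.2) ≤ N ^ 3) with hB1
  set B2 := FS (fun w : V => w ∈ W ∧ ¬ 100 * cn (fun x : V × V × V => x.1 ∈ Q ∧ x.2.1 ∈ U ∧ x.2.2 ∈ U ∧
      ¬ R x.1 w x.2.1 x.2.2) ≤ N ^ 3) with hB2
  set B3 := FS (fun u : V => u ∈ U ∧ ¬ 100 * cn (fun x : V × V × V => x.1 ∈ Q ∧ x.2.1 ∈ W ∧ x.2.2 ∈ U ∧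
      ¬ R x.1 x.2.1 u x.2.2) ≤ N ^ 3) with hB3
  have c1 : B1.card * M ≤ 2 * 100 * N := by
    refine few_perm B1 (fun x : V × V × V × V => x.1 ∈ Q ∧ x.2.1 ∈ W ∧ x.2.2.1 ∈ U ∧ x.2.2.2 ∈ U ∧
      ¬ R x.1 x.2.1 x.2.2.1 x.2.2.2) _ id Function.injective_id (fun x h => h) 100 N M 2 ?_ E.mWUU hN
    intro q hq
    obtain ⟨hq, h⟩ := mem_FS.1 hq
    refine (not_le.1 h).le.trans (Nat.mul_le_mul_left _ (cn_mono (fun x hx => ?_)))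
    exact ⟨hq, hx⟩
  have c2 : B2.card * M ≤ 2 * 100 * N := by
    refine few_perm B2 (fun x : V × V × V × V => x.1 ∈ W ∧ x.2.1 ∈ Q ∧ x.2.2.1 ∈ U ∧ x.2.2.2 ∈ U ∧
      ¬ R x.2.1 x.1 x.2.2.1 x.2.2.2) _ (fun x => (x.2.1, x.1, x.2.2.1, x.2.2.2)) ?_
      (fun x h => ⟨h.2.1, h.1, h.2.2⟩) 100 N M 2 ?_ E.mWUU hN
    · rintro ⟨a, b, c, d⟩ ⟨a', b', c', d'⟩ h; simp at h ⊢; tauto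
    intro q hq
    obtain ⟨hq, h⟩ := mem_FS.1 hq
    refine (not_le.1 h).le.trans (Nat.mul_le_mul_left _ (cn_mono (fun x hx => ?_)))
    exact ⟨hq, hx⟩
  have c3 : B3.card * M ≤ 2 * 100 * N := by
    refine few_perm B3 (fun x : V × V × V × V => x.1 ∈ U ∧ x.2.1 ∈ Q ∧ x.2.2.1 ∈ W ∧ x.2.2.2 ∈ U ∧
      ¬ R x.2.1 x.2.2.1 x.1 x.2.2.2) _ (fun x => (x.2.1, x.2.2.1, x.1, x.2.2.2)) ?_
      (fun x h => ⟨h.2.1, h.2.2.1, h.1, h.2.2.2⟩) 100 N M 2 ?_ E.mWUU hN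
    · rintro ⟨a, b, c, d⟩ ⟨a', b', c', d'⟩ h; simp at h ⊢; tauto
    intro q hq
    obtain ⟨hq, h⟩ := mem_FS.1 hq
    refine (not_le.1 h).le.trans (Nat.mul_le_mul_left _ (cn_mono (fun x hx => ?_)))
    exact ⟨hq, hx⟩
  refine ⟨B1 ∪ (B2 ∪ B3), ?_, ?_, ?_, ?_⟩
  · have h1 : (B1 ∪ (B2 ∪ B3)).card ≤ B1.card + (B2.card + B3.card) :=
      (card_union_le _ _).trans (Nat.add_le_add_left (card_union_le _ _) _)
    have h2 := Nat.mul_le_mul_right M h1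
    nlinarith
  · intro v hv hm
    by_contra hc
    exact hv (mem_union_left _ (mem_FS.2 ⟨hm, hc⟩))
  · intro v hv hm
    by_contra hc
    exact hv (mem_union_right _ (mem_union_left _ (mem_FS.2 ⟨hm, hc⟩)))
  · intro v hv hm
    by_contra hc
    exact hv (mem_union_right _ (mem_union_right _ (mem_FS.2 ⟨hm, hc⟩)))

lemma Ex.CU (E : Ex Q P W U R N M) (C : Finset V) (hC : ∀ v ∈ C, N ^ 3 ≤ 4 * wc Q U R v)
    (hCU : C ⊆ U) : C.card * M ≤ 4 * N := by
  have hN : 0 < N := by have := E.Npos; omega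
  have := few_perm C (fun x : V × V × V × V => x.1 ∈ U ∧ x.2.1 ∈ Q ∧ x.2.2.1 ∈ U ∧ x.2.2.2 ∈ U ∧
      R x.2.1 x.1 x.2.2.1 x.2.2.2) _ (fun x => (x.2.1, x.1, x.2.2.1, x.2.2.2)) (by
        rintro ⟨a, b, c, d⟩ ⟨a', b', c', d'⟩ h; simp at h ⊢; tauto)
      (fun x h => ⟨h.2.1, h.1, h.2.2⟩) 4 N M 1 (by
        intro q hq
        refine (hC q hq).trans (Nat.mul_le_mul_left _ (cn_mono (fun x hx => ?_)))
        exact ⟨hCU hq, hx⟩) (E.hE.trans (le_of_eq (one_mul _).symm)) hN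
  omega

lemma Ex.WC (E : Ex Q P W U R N M) (C : Finset V) (hC : ∀ v ∈ C, ¬ N ^ 3 ≤ 4 * wc Q U R v)
    (hCW : C ⊆ W) : C.card * M ≤ 2 * N := by
  have hN : 0 < N := by have := E.Npos; omega
  have := few_perm C (fun x : V × V × V × V => x.1 ∈ W ∧ x.2.1 ∈ Q ∧ x.2.2.1 ∈ U ∧ x.2.2.2 ∈ U ∧
      ¬ R x.2.1 x.1 x.2.2.1 x.2.2.2) _ (fun x => (x.2.1, x.1, x.2.2.1, x.2.2.2)) (by
        rintro ⟨a, b, c, d⟩ ⟨a', b', c', d'⟩ h; simp at h ⊢; tauto)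
      (fun x h => ⟨h.2.1, h.1, h.2.2⟩) 1 N M 2 (by
        intro q hq
        have h1 := box3_split Q U U (fun x => R x.1 q x.2.1 x.2.2)
        have h2 := hC q hq
        rw [E.cQ, E.cU] at h1
        have h4 : N ^ 3 ≤ 1 * cn (fun x : V × V × V => x.1 ∈ Q ∧ x.2.1 ∈ U ∧ x.2.2 ∈ U ∧
          ¬ R x.1 q x.2.1 x.2.2) := by
          unfold wc at h2
          have h3 : N * (2 * N) * (2 * N) = 4 * N ^ 3 := by ring
          omega
        refine h4.trans (Nat.mul_le_mul_left _ (cn_mono (fun x hx => ?_)))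
        exact ⟨hCW hq, hx⟩) E.mWUU hN
  omega

lemma Ex.ZW (E : Ex Q P W U R N M) (C : Finset V) (hC : ∀ v ∈ C, ¬ N ^ 3 ≤ 4 * uc Q W U R v)
    (hCW : C ⊆ W) : C.card * M ≤ 2 * N := by
  have hN : 0 < N := by have := E.Npos; omega
  have := few_perm C (fun x : V × V × V × V => x.1 ∈ W ∧ x.2.1 ∈ Q ∧ x.2.2.1 ∈ W ∧ x.2.2.2 ∈ U ∧
      ¬ R x.2.1 x.1 x.2.2.1 x.2.2.2) _ (fun x => (x.2.1, x.1, x.2.2.1, x.2.2.2)) (by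
        rintro ⟨a, b, c, d⟩ ⟨a', b', c', d'⟩ h; simp at h ⊢; tauto)
      (fun x h => ⟨h.2.1, h.1, h.2.2⟩) 1 N M 2 (by
        intro q hq
        have h1 := box3_split Q W U (fun x => R x.1 q x.2.1 x.2.2)
        have h2 := hC q hq
        rw [E.cQ, E.cW, E.cU] at h1
        have h4 : N ^ 3 ≤ 1 * cn (fun x : V × V × V => x.1 ∈ Q ∧ x.2.1 ∈ W ∧ x.2.2 ∈ U ∧
          ¬ R x.1 q x.2.1 x.2.2) := by
          unfold uc at h2
          have h3 : N * N * (2 * N) = 2 * N ^ 3 := by ring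
          omega
        refine h4.trans (Nat.mul_le_mul_left _ (cn_mono (fun x hx => ?_)))
        exact ⟨hCW hq, hx⟩) E.mWWU hN
  omega

lemma Ex.ZU (E : Ex Q P W U R N M) (C : Finset V) (hC : ∀ v ∈ C, ¬ N ^ 3 ≤ 4 * uc Q W U R v)
    (hCU : C ⊆ U) : C.card * M ≤ 2 * N := by
  have hN : 0 < N := by have := E.Npos; omega
  have := few_perm C (fun x : V × V × V × V => x.1 ∈ U ∧ x.2.1 ∈ Q ∧ x.2.2.1 ∈ W ∧ x.2.2.2 ∈ U ∧
      ¬ R x.2.1 x.1 x.2.2.1 x.2.2.2) _ (fun x => (x.2.1, x.2.2.1, x.1, x.2.2.2)) (by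
        rintro ⟨a, b, c, d⟩ ⟨a', b', c', d'⟩ h; simp at h ⊢; tauto)
      (fun x h => ⟨h.2.1, h.2.2.1, h.1, h.2.2.2.1, fun h' => h.2.2.2.2 (E.hs.sw1 _ _ _ _ h')⟩) 1 N M 2 (by
        intro q hq
        have h1 := box3_split Q W U (fun x => R x.1 q x.2.1 x.2.2)
        have h2 := hC q hq
        rw [E.cQ, E.cW, E.cU] at h1
        have h4 : N ^ 3 ≤ 1 * cn (fun x : V × V × V => x.1 ∈ Q ∧ x.2.1 ∈ W ∧ x.2.2 ∈ U ∧
          ¬ R x.1 q x.2.1 x.2.2) := by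
          unfold uc at h2
          have h3 : N * N * (2 * N) = 2 * N ^ 3 := by ring
          omega
        refine h4.trans (Nat.mul_le_mul_left _ (cn_mono (fun x hx => ?_)))
        exact ⟨hCU hq, hx⟩) E.mWUU hN
  omega

/-- degree inside a slightly too large set -/
lemma Ex.degU (E : Ex Q P W U R N M) (hU' : U' ⊆ P) (k : ℕ) (cU' : U'.card = 2 * N + (k + 1)) :
    ∀ q ∈ Q, ∀ u ∈ U', 4 * N * k + 2 ≤ cn (fun x : V × V => x.1 ∈ U' ∧ x.2 ∈ U' ∧ R q u x.1 x.2) := by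
  intro q hq u hu
  have cP : P.card = 3 * N := by
    rw [← E.hP, card_union_of_disjoint E.hWU, E.cW, E.cU]; ring
  have d := E.hdeg q hq u (hU' hu)
  have h1 := cn_and_or (p := fun x : V × V => R q u x.1 x.2) (q := fun x : V × V => x ∈ (U'.erase u).offDiag)
    (r := fun x : V × V => x ∈ (P.erase u).offDiag) (by
      rintro x (h | h)
      · obtain ⟨_, _, h1, h2⟩ := E.hs.mem _ _ _ _ h
        obtain ⟨n1, n2, n3⟩ := E.hs.ne _ _ _ _ h
        rw [mem_offDiag]
        exact ⟨mem_erase.2 ⟨n1.symm, h1⟩, mem_erase.2 ⟨n2.symm, h2⟩, n3⟩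
      · rw [mem_offDiag] at h ⊢
        exact ⟨erase_subset_erase _ hU' h.1, erase_subset_erase _ hU' h.2.1, h.2.2⟩)
  rw [cn_mem, cn_mem, offDiag_card, offDiag_card, card_erase_of_mem hu, card_erase_of_mem (hU' hu), cP, cU'] at h1
  have h2 : cn (fun x : V × V => R q u x.1 x.2 ∧ x ∈ (U'.erase u).offDiag) ≤
      cn (fun x : V × V => x.1 ∈ U' ∧ x.2 ∈ U' ∧ R q u x.1 x.2) := by
    refine cn_mono ?_
    rintro x ⟨h, h'⟩
    rw [mem_offDiag] at h'
    exact ⟨mem_of_mem_erase h'.1, mem_of_mem_erase h'.2.1, h⟩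
  obtain ⟨n, rfl⟩ : ∃ n, N = n + 1 := ⟨N - 1, by have := E.Npos; omega⟩
  have e1 : 3 * (n + 1) - 1 = 3 * n + 2 := by omega
  have e2 : 2 * (n + 1) + (k + 1) - 1 = 2 * n + k + 2 := by omega
  rw [e1, e2] at h1
  have e3 : (3 * n + 2) * (3 * n + 2) - (3 * n + 2) = (3 * n + 2) * (3 * n + 1) := by
    rw [Nat.sub_eq_iff_eq_add (by nlinarith)]; ring
  have e4 : (2 * n + k + 2) * (2 * n + k + 2) - (2 * n + k + 2) = (2 * n + k + 2) * (2 * n + k + 1) := by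
    rw [Nat.sub_eq_iff_eq_add (by nlinarith)]; ring
  rw [e3, e4] at h1
  nlinarith [Nat.zero_le (k * k)]

end ext
end PM13


namespace PM13
open Finset
set_option linter.unusedSectionVars false
set_option linter.unusedVariables false

section ext
variable {V : Type} [Fintype V] [DecidableEq V] {Q P W U W' U' B : Finset V}
  {R : V → V → V → V → Prop} {N M : ℕ}

lemma Ex.greedy (E : Ex Q P W U R N M) (hU' : U' ⊆ P) (k : ℕ) (cU' : U'.card = 2 * N + (k + 1))
    (hk : 1000 * (k + 1) ≤ N) (hw : ∀ v ∈ U', ¬ N ^ 3 ≤ 4 * wc Q U R v)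
    (hd : 1000 * (U' \ U).card ≤ N) : ∀ j ≤ k + 1, ∃ S, Til R j S ∧ S ⊆ Q ∪ U' := by
  have hN := E.Npos
  have cP : P.card = 3 * N := by
    rw [← E.hP, card_union_of_disjoint E.hWU, E.cW, E.cU]; ring
  intro j
  induction j with
  | zero => exact fun _ => ⟨∅, Til.nil, by simp⟩
  | succ j ih =>
  intro hj
  obtain ⟨S, hS, hSU⟩ := ih (by omega)
  obtain ⟨s1, s2, s3⟩ := hS.cards E.hs
  -- all tuples
  have h1 : (Q \ S).card * (U'.card * (4 * N * k + 2)) ≤ cn (fun x : V × V × V × V => x.1 ∈ Q \ S ∧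
      x.2.1 ∈ U' ∧ x.2.2.1 ∈ U' ∧ x.2.2.2 ∈ U' ∧ R x.1 x.2.1 x.2.2.1 x.2.2.2) := by
    refine cn_prod_ge _ _ (fun q hq => ?_)
    refine le_trans (cn_prod_ge (p := fun x : V × V × V => x.1 ∈ U' ∧ x.2.1 ∈ U' ∧ x.2.2 ∈ U' ∧
      R q x.1 x.2.1 x.2.2) U' _ (fun u hu => ?_)) (cn_mono (fun x h => ⟨hq, h⟩))
    exact (E.degU hU' k cU' q (mem_sdiff.1 hq).1 u hu).trans (cn_mono (fun x h => ⟨hu, h⟩))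
  -- tuples touching S in a given coordinate
  have h2 : cn (fun x : V × V × V × V => x.1 ∈ S ∩ P ∧ x.2.1 ∈ Q ∧ x.1 ∈ U' ∧ x.2.2.1 ∈ U' ∧ x.2.2.2 ∈ U' ∧
      R x.2.1 x.1 x.2.2.1 x.2.2.2) ≤ (S ∩ P).card * (N ^ 3 / 3) := by
    refine cn_prod_le _ _ (fun a b h => h.1) (fun u hu => ?_)
    by_cases huU : u ∈ U'
    · have a1 : cn (fun b : V × V × V => u ∈ S ∩ P ∧ b.1 ∈ Q ∧ u ∈ U' ∧ b.2.1 ∈ U' ∧ b.2.2 ∈ U' ∧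
          R b.1 u b.2.1 b.2.2) ≤ wc Q U R u + (cn (fun b : V × V × V => b.1 ∈ Q ∧ b.2.1 ∈ U' \ U ∧ b.2.2 ∈ P) +
            cn (fun b : V × V × V => b.1 ∈ Q ∧ b.2.1 ∈ P ∧ b.2.2 ∈ U' \ U)) := by
        refine (cn_cover (q := fun x : V × V × V => x.1 ∈ Q ∧ x.2.1 ∈ U ∧ x.2.2 ∈ U ∧ R x.1 u x.2.1 x.2.2)
          (r := fun b : V × V × V => (b.1 ∈ Q ∧ b.2.1 ∈ U' \ U ∧ b.2.2 ∈ P) ∨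
            (b.1 ∈ Q ∧ b.2.1 ∈ P ∧ b.2.2 ∈ U' \ U)) ?_).trans (Nat.add_le_add_left (cn_or _ _) _)
        rintro x ⟨_, g1, _, g2, g3, g4⟩
        have g5 := hU' g2
        have g6 := hU' g3
        simp only [mem_sdiff]
        tauto
      rw [box3, box3, E.cQ, cP] at a1
      have a2 := hw u huU
      refine a1.trans ?_
      rw [Nat.le_div_iff_mul_le (by norm_num)]
      have a3 : 1000 * (U' \ U).card * N ^ 2 ≤ N * N ^ 2 := Nat.mul_le_mul_right _ hd
      nlinarith
    · have : cn (fun b : V × V × V => u ∈ S ∩ P ∧ b.1 ∈ Q ∧ u ∈ U' ∧ b.2.1 ∈ U' ∧ b.2.2 ∈ U' ∧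
          R b.1 u b.2.1 b.2.2) = 0 := by
        by_contra h
        obtain ⟨a, ha⟩ := cn_pos (Nat.pos_of_ne_zero h)
        tauto
      exact this.trans_le (Nat.zero_le _)
  set c := cn (fun x : V × V × V × V => x.1 ∈ S ∩ P ∧ x.2.1 ∈ Q ∧ x.1 ∈ U' ∧ x.2.2.1 ∈ U' ∧ x.2.2.2 ∈ U' ∧
      R x.2.1 x.1 x.2.2.1 x.2.2.2) with hc
  have t1 : cn (fun x : V × V × V × V => x.2.1 ∈ S ∩ P ∧ x.1 ∈ Q ∧ x.2.1 ∈ U' ∧ x.2.2.1 ∈ U' ∧ x.2.2.2 ∈ U' ∧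
      R x.1 x.2.1 x.2.2.1 x.2.2.2) ≤ c := by
    refine cn_inj (fun x => (x.2.1, x.1, x.2.2.1, x.2.2.2)) (fun x h => h) ?_
    rintro ⟨a, b, c, d⟩ ⟨a', b', c', d'⟩ _ _ h; simp at h ⊢; tauto
  have t2 : cn (fun x : V × V × V × V => x.2.2.1 ∈ S ∩ P ∧ x.1 ∈ Q ∧ x.2.1 ∈ U' ∧ x.2.2.1 ∈ U' ∧ x.2.2.2 ∈ U' ∧
      R x.1 x.2.1 x.2.2.1 x.2.2.2) ≤ c := by
    refine cn_inj (fun x => (x.2.2.1, x.1, x.2.1, x.2.2.2))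
      (fun x h => ⟨h.1, h.2.1, h.2.2.2.1, h.2.2.1, h.2.2.2.2.1, E.hs.sw1 _ _ _ _ h.2.2.2.2.2⟩) ?_
    rintro ⟨a, b, c, d⟩ ⟨a', b', c', d'⟩ _ _ h; simp at h ⊢; tauto
  have t3 : cn (fun x : V × V × V × V => x.2.2.2 ∈ S ∩ P ∧ x.1 ∈ Q ∧ x.2.1 ∈ U' ∧ x.2.2.1 ∈ U' ∧ x.2.2.2 ∈ U' ∧
      R x.1 x.2.1 x.2.2.1 x.2.2.2) ≤ c := by
    refine cn_inj (fun x => (x.2.2.2, x.1, x.2.1, x.2.2.1))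
      (fun x h => ⟨h.1, h.2.1, h.2.2.2.2.1, h.2.2.1, h.2.2.2.1, E.hs.rot' h.2.2.2.2.2⟩) ?_
    rintro ⟨a, b, c, d⟩ ⟨a', b', c', d'⟩ _ _ h; simp at h ⊢; tauto
  have t23 := cn_or (fun x : V × V × V × V => x.2.2.1 ∈ S ∩ P ∧ x.1 ∈ Q ∧ x.2.1 ∈ U' ∧ x.2.2.1 ∈ U' ∧
      x.2.2.2 ∈ U' ∧ R x.1 x.2.1 x.2.2.1 x.2.2.2)
    (fun x : V × V × V × V => x.2.2.2 ∈ S ∩ P ∧ x.1 ∈ Q ∧ x.2.1 ∈ U' ∧ x.2.2.1 ∈ U' ∧ x.2.2.2 ∈ U' ∧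
      R x.1 x.2.1 x.2.2.1 x.2.2.2)
  have t123 := cn_or (fun x : V × V × V × V => x.2.1 ∈ S ∩ P ∧ x.1 ∈ Q ∧ x.2.1 ∈ U' ∧ x.2.2.1 ∈ U' ∧
      x.2.2.2 ∈ U' ∧ R x.1 x.2.1 x.2.2.1 x.2.2.2) (fun x : V × V × V × V =>
    (x.2.2.1 ∈ S ∩ P ∧ x.1 ∈ Q ∧ x.2.1 ∈ U' ∧ x.2.2.1 ∈ U' ∧ x.2.2.2 ∈ U' ∧
      R x.1 x.2.1 x.2.2.1 x.2.2.2) ∨ (x.2.2.2 ∈ S ∩ P ∧ x.1 ∈ Q ∧ x.2.1 ∈ U' ∧ x.2.2.1 ∈ U' ∧ x.2.2.2 ∈ U' ∧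
      R x.1 x.2.1 x.2.2.1 x.2.2.2))
  rw [s2] at h2
  have hQS : N ≤ 2 * (Q \ S).card := by
    have h := card_sdiff_add_card_inter Q S
    rw [inter_comm Q S, s1, E.cQ] at h
    omega
  obtain ⟨⟨q, u, x, y⟩, ⟨hq, hu, hx, hy, hR⟩, hn⟩ := cn_exists (lt_of_le_of_lt t123 (lt_of_lt_of_le (by
    have b1 : 3 * (N ^ 3 / 3) ≤ N ^ 3 := Nat.mul_div_le _ _
    have b2 : 3 * c ≤ 3 * (k * N ^ 3) := by
      have : 3 * j * (N ^ 3 / 3) = j * (3 * (N ^ 3 / 3)) := by ring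
      have : j * (3 * (N ^ 3 / 3)) ≤ k * N ^ 3 := Nat.mul_le_mul (by omega) b1
      omega
    have b3 : 2 * (N ^ 2 * (4 * N * k + 2)) ≤ 2 * ((Q \ S).card * (U'.card * (4 * N * k + 2))) := by
      have h5 : 2 * N ≤ U'.card := by omega
      calc 2 * (N ^ 2 * (4 * N * k + 2)) = N * ((2 * N) * (4 * N * k + 2)) := by ring
        _ ≤ (2 * (Q \ S).card) * (U'.card * (4 * N * k + 2)) := by gcongr
        _ = _ := by ring
    have b4 : 3 * (k * N ^ 3) < N ^ 2 * (4 * N * k + 2) := by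
      have : 0 < N ^ 2 := by positivity
      have : 0 ≤ k * N ^ 3 := Nat.zero_le _
      nlinarith
    omega) h1))
  simp only [mem_sdiff] at hq
  have hmem : ∀ v, v ∈ U' → v ∉ S ∩ P → v ∉ S := fun v hv hvn hvS => hvn (mem_inter.2 ⟨hvS, hU' hv⟩)
  have nu : u ∉ S := hmem u hu (fun h => hn (Or.inl ⟨h, hq.1, hu, hx, hy, hR⟩))
  have nx : x ∉ S := hmem x hx (fun h => hn (Or.inr (Or.inl ⟨h, hq.1, hu, hx, hy, hR⟩)))
  have ny : y ∉ S := hmem y hy (fun h => hn (Or.inr (Or.inr ⟨h, hq.1, hu, hx, hy, hR⟩)))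
  refine ⟨S ∪ {q, u, x, y}, hS.union (Til.single hR) ?_, union_subset hSU ?_⟩
  · rw [Finset.disjoint_right]
    intro v hv
    simp only [mem_insert, mem_singleton] at hv
    rcases hv with h | h | h | h <;> rw [h]
    exacts [hq.2, nu, nx, ny]
  · intro v hv
    simp only [mem_insert, mem_singleton] at hv
    rcases hv with h | h | h | h <;> rw [h, mem_union]
    exacts [Or.inl hq.1, Or.inr hu, Or.inr hx, Or.inr hy]

theorem Ex.main (E : Ex Q P W U R N M) : ∃ k, Til R k univ := by
  have hN := E.Npos
  have hM := E.hM
  have UP : U ⊆ P := E.hP ▸ subset_union_right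
  have WP : W ⊆ P := E.hP ▸ subset_union_left
  have dWU := Finset.disjoint_left.1 E.hWU
  have cP : P.card = 3 * N := by
    rw [← E.hP, card_union_of_disjoint E.hWU, E.cW, E.cU]; ring
  have smallM : ∀ a d : ℕ, a * M ≤ d * N → 10 ^ 7 * a ≤ d * N := fun a d h =>
    le_trans (by rw [mul_comm]; exact Nat.mul_le_mul_left _ hM) h
  obtain ⟨B0, cB0, gq, gw, gu⟩ := E.bad
  have cB0' := smallM _ _ cB0
  set C := FS (fun v : V => v ∈ P ∧ N ^ 3 ≤ 4 * wc Q U R v) with hC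
  have CP : C ⊆ P := fun v hv => (mem_FS.1 hv).1
  have mC : ∀ v ∈ C, N ^ 3 ≤ 4 * wc Q U R v := fun v hv => (mem_FS.1 hv).2
  have nC : ∀ v ∈ P, v ∉ C → ¬ N ^ 3 ≤ 4 * wc Q U R v := fun v hv hn h => hn (mem_FS.2 ⟨hv, h⟩)
  have cCU := smallM _ _ (E.CU (C ∩ U) (fun v hv => mC v (mem_inter.1 hv).1) inter_subset_right)
  have cWC := smallM _ _ (E.WC (W \ C) (fun v hv => nC v (WP (mem_sdiff.1 hv).1) (mem_sdiff.1 hv).2)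
    sdiff_subset)
  set Z := FS (fun v : V => v ∈ P ∧ ¬ N ^ 3 ≤ 4 * uc Q W U R v) with hZ
  have nZ : ∀ v ∈ P, v ∉ Z → N ^ 3 ≤ 4 * uc Q W U R v := fun v hv hn => by
    by_contra h; exact hn (mem_FS.2 ⟨hv, h⟩)
  have ZP : Z ⊆ P := fun v hv => (mem_FS.1 hv).1
  have cZW := smallM _ _ (E.ZW (Z ∩ W) (fun v hv => (mem_FS.1 (mem_inter.1 hv).1).2) inter_subset_right)
  have cZU := smallM _ _ (E.ZU (Z ∩ U) (fun v hv => (mem_FS.1 (mem_inter.1 hv).1).2) inter_subset_right)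
  have ZC : Z ⊆ C := by
    intro v hv
    by_contra hc
    have h1 := nC v (ZP hv) hc
    have h2 := (mem_FS.1 hv).2
    have h3 := E.wcuc (ZP hv)
    have h4 : 100 * N ^ 2 ≤ N * N ^ 2 := Nat.mul_le_mul_right _ (by omega)
    have h5 : N * N ^ 2 = N ^ 3 := by ring
    omega
  have cZ : Z.card ≤ (Z ∩ W).card + (Z ∩ U).card := by
    have : Z = (Z ∩ W) ∪ (Z ∩ U) := by
      rw [← inter_union_distrib_left, E.hP, inter_eq_left.2 ZP]
    conv_lhs => rw [this]
    exact card_union_le _ _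
  have mk : ∀ W' : Finset V, W' ⊆ C → Z ⊆ W' → Xt Q P W U W' (P \ W') (B0 ∪ ((W \ W') ∪ (W' ∩ U))) R N := by
    intro W' hW'C hZW'
    refine ⟨E.hs, E.hQP, E.cV, E.hWU, E.hP, disjoint_sdiff, union_sdiff_of_subset (hW'C.trans CP),
      ?_, ?_, ?_, ?_, ?_, E.bq, ?_, ?_, E.ww⟩
    · intro v hv hw
      simp only [mem_union, mem_sdiff, mem_inter] at hv
      tauto
    · intro v hv hu
      simp only [mem_union, mem_sdiff, mem_inter] at hv ⊢
      have := UP hu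
      tauto
    · exact fun q hq => gq q (fun h => hq (mem_union_left _ h))
    · exact fun q hq => gw q (fun h => hq (mem_union_left _ h))
    · exact fun q hq => gu q (fun h => hq (mem_union_left _ h))
    · exact fun w hw => mC w (hW'C hw)
    · exact fun u hu => nZ u (mem_sdiff.1 hu).1 (fun h => (mem_sdiff.1 hu).2 (hZW' h))
  have cB : ∀ W' : Finset V, W' ⊆ C → (B0 ∪ ((W \ W') ∪ (W' ∩ U))).card ≤
      B0.card + ((W \ W').card + (C ∩ U).card) := fun W' h =>
    (card_union_le _ _).trans (Nat.add_le_add_left ((card_union_le _ _).trans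
      (Nat.add_le_add_left (card_le_card (inter_subset_inter_right h)) _)) _)
  rcases le_or_gt N C.card with hcase | hcase
  · obtain ⟨W', hZW', hW'C, cW'⟩ := exists_subsuperset_card_eq (n := N) ZC (by omega) hcase
    have h1 : (W \ W').card = (W' \ W).card := by
      have a := card_sdiff_add_card_inter W W'
      have b := card_sdiff_add_card_inter W' W
      rw [inter_comm W' W, cW'] at b
      rw [E.cW] at a
      omega
    have h2 : (W' \ W).card ≤ (C ∩ U).card := by
      refine card_le_card (fun v hv => ?_)
      have := CP (hW'C (mem_sdiff.1 hv).1)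
      rw [← E.hP, mem_union] at this
      exact mem_inter.2 ⟨hW'C (mem_sdiff.1 hv).1, this.resolve_left (mem_sdiff.1 hv).2⟩
    have h3 := cB W' hW'C
    refine (mk W' hW'C hZW').finish _ ?_ (by omega) _ univ N ?_ ?_ ?_ rfl le_rfl
    · rw [inter_univ, compl_univ, card_empty]; omega
    · rw [univ_inter, E.cQ]
    · rw [univ_inter, cW']
    · rw [univ_inter, card_sdiff_of_subset (hW'C.trans CP), cW', cP]; omega
  · have c1 : C.card + (W \ C).card ≥ N := by
      have a := card_sdiff_add_card_inter W C
      rw [E.cW] at a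
      have := card_le_card (inter_subset_right : W ∩ C ⊆ C)
      omega
    obtain ⟨k, hk⟩ : ∃ k, N = C.card + (k + 1) := ⟨N - C.card - 1, by omega⟩
    have cU' : (P \ C).card = 2 * N + (k + 1) := by
      rw [card_sdiff_of_subset CP, cP]; omega
    have hPU : ((P \ C) \ U).card ≤ (W \ C).card := by
      refine card_le_card (fun v hv => ?_)
      simp only [mem_sdiff, ← E.hP, mem_union] at hv ⊢
      tauto
    obtain ⟨S, hS, hSU⟩ := E.greedy (sdiff_subset : P \ C ⊆ P) k cU' (by omega)
      (fun v hv => nC v (mem_sdiff.1 hv).1 (mem_sdiff.1 hv).2) (by omega) (k + 1) le_rfl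
    obtain ⟨s1, s2, s3⟩ := hS.cards E.hs
    have dQP := Finset.disjoint_left.1 E.hs.disj
    have s4 : S ∩ C = ∅ := by
      rw [eq_empty_iff_forall_notMem]
      intro v hv
      obtain ⟨h1, h2⟩ := mem_inter.1 hv
      rcases mem_union.1 (hSU h1) with h | h
      · exact dQP h (CP h2)
      · exact (mem_sdiff.1 h).2 h2
    have s5 : S ∩ (P \ C) = S ∩ P := by
      ext v
      simp only [mem_inter, mem_sdiff]
      refine ⟨fun h => ⟨h.1, h.2.1⟩, fun h => ⟨h.1, h.2, fun hc => ?_⟩⟩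
      have : v ∈ S ∩ C := mem_inter.2 ⟨h.1, hc⟩
      rw [s4] at this; simp at this
    have e1 := card_sdiff_inter Q (subset_univ S)
    have e2 := card_sdiff_inter C (subset_univ S)
    have e3 := card_sdiff_inter (P \ C) (subset_univ S)
    rw [univ_inter, s1, E.cQ] at e1
    rw [univ_inter, s4, card_empty] at e2
    rw [univ_inter, s5, s2, cU'] at e3
    have cS : S.card = 4 * (k + 1) := by
      have : S = (S ∩ Q) ∪ (S ∩ P) := by
        rw [← inter_union_distrib_left, inter_eq_left.2 s3]
      rw [this, card_union_of_disjoint, s1, s2]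
      · ring
      · exact disjoint_of_subset_left inter_subset_right
          (disjoint_of_subset_right inter_subset_right E.hs.disj)
    have hcc : (univ \ S)ᶜ = S := by ext v; simp
    have h3 := cB C Subset.rfl
    have h4 := card_le_card (inter_subset_left : (B0 ∪ ((W \ C) ∪ (C ∩ U))) ∩ (univ \ S) ⊆ _)
    obtain ⟨k', hk'⟩ := (mk C Subset.rfl ZC).finish (4 * (k + 1) +
      8 * ((B0 ∪ ((W \ C) ∪ (C ∩ U))) ∩ (univ \ S)).card) (by omega) (by omega) _ (univ \ S) C.card
      (by omega) (by omega) (by omega) rfl (by rw [hcc, cS])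
    refine ⟨k + 1 + k', ?_⟩
    have := hS.union hk' disjoint_sdiff
    rwa [union_sdiff_of_subset (subset_univ S)] at this

end ext
end PM13


namespace PM13
open Finset
set_option linter.unusedSectionVars false
set_option linter.unusedVariables false

lemma core_arith1 {N N' k d C c : ℕ} (hN : N' ≤ N) (hd : d ≤ 2 * k)
    (hk : 640000000 * k ≤ N) (h0 : N ^ 4 < 10 ^ 7 * C)
    (h1 : C ≤ c + ((k * (2 * N) * (2 * N) * (2 * N) + N * d * (2 * N) * (2 * N)) +
      (N * (2 * N) * d * (2 * N) + N * (2 * N) * (2 * N) * d))) :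
    N' ^ 4 ≤ (2 * 10 ^ 7) * c := by
  have e4 : N' ^ 4 ≤ N ^ 4 := Nat.pow_le_pow_left hN 4
  have e5 : 640000000 * k * N ^ 3 ≤ N * N ^ 3 := Nat.mul_le_mul_right _ hk
  have e1 : d * N ^ 3 ≤ 2 * k * N ^ 3 := Nat.mul_le_mul_right _ hd
  have r1 : N * N ^ 3 = N ^ 4 := by ring
  have r2 : 640000000 * k * N ^ 3 = 640000000 * (k * N ^ 3) := by ring
  have r3 : 2 * k * N ^ 3 = 2 * (k * N ^ 3) := by ring
  have r4 : (k * (2 * N) * (2 * N) * (2 * N) + N * d * (2 * N) * (2 * N)) +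
      (N * (2 * N) * d * (2 * N) + N * (2 * N) * (2 * N) * d) = 8 * (k * N ^ 3) + 12 * (d * N ^ 3) := by
    ring
  rw [r4] at h1
  rw [r1, r2] at e5
  rw [r3] at e1
  generalize k * N ^ 3 = X at *
  generalize d * N ^ 3 = Y at *
  generalize N ^ 4 = Z at *
  generalize N' ^ 4 = Z' at *
  omega

set_option maxHeartbeats 2000000 in
theorem core : ∃ N0, ∀ N ≥ N0, ∀ (V : Type) [Fintype V] [DecidableEq V] (Q P : Finset V)
    (R : V → V → V → V → Prop), Sys Q P R → Q ∪ P = univ → Q.card = N → P.card = 3 * N →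
    (∀ q ∈ Q, ∀ u ∈ P, 5 * N ^ 2 + 4 ≤ 7 * N + cn (fun x : V × V => R q u x.1 x.2)) →
    ∃ k, Til R k univ := by
  obtain ⟨N1, habs⟩ := absorber (2 ^ 100) (by norm_num)
  refine ⟨max N1 (2 ^ 150), ?_⟩
  intro N hN V _ _ Q P R hs hQP cQ cP hdeg
  have hN1 : N1 ≤ N := (le_max_left _ _).trans hN
  have hN2 : 2 ^ 150 ≤ N := (le_max_right _ _).trans hN
  have cV : Fintype.card V = 4 * N := by
    rw [← card_univ, ← hQP, card_union_of_disjoint hs.disj, cQ, cP]; ring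
  by_cases hex : ∃ U ⊆ P, U.card = 2 * N ∧ 10 ^ 7 * cn (fun x : V × V × V × V => x.1 ∈ Q ∧ x.2.1 ∈ U ∧
      x.2.2.1 ∈ U ∧ x.2.2.2 ∈ U ∧ R x.1 x.2.1 x.2.2.1 x.2.2.2) ≤ N ^ 4
  · obtain ⟨U, hUP, cU, hU⟩ := hex
    have E : Ex Q P (P \ U) U R N (10 ^ 7) :=
      ⟨hs, hQP, cV, sdiff_disjoint, sdiff_union_of_subset hUP, cQ, by
        rw [card_sdiff_of_subset hUP, cP, cU]; omega, cU, hdeg, hU, le_rfl, by omega⟩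
    exact E.main
  push Not at hex
  obtain ⟨S, kS, hS, hkS, cS, hSabs⟩ := habs N hN1 V Q P R hs cQ cP cV (fun q hq u hu => by
    have := hdeg q hq u hu; omega)
  obtain ⟨s1, s2, s3⟩ := hS.cards hs
  set a := N / 2 ^ 100 with ha
  have ha1 : 2 ^ 100 * a ≤ N := Nat.mul_div_le _ _
  have ha2 : 2 ^ 50 ≤ a := by
    rw [ha, Nat.le_div_iff_mul_le (by norm_num)]
    exact le_trans (by norm_num) hN2
  clear_value a
  have dQP := Finset.disjoint_left.1 hs.disj
  set R' : V → V → V → V → Prop := fun q x y z => R q x y z ∧ q ∉ S ∧ x ∉ S ∧ y ∉ S ∧ z ∉ S with hR'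
  have hs' : Sys (Q \ S) (P \ S) R' := by
    refine ⟨disjoint_of_subset_left sdiff_subset (disjoint_of_subset_right sdiff_subset hs.disj),
      ?_, ?_, ?_, ?_⟩
    · rintro q x y z ⟨h, h1, h2, h3, h4⟩
      obtain ⟨m1, m2, m3, m4⟩ := hs.mem _ _ _ _ h
      exact ⟨mem_sdiff.2 ⟨m1, h1⟩, mem_sdiff.2 ⟨m2, h2⟩, mem_sdiff.2 ⟨m3, h3⟩, mem_sdiff.2 ⟨m4, h4⟩⟩
    · rintro q x y z ⟨h, _⟩
      exact hs.ne _ _ _ _ h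
    · rintro q x y z ⟨h, h1, h2, h3, h4⟩
      exact ⟨hs.sw1 _ _ _ _ h, h1, h3, h2, h4⟩
    · rintro q x y z ⟨h, h1, h2, h3, h4⟩
      exact ⟨hs.sw2 _ _ _ _ h, h1, h2, h4, h3⟩
  have cQ' : (Q \ S).card = N - kS := by
    have := card_sdiff_add_card_inter Q S
    rw [inter_comm, s1, cQ] at this; omega
  have cP' : (P \ S).card = 3 * (N - kS) := by
    have := card_sdiff_add_card_inter P S
    rw [inter_comm, s2, cP] at this; omega
  have hkN : 2 * kS ≤ N := by omega
  set N' := N - kS with hN'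
  have hNN' : N ≤ 2 * N' := by omega
  have hN'N : N' ≤ N := by omega
  -- degree condition
  have hdeg' : ∀ q ∈ Q \ S, ∀ u ∈ P \ S, 5 * N' ^ 2 ≤ (7 * N + 2 * S.card * (4 * N)) +
      cn (fun x : V × V => R' q u x.1 x.2) := by
    intro q hq u hu
    have d := hdeg q (mem_sdiff.1 hq).1 u (mem_sdiff.1 hu).1
    have h1 : cn (fun x : V × V => R q u x.1 x.2) ≤ cn (fun x : V × V => R' q u x.1 x.2) +
        (cn (fun x : V × V => x.1 ∈ S) + cn (fun x : V × V => x.2 ∈ S)) := by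
      refine (cn_cover (q := fun x : V × V => R' q u x.1 x.2) (r := fun x : V × V => x.1 ∈ S ∨ x.2 ∈ S)
        ?_).trans (Nat.add_le_add_left (cn_or _ _) _)
      intro x h
      have a1 := (mem_sdiff.1 hq).2
      have a2 := (mem_sdiff.1 hu).2
      simp only [hR']
      tauto
    have h2 := touch2 S (fun x : V × V => x) (fun x y h => h)
    have h3 := touch2 S (fun x : V × V => (x.2, x.1)) (by
      rintro ⟨a, b⟩ ⟨a', b'⟩ h; simp at h ⊢; tauto)
    rw [cV] at h2 h3
    have h4 : N' ^ 2 ≤ N ^ 2 := Nat.pow_le_pow_left hN'N 2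
    nlinarith
  -- non-extremality
  have hext : ∀ U ⊆ P \ S, 2 * N' ≤ U.card → N' ^ 4 ≤ (2 * 10 ^ 7) * cn (fun x : V × V × V × V =>
      R' x.1 x.2.1 x.2.2.1 x.2.2.2 ∧ x.2.1 ∈ U ∧ x.2.2.1 ∈ U ∧ x.2.2.2 ∈ U) := by
    intro U hU cU
    obtain ⟨U1, hU1P, cU1, hU1⟩ : ∃ U1 ⊆ P, U1.card = 2 * N ∧ (U1 \ U).card ≤ 2 * kS := by
      rcases le_or_gt (2 * N) U.card with h | h
      · obtain ⟨U1, h1, h2⟩ := exists_subset_card_eq h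
        refine ⟨U1, h1.trans (hU.trans sdiff_subset), h2, ?_⟩
        rw [sdiff_eq_empty_iff_subset.2 h1]; simp
      · obtain ⟨U1, h1, h2, h3⟩ := exists_subsuperset_card_eq (n := 2 * N) (hU.trans sdiff_subset) h.le
          (by omega)
        refine ⟨U1, h2, h3, ?_⟩
        rw [card_sdiff_of_subset h1]; omega
    have h0 := hex U1 hU1P cU1
    have h1 : cn (fun x : V × V × V × V => x.1 ∈ Q ∧ x.2.1 ∈ U1 ∧
      x.2.2.1 ∈ U1 ∧ x.2.2.2 ∈ U1 ∧ R x.1 x.2.1 x.2.2.1 x.2.2.2) ≤ cn (fun x : V × V × V × V =>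
      R' x.1 x.2.1 x.2.2.1 x.2.2.2 ∧ x.2.1 ∈ U ∧ x.2.2.1 ∈ U ∧ x.2.2.2 ∈ U) +
      ((cn (fun x : V × V × V × V => x.1 ∈ S ∩ Q ∧ x.2.1 ∈ U1 ∧ x.2.2.1 ∈ U1 ∧ x.2.2.2 ∈ U1) +
        cn (fun x : V × V × V × V => x.1 ∈ Q ∧ x.2.1 ∈ U1 \ U ∧ x.2.2.1 ∈ U1 ∧ x.2.2.2 ∈ U1)) +
        (cn (fun x : V × V × V × V => x.1 ∈ Q ∧ x.2.1 ∈ U1 ∧ x.2.2.1 ∈ U1 \ U ∧ x.2.2.2 ∈ U1) +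
        cn (fun x : V × V × V × V => x.1 ∈ Q ∧ x.2.1 ∈ U1 ∧ x.2.2.1 ∈ U1 ∧ x.2.2.2 ∈ U1 \ U))) := by
      refine (cn_cover (q := fun x : V × V × V × V =>
        R' x.1 x.2.1 x.2.2.1 x.2.2.2 ∧ x.2.1 ∈ U ∧ x.2.2.1 ∈ U ∧ x.2.2.2 ∈ U) (r := fun x =>
        ((x.1 ∈ S ∩ Q ∧ x.2.1 ∈ U1 ∧ x.2.2.1 ∈ U1 ∧ x.2.2.2 ∈ U1) ∨
        (x.1 ∈ Q ∧ x.2.1 ∈ U1 \ U ∧ x.2.2.1 ∈ U1 ∧ x.2.2.2 ∈ U1)) ∨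
        ((x.1 ∈ Q ∧ x.2.1 ∈ U1 ∧ x.2.2.1 ∈ U1 \ U ∧ x.2.2.2 ∈ U1) ∨
        (x.1 ∈ Q ∧ x.2.1 ∈ U1 ∧ x.2.2.1 ∈ U1 ∧ x.2.2.2 ∈ U1 \ U))) ?_).trans
        (Nat.add_le_add_left ((cn_or _ _).trans (Nat.add_le_add (cn_or _ _) (cn_or _ _))) _)
      rintro ⟨q, x, y, z⟩ ⟨h1, h2, h3, h4, h5⟩
      have hUS : ∀ v, v ∈ U → v ∉ S := fun v hv => (mem_sdiff.1 (hU hv)).2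
      by_cases hq : q ∈ S
      · exact Or.inr (Or.inl (Or.inl ⟨mem_inter.2 ⟨hq, h1⟩, h2, h3, h4⟩))
      by_cases hx : x ∈ U
      swap
      · exact Or.inr (Or.inl (Or.inr ⟨h1, mem_sdiff.2 ⟨h2, hx⟩, h3, h4⟩))
      by_cases hy : y ∈ U
      swap
      · exact Or.inr (Or.inr (Or.inl ⟨h1, h2, mem_sdiff.2 ⟨h3, hy⟩, h4⟩))
      by_cases hz : z ∈ U
      swap
      · exact Or.inr (Or.inr (Or.inr ⟨h1, h2, h3, mem_sdiff.2 ⟨h4, hz⟩⟩))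
      exact Or.inl ⟨⟨h5, hq, hUS _ hx, hUS _ hy, hUS _ hz⟩, hx, hy, hz⟩
    rw [box4, box4, box4, box4, s1, cQ, cU1] at h1
    set c := cn (fun x : V × V × V × V =>
      R' x.1 x.2.1 x.2.2.1 x.2.2.2 ∧ x.2.1 ∈ U ∧ x.2.2.1 ∈ U ∧ x.2.2.2 ∈ U)
    exact core_arith1 hN'N hU1 (by omega) h0 h1
  obtain ⟨k, T, hT, hkm⟩ := almost (m := a) hs' cQ' cP' hdeg' (2 * 10 ^ 7) (by norm_num) hext
    (2 ^ 21 * (2 * 10 ^ 7)) rfl (by omega) (by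
      have h1 : 2 ^ 21 * (2 * 10 ^ 7) * 56 ≤ N := by omega
      have h2 : 2 ^ 21 * (2 * 10 ^ 7) * 64 * S.card ≤ N := by omega
      have h3 := Nat.mul_le_mul_right N h1
      have h4 := Nat.mul_le_mul_right N h2
      have h5 : N ^ 2 ≤ (2 * N') ^ 2 := Nat.pow_le_pow_left hNN' 2
      have h6 : (2 * N') ^ 2 = 4 * N' ^ 2 := by ring
      have h7 : N * N = N ^ 2 := by ring
      rw [h6] at h5
      rw [h7] at h3 h4
      nlinarith) (by omega) (by omega)
  obtain ⟨t1, t2, t3⟩ := hT.cards hs'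
  have hTS : Disjoint T S := by
    rw [Finset.disjoint_left]
    intro v hv hvS
    rcases mem_union.1 (t3 hv) with h | h
    · exact (mem_sdiff.1 h).2 hvS
    · exact (mem_sdiff.1 h).2 hvS
  obtain ⟨t1', t2', t3'⟩ := (hT.mono (R' := R) (fun q x y z h => h.1)).cards hs
  have hkN' : k ≤ N' := by
    rw [← t1, ← cQ']; exact card_le_card inter_subset_right
  have uc : ∀ Y : Finset V, ((S ∪ T) ∩ Y).card = (S ∩ Y).card + (T ∩ Y).card := by
    intro Y
    rw [union_inter_distrib_right, card_union_of_disjoint]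
    exact disjoint_of_subset_left inter_subset_left
      (disjoint_of_subset_right inter_subset_left hTS.symm)
  have z1 := card_sdiff_inter Q (subset_univ (S ∪ T))
  have z2 := card_sdiff_inter P (subset_univ (S ∪ T))
  rw [univ_inter, uc, s1, t1', cQ] at z1
  rw [univ_inter, uc, s2, t2', cP] at z2
  obtain ⟨k', hk'⟩ := hSabs (univ \ (S ∪ T))
    (disjoint_of_subset_right subset_union_left sdiff_disjoint) (by rw [hQP]; exact subset_univ _)
    (N' - k) (by omega) (by omega) (by omega)
  refine ⟨k' + k, ?_⟩
  have := hk'.union (hT.mono (R' := R) (fun q x y z h => h.1)) (by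
    rw [disjoint_union_left]
    exact ⟨hTS.symm, disjoint_of_subset_right subset_union_right sdiff_disjoint⟩)
  convert this using 1
  ext v
  simp only [mem_univ, mem_union, mem_sdiff, true_and, true_iff]
  tauto

end PM13


namespace PM13
open Finset
set_option linter.unusedSectionVars false
set_option linter.unusedVariables false

section fin
variable {V : Type} [Fintype V] [DecidableEq V]

lemma edge_sys {Q P : Finset V} (H : Finset (Finset V)) (hd : Disjoint Q P) :
    Sys Q P (fun q x y z => (q ∈ Q ∧ x ∈ P ∧ y ∈ P ∧ z ∈ P) ∧ (x ≠ y ∧ x ≠ z ∧ y ≠ z) ∧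
      ({q, x, y, z} : Finset V) ∈ H) := by
  refine ⟨hd, fun q x y z h => h.1, fun q x y z h => h.2.1, ?_, ?_⟩
  · rintro q x y z ⟨⟨a, b, c, d⟩, ⟨e, f, g⟩, h⟩
    refine ⟨⟨a, c, b, d⟩, ⟨e.symm, g, f⟩, ?_⟩
    rw [Finset.insert_comm y x]; exact h
  · rintro q x y z ⟨⟨a, b, c, d⟩, ⟨e, f, g⟩, h⟩
    refine ⟨⟨a, b, d, c⟩, ⟨f, e, g.symm⟩, ?_⟩
    rw [Finset.pair_comm z y]; exact h

lemma edge_deg {Q P : Finset V} (H : Finset (Finset V)) (hd : Disjoint Q P) (hu : Q ∪ P = univ)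
    (hH : ∀ e ∈ H, (e ∩ Q).card = 1 ∧ (e ∩ P).card = 3) {q u : V} (hq : q ∈ Q) (hx : u ∈ P) :
    2 * (H.filter (fun e => u ∈ e ∧ q ∈ e)).card ≤ cn (fun x : V × V =>
      (q ∈ Q ∧ u ∈ P ∧ x.1 ∈ P ∧ x.2 ∈ P) ∧ (u ≠ x.1 ∧ u ≠ x.2 ∧ x.1 ≠ x.2) ∧
      ({q, u, x.1, x.2} : Finset V) ∈ H) := by
  have key : ∀ e ∈ H.filter (fun e => u ∈ e ∧ q ∈ e), ∃ x y, x ≠ y ∧ u ≠ x ∧ u ≠ y ∧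
      x ∈ P ∧ y ∈ P ∧ e = {q, u, x, y} := by
    intro e he
    obtain ⟨he, hue, hqe⟩ := mem_filter.1 he
    obtain ⟨h1, h2⟩ := hH e he
    obtain ⟨q', hq'⟩ := card_eq_one.1 h1
    have hqq : q = q' := by
      have : q ∈ e ∩ Q := mem_inter.2 ⟨hqe, hq⟩
      rw [hq'] at this; exact mem_singleton.1 this
    subst hqq
    have hm : u ∈ e ∩ P := mem_inter.2 ⟨hue, hx⟩
    have h3 : ((e ∩ P).erase u).card = 2 := by rw [card_erase_of_mem hm, h2]
    obtain ⟨x, y, hxy, hE⟩ := card_eq_two.1 h3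
    have mx : x ∈ (e ∩ P).erase u := by rw [hE]; simp
    have my : y ∈ (e ∩ P).erase u := by rw [hE]; simp
    rw [mem_erase, mem_inter] at mx my
    refine ⟨x, y, hxy, mx.1.symm, my.1.symm, mx.2.2, my.2.2, ?_⟩
    ext v
    have w1 : v ∈ e ∩ Q ↔ v ∈ ({q} : Finset V) := by rw [hq']
    have w2 : v ∈ (e ∩ P).erase u ↔ v ∈ ({x, y} : Finset V) := by rw [hE]
    have w3 : v ∈ Q ∪ P := by rw [hu]; exact mem_univ _
    simp only [mem_inter, mem_erase, mem_insert, mem_singleton, mem_union] at w1 w2 w3 ⊢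
    by_cases hvu : v = u
    · subst hvu; simp [hue]
    · tauto
  unfold cn
  refine mul_card_image_le_card_of_maps_to (f := fun x : V × V => ({q, u, x.1, x.2} : Finset V)) ?_ 2 ?_
  · intro x hx'
    have h := mem_FS.1 hx'
    exact mem_filter.2 ⟨h.2.2, by simp, by simp⟩
  · intro e he
    obtain ⟨x, y, h1, h2, h3, h4, h5, rfl⟩ := key e he
    have he' := (mem_filter.1 he).1
    have hyx : ({q, u, y, x} : Finset V) = {q, u, x, y} := by rw [Finset.pair_comm y x]
    have hc : ({(x, y), (y, x)} : Finset (V × V)).card = 2 :=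
      card_pair (fun h => h1 (Prod.ext_iff.1 h).1)
    rw [← hc]
    apply card_le_card
    intro p hp
    rw [mem_filter]
    rcases mem_insert.1 hp with rfl | hp
    · exact ⟨mem_FS.2 ⟨⟨hq, hx, h4, h5⟩, ⟨h2, h3, h1⟩, he'⟩, rfl⟩
    · rw [mem_singleton] at hp
      subst hp
      exact ⟨mem_FS.2 ⟨⟨hq, hx, h5, h4⟩, ⟨h3, h2, h1.symm⟩, by rw [hyx]; exact he'⟩, hyx⟩

lemma deg_arith {N : ℕ} (hN : 2 ≤ N) :
    5 * N ^ 2 + 4 ≤ 7 * N + 2 * (Nat.choose (3 * N - 1) 2 - Nat.choose (2 * N) 2 + 1) := by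
  obtain ⟨m, rfl⟩ : ∃ m, N = m + 1 := ⟨N - 1, by omega⟩
  have h1 : 2 * Nat.choose (3 * (m + 1) - 1) 2 = (3 * m + 2) * (3 * m + 1) := by
    rw [Nat.choose_two_right, show 3 * (m + 1) - 1 = 3 * m + 2 by omega,
      show 3 * m + 2 - 1 = 3 * m + 1 by omega]
    exact Nat.mul_div_cancel' (Nat.even_mul_pred_self (3 * m + 2)).two_dvd
  have h2 : 2 * Nat.choose (2 * (m + 1)) 2 = (2 * m + 2) * (2 * m + 1) := by
    rw [Nat.choose_two_right, show 2 * (m + 1) = 2 * m + 2 by omega,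
      show 2 * m + 2 - 1 = 2 * m + 1 by omega]
    exact Nat.mul_div_cancel' (Nat.even_mul_pred_self (2 * m + 2)).two_dvd
  have h3 : (3 * m + 2) * (3 * m + 1) = 9 * m ^ 2 + 9 * m + 2 := by ring
  have h4 : (2 * m + 2) * (2 * m + 1) = 4 * m ^ 2 + 6 * m + 2 := by ring
  have h5 : 5 * (m + 1) ^ 2 = 5 * m ^ 2 + 10 * m + 5 := by ring
  rw [h5]
  omega

end fin
end PM13

/-- There exists `N` such that for every `n ∈ 3ℤ` with `n ≥ N`:
if `H` is a (1,3)-partite 4-graph with partition classes `Q, P`, `3|Q| = |P| = n`,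
and `d_H({u,v}) ≥ C(n-1,2) - C(2n/3,2) + 1` for all `u ∈ P` and `v ∈ Q`, then `H`
has a perfect matching. The vertex set is `Fin (n + n/3)`. -/
theorem perfect_matching_13_partite :
    ∃ N : ℕ, ∀ n : ℕ, 3 ∣ n → N ≤ n →
      ∀ (Q P : Finset (Fin (n + n / 3))) (H : Finset (Finset (Fin (n + n / 3)))),
        Disjoint Q P → Q ∪ P = Finset.univ →
        Q.card = n / 3 → P.card = n →
        (∀ e ∈ H, (e ∩ Q).card = 1 ∧ (e ∩ P).card = 3) →
        (∀ u ∈ P, ∀ v ∈ Q,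
          Nat.choose (n - 1) 2 - Nat.choose (2 * n / 3) 2 + 1 ≤
            (H.filter (fun e => u ∈ e ∧ v ∈ e)).card) →
        ∃ M ⊆ H, (∀ e ∈ M, ∀ f ∈ M, e ≠ f → Disjoint e f) ∧
          ∀ x : Fin (n + n / 3), ∃ e ∈ M, x ∈ e := by
  obtain ⟨N0, hcore⟩ := PM13.core
  refine ⟨3 * N0 + 6, ?_⟩
  intro n hn hNn Q P H hd hu cQ cP hH hdeg
  obtain ⟨N, hN⟩ := hn
  have hn3 : n / 3 = N := by omega
  have hn2 : 2 * n / 3 = 2 * N := by omega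
  obtain ⟨k, M, hM1, hM2, hM3, hM4⟩ := hcore N (by omega) (Fin (n + n / 3)) Q P _
    (PM13.edge_sys H hd) hu (cQ.trans hn3) (cP.trans hN) (by
      intro q hq u hx
      have h1 := PM13.edge_deg H hd hu hH hq hx
      have h2 := hdeg u hx q hq
      have h3 := PM13.deg_arith (N := N) (by omega)
      rw [hn2, show n - 1 = 3 * N - 1 by omega] at h2
      refine h3.trans (Nat.add_le_add_left ((Nat.mul_le_mul_left 2 h2).trans h1) _))
  refine ⟨M, ?_, hM2, ?_⟩
  · intro e he
    obtain ⟨q, x, y, z, hr, rfl⟩ := hM1 e he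
    exact hr.2.2
  · intro x
    have hx : x ∈ M.biUnion id := by rw [hM4]; exact Finset.mem_univ x
    obtain ⟨e, he, hxe⟩ := Finset.mem_biUnion.1 hx
    exact ⟨e, he, hxe⟩
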